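/- arXiv:1312.5668 — 3 statements merged into one kernel-verified Lean document; each statement's English description precedes it below -/
import Mathlib

section
/- Let k be a field of characteristic different from 2, let D (with embedding φ : kΓ → D) be a division ring of quotients of the group algebra kΓ of the Heisenberg group Γ, and let * be a k-involution on D induced by an involution ⋆ on Γ. Suppose there exist integers m, n, both odd, such that x⋆ = λ^m·x and y⋆ = λ^n·y. Then the multiplicative group D^× contains a free unitary pair. -/
/-- The commutator `g⁻¹h⁻¹gh` used in the paper's convention. -/
def commS {G : Type*} [Group G] (g h : G) : G := g⁻¹ * h⁻¹ * g * h

/-- Relations of the Heisenberg group: `[[x,y],x] = [[x,y],y] = 1`. -/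
def heisRels : Set (FreeGroup (Fin 2)) :=
  { commS (commS (FreeGroup.of 0) (FreeGroup.of 1)) (FreeGroup.of 0),
    commS (commS (FreeGroup.of 0) (FreeGroup.of 1)) (FreeGroup.of 1) }

/-- The Heisenberg group, presented by `x, y` with `[[x,y],x] = [[x,y],y] = 1`. -/
abbrev Heisenberg : Type := PresentedGroup heisRels

/-- The generator `x` of the Heisenberg group. -/
def Hx : Heisenberg := PresentedGroup.of 0

/-- The generator `y` of the Heisenberg group. -/
def Hy : Heisenberg := PresentedGroup.of 1

/-- The central element `λ = [x,y]`. -/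
def Hlam : Heisenberg := commS Hx Hy

/-- A pair of elements of a group is free if the induced map from the free group
on two generators is injective. -/
def IsFreePair {G : Type*} [Group G] (u v : G) : Prop :=
  Function.Injective ⇑(FreeGroup.lift (fun b : Bool => if b then u else v) : FreeGroup Bool →* G)

namespace HeisenbergFreePair

open HahnSeries

/-- Ping-pong for two infinite cyclic groups, phrased on the generators. -/
theorem isFreePair_of_ping_pong {G α : Type*} [Group G] [MulAction G α] {u v : G} {S T : Set α}
    (hS : S.Nonempty) (hT : T.Nonempty) (hST : Disjoint S T)
    (hu : ∀ a : ℤ, a ≠ 0 → ∀ x ∈ T, u ^ a • x ∈ S)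
    (hv : ∀ a : ℤ, a ≠ 0 → ∀ x ∈ S, v ^ a • x ∈ T) : IsFreePair u v := by
  unfold IsFreePair
  set a : Bool → G := fun b => if b then u else v with ha
  have hlift : (FreeGroup.lift a : FreeGroup Bool →* G) =
      (Monoid.CoprodI.lift fun i => FreeGroup.lift fun _ : Unit => a i).comp
        (freeGroupEquivCoprodI (ι := Bool)).toMonoidHom := by
    ext i
    simp [freeGroupEquivCoprodI]
  rw [hlift, MonoidHom.coe_comp]
  refine Function.Injective.comp ?_ freeGroupEquivCoprodI.injective
  refine Monoid.CoprodI.lift_injective_of_ping_pong (H := fun _ : Bool => FreeGroup Unit)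
    (fun i => FreeGroup.lift fun _ : Unit => a i) (Or.inr ⟨true, ?_⟩)
    (fun i => if i then S else T) ?_ ?_ ?_
  · have : Infinite (FreeGroup Unit) :=
      Infinite.of_surjective _ FreeGroup.freeGroupUnitEquivInt.surjective
    exact (Cardinal.natCast_le_aleph0 (n := 3)).trans (Cardinal.aleph0_le_mk _)
  · rintro (_ | _) <;> simpa
  · rintro (_ | _) (_ | _) h
    · exact absurd rfl h
    · simpa [Function.onFun] using hST.symm
    · simpa [Function.onFun] using hST
    · exact absurd rfl h
  · intro i j hij
    refine FreeGroup.freeGroupUnitEquivInt.forall_congr_left.mpr ?_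
    intro n hn
    have hn0 : n ≠ 0 := by
      rintro rfl
      exact hn (by simp [FreeGroup.freeGroupUnitEquivInt])
    have hlift_pow : (FreeGroup.lift fun _ : Unit => a i)
        (FreeGroup.freeGroupUnitEquivInt.symm n) = a i ^ n := by
      change FreeGroup.lift (fun _ => a i) (FreeGroup.of () ^ n) = _
      simp
    rw [hlift_pow]
    rintro _ ⟨x, hx, rfl⟩
    rcases i with _ | _ <;> rcases j with _ | _
    · exact absurd rfl hij
    · simpa [ha] using hv n hn0 x (by simpa using hx)
    · simpa [ha] using hu n hn0 x (by simpa using hx)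
    · exact absurd rfl hij

/-- Multiply the `n`-th coefficient of a Laurent series by `χ n`. -/
noncomputable def twist (R : Type*) [CommRing R] :
    (ℤ → R) →* Module.End R (HahnSeries ℤ R) where
  toFun χ :=
    { toFun := fun f => ⟨fun n => χ n * f.coeff n,
        f.isPWO_support.mono fun n hn => right_ne_zero_of_mul hn⟩
      map_add' := fun f g => by ext n; simp [mul_add]
      map_smul' := fun c f => by ext n; simp [mul_left_comm] }
  map_one' := by ext; simp
  map_mul' χ ψ := by
    refine LinearMap.ext fun f => ?_
    ext n
    simp [mul_assoc]

@[simp]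
theorem coeff_twist {R : Type*} [CommRing R] (χ : ℤ → R) (f : HahnSeries ℤ R) (n : ℤ) :
    (twist R χ f).coeff n = χ n * f.coeff n := rfl

/-- The automorphism `z ↦ -z` of Laurent series in `z`, as a linear map. -/
noncomputable def parity (R : Type*) [CommRing R] : Module.End R (HahnSeries ℤ R) :=
  twist R fun n => if Even n then 1 else -1

theorem parity_parity {R : Type*} [CommRing R] (f : HahnSeries ℤ R) :
    parity R (parity R f) = f := by
  ext n
  simp only [parity, coeff_twist]
  split_ifs <;> simp

theorem parity_single_mul {R : Type*} [CommRing R] (f : HahnSeries ℤ R) :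
    parity R (single 1 1 * f) = -(single 1 1 * parity R f) := by
  ext n
  simp only [parity, coeff_twist, coeff_single_mul, coeff_neg, one_mul, Int.even_sub_one]
  split_ifs <;> simp_all

theorem parity_one_add_pow_mul {R : Type*} [CommRing R] (p : ℕ) (f : HahnSeries ℤ R) :
    parity R ((1 + single 1 1) ^ p * f) = (1 - single 1 1) ^ p * parity R f := by
  induction p with
  | zero => simp
  | succ p ih =>
    rw [pow_succ', mul_assoc, add_mul, one_mul, map_add, parity_single_mul, ih, pow_succ']
    ring

theorem parity_one_sub_pow_mul {R : Type*} [CommRing R] (p : ℕ) (f : HahnSeries ℤ R) :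
    parity R ((1 - single 1 1) ^ p * f) = (1 + single 1 1) ^ p * parity R f := by
  conv_lhs => rw [← parity_parity f, ← parity_one_add_pow_mul, parity_parity]

theorem one_add_pow_ne {F : Type*} [Field F] (h2 : (2 : F) ≠ 0) {p : ℕ} (hp : p ≠ 0)
    {s : HahnSeries ℤ F} (hs : s = 1 ∨ s = -1) :
    (1 + single 1 1 : HahnSeries ℤ F) ^ p ≠ s * (1 - single 1 1) ^ p := by
  intro h
  let j : Polynomial F →+* HahnSeries ℤ F :=
    (ofPowerSeries ℤ F).comp (Polynomial.coeToPowerSeries.ringHom)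
  have hj : Function.Injective j :=
    ofPowerSeries_injective.comp (Polynomial.coe_injective F)
  have hX : j Polynomial.X = single 1 1 := by simp [j]
  obtain ⟨t, ht, hts⟩ : ∃ t : Polynomial F, j t = s ∧ (t = 1 ∨ t = -1) := by
    rcases hs with rfl | rfl
    · exact ⟨1, by simp, Or.inl rfl⟩
    · exact ⟨-1, by simp, Or.inr rfl⟩
  have hpoly : (1 + Polynomial.X : Polynomial F) ^ p = t * (1 - Polynomial.X) ^ p :=
    hj (by simpa [hX, ht] using h)
  have heval := congrArg (Polynomial.eval 1) hpoly
  simp [hp, one_add_one_eq_two, h2] at heval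

/-- A nonzero Laurent series which is even or odd. -/
def IsPure {F : Type*} [Field F] (h : HahnSeries ℤ F) : Prop :=
  h ≠ 0 ∧ (parity F h = h ∨ parity F h = -h)

/-- A Laurent series which is neither even nor odd. -/
def IsMixed {F : Type*} [Field F] (h : HahnSeries ℤ F) : Prop :=
  parity F h ≠ h ∧ parity F h ≠ -h

theorem IsMixed.ne_zero {F : Type*} [Field F] {h : HahnSeries ℤ F} (hh : IsMixed h) : h ≠ 0 := by
  rintro rfl
  exact hh.1 (map_zero _)

theorem IsPure.not_isMixed {F : Type*} [Field F] {h : HahnSeries ℤ F} (hh : IsPure h) :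
    ¬ IsMixed h := fun hm => hh.2.elim hm.1 hm.2

theorem IsMixed.exists_odd {F : Type*} [Field F] {h : HahnSeries ℤ F} (hh : IsMixed h) :
    ∃ n, ¬ Even n ∧ h.coeff n ≠ 0 := by
  by_contra! hc
  refine hh.1 ?_
  ext n
  by_cases hn : Even n
  · simp [parity, hn]
  · simp [parity, hn, hc n hn]

theorem IsMixed.exists_even {F : Type*} [Field F] {h : HahnSeries ℤ F} (hh : IsMixed h) :
    ∃ n, Even n ∧ h.coeff n ≠ 0 := by
  by_contra! hc
  refine hh.2 ?_
  ext n
  by_cases hn : Even n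
  · simp [parity, hn, hc n hn]
  · simp [parity, hn]

theorem isMixed_of_mul_eq {F : Type*} [Field F] (h2 : (2 : F) ≠ 0) {p : ℕ} (hp : p ≠ 0)
    {h h' : HahnSeries ℤ F} (hh : IsPure h)
    (heq : (1 - single 1 1) ^ p * h' = (1 + single 1 1) ^ p * h) : IsMixed h' := by
  obtain ⟨hne, hpar⟩ := hh
  have heq' := congrArg (parity F) heq
  rw [parity_one_sub_pow_mul, parity_one_add_pow_mul] at heq'
  by_contra hc
  have hpar' : parity F h' = h' ∨ parity F h' = -h' := by
    unfold IsMixed at hc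
    tauto
  obtain ⟨s, hs, hs'⟩ : ∃ s : HahnSeries ℤ F, (s = 1 ∨ s = -1) ∧
      (1 + single 1 1) ^ p * h' = s * ((1 - single 1 1) ^ p * h) := by
    rcases hpar with e | e <;> rcases hpar' with e' | e' <;> rw [e, e'] at heq'
    · exact ⟨1, Or.inl rfl, by linear_combination heq'⟩
    · exact ⟨-1, Or.inr rfl, by linear_combination -heq'⟩
    · exact ⟨-1, Or.inr rfl, by linear_combination heq'⟩
    · exact ⟨1, Or.inl rfl, by linear_combination -heq'⟩
  refine one_add_pow_ne h2 (Nat.mul_ne_zero hp two_ne_zero) hs (mul_right_cancel₀ hne ?_)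
  calc (1 + single 1 1) ^ (p * 2) * h
      = (1 + single 1 1) ^ p * ((1 + single 1 1) ^ p * h) := by ring
    _ = (1 - single 1 1) ^ p * ((1 + single 1 1) ^ p * h') := by rw [← heq]; ring
    _ = s * (1 - single 1 1) ^ (p * 2) * h := by rw [hs']; ring

theorem isMixed_of_mul_eq' {F : Type*} [Field F] (h2 : (2 : F) ≠ 0) {p : ℕ} (hp : p ≠ 0)
    {h h' : HahnSeries ℤ F} (hh : IsPure h)
    (heq : (1 + single 1 1) ^ p * h' = (1 - single 1 1) ^ p * h) : IsMixed h' := by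
  have hpure : IsPure (parity F h) := by
    rcases hh with ⟨hne, e | e⟩
    · exact ⟨by rwa [e], Or.inl (by rw [e, e])⟩
    · exact ⟨by rwa [e, neg_ne_zero], Or.inr (by rw [e, map_neg, e])⟩
  have heq' := congrArg (parity F) heq
  rw [parity_one_sub_pow_mul, parity_one_add_pow_mul] at heq'
  obtain ⟨h1, h2⟩ := isMixed_of_mul_eq h2 hp hpure heq'
  rw [parity_parity] at h1 h2
  exact ⟨h1.symm, fun e => h2 (by rw [e, neg_neg])⟩

/-- The ring homomorphism of Laurent series induced by a homomorphism of coefficient rings. -/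
noncomputable def mapRingHom {R S : Type*} [CommRing R] [CommRing S] (f : R →+* S) :
    HahnSeries ℤ R →+* HahnSeries ℤ S where
  toFun g := g.map f
  map_one' := by
    ext n
    simp [coeff_one, apply_ite f]
  map_mul' x y := HahnSeries.map_mul f.toNonUnitalRingHom
  map_zero' := by ext; simp
  map_add' x y := by ext; simp

@[simp]
theorem coeff_mapRingHom {R S : Type*} [CommRing R] [CommRing S] (f : R →+* S)
    (g : HahnSeries ℤ R) (n : ℤ) : (mapRingHom f g).coeff n = f (g.coeff n) := rfl

theorem mapRingHom_single {R S : Type*} [CommRing R] [CommRing S] (f : R →+* S) (n : ℤ) (r : R) :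
    mapRingHom f (single n r) = single n (f r) := by
  ext k
  by_cases h : k = n
  · subst h; simp
  · simp [coeff_single_of_ne h]

/-- Series over `K` which, up to a power of `ι ε`, are defined over `O` and whose reduction
modulo `ρ` satisfies `P`. -/
def reductionSet {O K F : Type*} [CommRing O] [Field K] [Field F] (ι : O →+* K) (ρ : O →+* F)
    (ε : O) (P : HahnSeries ℤ F → Prop) : Set (HahnSeries ℤ K) :=
  {f | ∃ (j : ℤ) (g : HahnSeries ℤ O), f = (ι ε ^ j) • mapRingHom ι g ∧ P (mapRingHom ρ g)}

theorem disjoint_reductionSet {O K F : Type*} [CommRing O] [Field K] [Field F] {ι : O →+* K}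
    (hι : Function.Injective ι) {ρ : O →+* F} {ε : O} (hε : ε ≠ 0) (hρε : ρ ε = 0)
    {P Q : HahnSeries ℤ F → Prop} (hP : ∀ h, P h → h ≠ 0) (hQ : ∀ h, Q h → h ≠ 0)
    (hPQ : ∀ h, P h → ¬ Q h) : Disjoint (reductionSet ι ρ ε P) (reductionSet ι ρ ε Q) := by
  have hE : ι ε ≠ 0 := fun h => hε (hι (by rw [h, map_zero]))
  have key : ∀ (j : ℤ) (p : ℕ) (g g' : HahnSeries ℤ O),
      ι ε ^ (j + p) • mapRingHom ι g = ι ε ^ j • mapRingHom ι g' →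
        mapRingHom ρ g' ≠ 0 → g = g' := by
    intro j p g g' h hg'
    have hcoeff : ∀ n, g'.coeff n = ε ^ p * g.coeff n := by
      intro n
      apply hι
      have hn := congrArg (fun f => f.coeff n) h
      simp only [coeff_smul, coeff_mapRingHom, smul_eq_mul, zpow_add₀ hE, zpow_natCast,
        mul_assoc] at hn
      rw [map_mul, map_pow]
      exact (mul_left_cancel₀ (zpow_ne_zero j hE) hn).symm
    rcases Nat.eq_zero_or_pos p with rfl | hp
    · ext n; simp [hcoeff n]
    · refine absurd ?_ hg'
      ext n
      simp [hcoeff n, hρε, hp.ne']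
  rw [Set.disjoint_left]
  rintro f ⟨j, g, hf, hg⟩ ⟨j', g', hf', hg'⟩
  have hgg : g = g' := by
    rcases le_total j j' with hle | hle
    · obtain ⟨p, rfl⟩ := Int.le.dest hle
      exact (key j p g' g (by rw [← hf', ← hf]) (hP _ hg)).symm
    · obtain ⟨p, rfl⟩ := Int.le.dest hle
      exact key j' p g g' (by rw [← hf', ← hf]) (hQ _ hg')
  subst hgg
  exact hPQ _ hg hg'

/-- The invertible operator rescaling coefficients by a family of units. -/
noncomputable def twistUnits (R : Type*) [CommRing R] :
    (ℤ → Rˣ) →* (Module.End R (HahnSeries ℤ R))ˣ :=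
  (Units.map (twist R)).comp MulEquiv.piUnits.symm.toMonoidHom

@[simp]
theorem coeff_twistUnits {R : Type*} [CommRing R] (d : ℤ → Rˣ) (f : HahnSeries ℤ R) (n : ℤ) :
    ((twistUnits R d : Module.End R (HahnSeries ℤ R)) f).coeff n = d n * f.coeff n := rfl

/-- Multiplication by a Laurent series, as an operator. -/
noncomputable def mulEnd (R : Type*) [CommRing R] :
    HahnSeries ℤ R →* Module.End R (HahnSeries ℤ R) where
  toFun w :=
    { toFun := fun f => w * f
      map_add' := mul_add w
      map_smul' := fun c f => by
        simp only [← C_mul_eq_smul, RingHom.id_apply]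
        ring }
  map_one' := LinearMap.ext one_mul
  map_mul' w w' := LinearMap.ext (mul_assoc w w')

@[simp]
theorem mulEnd_apply {R : Type*} [CommRing R] (w f : HahnSeries ℤ R) : mulEnd R w f = w * f := rfl

/-- The invertible operator of multiplication by an invertible series. -/
noncomputable def mulUnits (R : Type*) [CommRing R] :
    (HahnSeries ℤ R)ˣ →* (Module.End R (HahnSeries ℤ R))ˣ :=
  Units.map (mulEnd R)

@[simp]
theorem mulUnits_apply {R : Type*} [CommRing R] (w : (HahnSeries ℤ R)ˣ) (f : HahnSeries ℤ R) :
    (mulUnits R w : Module.End R (HahnSeries ℤ R)) f = w * f := rfl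

theorem isFreePair_twistUnits_mulUnits {O K F : Type*} [CommRing O] [Field K] [Field F]
    (h2 : (2 : F) ≠ 0) {ι : O →+* K} (hι : Function.Injective ι) {ρ : O →+* F}
    {ε : O} (hε : ε ≠ 0) (hρε : ρ ε = 0) {d : ℤ → Kˣ} {e : ℤ → Oˣ}
    (hd : ∀ n, (d n : K) = ι ε ^ (if Even n then 1 else -1 : ℤ) * ι (e n))
    {w : (HahnSeries ℤ O)ˣ}
    (hw : (1 - single 1 1) * mapRingHom ρ w = 1 + single 1 1) :
    IsFreePair (twistUnits K d) (mulUnits K (Units.map (mapRingHom ι).toMonoidHom w)) := by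
  have hE : ι ε ≠ 0 := fun h => hε (hι (by rw [h, map_zero]))
  have hpure : ∀ c : O, ρ c = 1 → IsPure (mapRingHom ρ (single 0 c)) := by
    intro c hc
    rw [mapRingHom_single, hc]
    refine ⟨by simp, Or.inl ?_⟩
    ext n
    by_cases hn : n = 0
    · subst hn; simp [parity]
    · simp [parity, hn]
  have hu : ∀ a : ℤ, a ≠ 0 → ∀ f ∈ reductionSet ι ρ ε IsMixed,
      twistUnits K d ^ a • f ∈ reductionSet ι ρ ε IsPure := by
    rintro a ha f ⟨j, g, rfl, hg⟩
    let c : ℤ → O := fun n => if (Even n ↔ 0 < a) then ε ^ (2 * a.natAbs) else 1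
    refine ⟨j - a.natAbs, twist O (fun n => c n * ((e n ^ a : Oˣ) : O)) g, ?_, ?_, ?_⟩
    · ext n
      have hda : ((d n ^ a : Kˣ) : K) = ι ε ^ (-(a.natAbs : ℤ)) * ι (c n) *
          ι ((e n ^ a : Oˣ) : O) := by
        have he : ι ((e n ^ a : Oˣ) : O) = (ι (e n)) ^ a := by
          change ((Units.map (ι : O →* K) (e n ^ a) : Kˣ) : K) = _
          rw [map_zpow, Units.val_zpow_eq_zpow_val]
          rfl
        rw [Units.val_zpow_eq_zpow_val, hd, mul_zpow, he, ← zpow_mul]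
        congr 1
        by_cases hn : Even n <;> by_cases hpos : 0 < a <;>
          simp only [c, hn, hpos, if_true, if_false, iff_true, iff_false, not_true, not_false_iff,
            map_pow, map_one, mul_one, one_mul]
        · rw [← zpow_natCast, ← zpow_add₀ hE]
          congr 1
          omega
        · congr 1
          omega
        · congr 1
          omega
        · rw [← zpow_natCast, ← zpow_add₀ hE]
          congr 1
          omega
      rw [← map_zpow, Units.smul_def, Module.End.smul_def, coeff_twistUnits]
      simp only [Pi.pow_apply, hda, coeff_smul, coeff_mapRingHom, smul_eq_mul, coeff_twist,
        map_mul, zpow_sub₀ hE, zpow_neg, div_eq_mul_inv]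
      ring
    · have hunit : ∀ n, ρ ((e n ^ a : Oˣ) : O) ≠ 0 := fun n =>
        ((e n ^ a).isUnit.map ρ).ne_zero
      obtain ⟨n, hn, hgn⟩ : ∃ n, ¬ (Even n ↔ 0 < a) ∧ (mapRingHom ρ g).coeff n ≠ 0 := by
        by_cases hpos : 0 < a
        · obtain ⟨n, hn, h⟩ := hg.exists_odd
          exact ⟨n, by tauto, h⟩
        · obtain ⟨n, hn, h⟩ := hg.exists_even
          exact ⟨n, by tauto, h⟩
      intro h0
      have hn0 := congrArg (fun f => f.coeff n) h0
      simp [c, hn, hunit] at hn0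
      exact hgn (by simpa using hn0)
    · have hap : 2 * a.natAbs ≠ 0 := by omega
      by_cases hpos : 0 < a
      · right
        ext n
        by_cases hn : Even n
        · simp [parity, c, hpos, hn, hρε, ha]
        · simp [parity, hn]
      · left
        ext n
        by_cases hn : Even n
        · simp [parity, hn]
        · simp only [parity, coeff_twist, coeff_mapRingHom, c, hpos, hn, iff_self, if_true, map_mul,
            map_pow, hρε, zero_pow hap, zero_mul, mul_zero]
  have hv : ∀ a : ℤ, a ≠ 0 → ∀ f ∈ reductionSet ι ρ ε IsPure,
      mulUnits K (Units.map (mapRingHom ι).toMonoidHom w) ^ a • f ∈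
        reductionSet ι ρ ε IsMixed := by
    rintro a ha f ⟨j, g, rfl, hg⟩
    refine ⟨j, ((w ^ a : (HahnSeries ℤ O)ˣ) : HahnSeries ℤ O) * g, ?_, ?_⟩
    · rw [← map_zpow, ← map_zpow, Units.smul_def, Module.End.smul_def, mulUnits_apply, map_mul]
      simp only [← C_mul_eq_smul]
      rw [mul_left_comm]
      rfl
    · rw [map_mul]
      set W : (HahnSeries ℤ F)ˣ := Units.map (mapRingHom ρ).toMonoidHom w with hW
      have hWa : mapRingHom ρ ((w ^ a : (HahnSeries ℤ O)ˣ) : HahnSeries ℤ O) =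
          ((W ^ a : (HahnSeries ℤ F)ˣ) : HahnSeries ℤ F) := by
        rw [hW, ← map_zpow]
        rfl
      have hw' : (1 - single 1 1) * (W : HahnSeries ℤ F) = 1 + single 1 1 := hw
      rw [hWa]
      have hap : a.natAbs ≠ 0 := by omega
      rcases Int.natAbs_eq a with h | h
      · refine isMixed_of_mul_eq h2 hap hg ?_
        rw [h, zpow_natCast, Units.val_pow_eq_pow_val, ← mul_assoc, Int.natAbs_natCast, ← mul_pow,
          hw']
      · refine isMixed_of_mul_eq' h2 hap hg ?_
        rw [h, zpow_neg, zpow_natCast, Int.natAbs_neg, Int.natAbs_natCast, ← hw', mul_pow,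
          mul_assoc, ← mul_assoc (_ ^ _) _ (mapRingHom ρ g), ← Units.val_pow_eq_pow_val,
          Units.mul_inv, one_mul]
  have hmem : mapRingHom ι (single 0 1) ∈ reductionSet ι ρ ε IsPure :=
    ⟨0, single 0 1, by simp, hpure 1 (map_one ρ)⟩
  exact isFreePair_of_ping_pong ⟨_, hmem⟩ ⟨_, hv 1 one_ne_zero _ hmem⟩
    (disjoint_reductionSet hι hε hρε (fun h hh => hh.1) (fun h hh => hh.ne_zero)
      fun h hh => hh.not_isMixed) hu hv

theorem isFreePair_of_fractions {A D E : Type*} [Ring A] [DivisionRing D] [Ring E]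
    {φ : A →+* D} (hφ : Function.Injective φ)
    (hore : ∀ a b : A, b ≠ 0 → ∃ r r' : A, r ≠ 0 ∧ r * a = r' * b)
    {ψ : A →+* E} (hψ : ∀ b : A, b ≠ 0 → ∀ e e' : E, ψ b * e = ψ b * e' → e = e')
    {u v : Dˣ} {U V : Eˣ} {p q p' q' : A} (hp : p ≠ 0) (hq : q ≠ 0) (hp' : p' ≠ 0) (hq' : q' ≠ 0)
    (hu : φ q * u = φ p) (hU : ψ q * U = ψ p) (hv : φ q' * v = φ p') (hV : ψ q' * V = ψ p')
    (hfree : IsFreePair U V) : IsFreePair u v := by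
  have hφ0 : ∀ {a : A}, a ≠ 0 → φ a ≠ 0 := fun h => (map_ne_zero_iff φ hφ).mpr h
  have hnz : ∀ {a b : A}, a ≠ 0 → b ≠ 0 → a * b ≠ 0 := by
    intro a b ha hb hab
    have h := congrArg φ hab
    rw [map_mul, map_zero] at h
    exact (mul_ne_zero (hφ0 ha) (hφ0 hb)) h
  let Rel : D → E → Prop := fun d e => ∃ a b : A, b ≠ 0 ∧ φ b * d = φ a ∧ ψ b * e = ψ a
  have hmul : ∀ {d e d' e'}, Rel d e → Rel d' e' → Rel (d * d') (e * e') := by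
    rintro d e d' e' ⟨a, b, hb, hd, he⟩ ⟨a', b', hb', hd', he'⟩
    obtain ⟨r, r', hr, hrr⟩ := hore a b' hb'
    refine ⟨r' * a', r * b, hnz hr hb, ?_, ?_⟩
    · calc φ (r * b) * (d * d') = φ r * (φ b * d) * d' := by simp only [map_mul, mul_assoc]
        _ = φ (r' * b') * d' := by rw [hd, ← map_mul, hrr]
        _ = φ (r' * a') := by rw [map_mul, mul_assoc, hd', map_mul]
    · calc ψ (r * b) * (e * e') = ψ r * (ψ b * e) * e' := by simp only [map_mul, mul_assoc]
        _ = ψ (r' * b') * e' := by rw [he, ← map_mul, hrr]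
        _ = ψ (r' * a') := by rw [map_mul, mul_assoc, he', map_mul]
  let f : FreeGroup Bool →* Dˣ := FreeGroup.lift fun b : Bool => if b then u else v
  let g : FreeGroup Bool →* Eˣ := FreeGroup.lift fun b : Bool => if b then U else V
  have hrel : ∀ w : FreeGroup Bool, Rel (f w) (g w) := by
    intro w
    induction w using FreeGroup.induction_on with
    | C1 => exact ⟨1, 1, fun h => hq (by rw [← mul_one q, h, mul_zero]), by simp, by simp⟩
    | of b =>
      cases b
      · exact ⟨p', q', hq', by simpa [f] using hv, by simpa [g] using hV⟩
      · exact ⟨p, q, hq, by simpa [f] using hu, by simpa [g] using hU⟩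
    | inv_of b _ =>
      cases b
      · exact ⟨q', p', hp', by simp [f, ← hv], by simp [g, ← hV]⟩
      · exact ⟨q, p, hp, by simp [f, ← hu], by simp [g, ← hU]⟩
    | mul w w' h h' => simpa using hmul h h'
  refine (injective_iff_map_eq_one f).mpr fun w hw => ?_
  refine (injective_iff_map_eq_one g).mp hfree w ?_
  obtain ⟨a, b, hb, hd, he⟩ := hrel w
  rw [hw, Units.val_one, mul_one] at hd
  rw [← hφ hd] at he
  exact Units.ext (hψ b hb _ _ (by rw [he, Units.val_one, mul_one]))

theorem commute_Hlam_Hx : Commute Hlam Hx := by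
  have h : commS (commS Hx Hy) Hx = 1 :=
    PresentedGroup.one_of_mem (rels := heisRels) (Set.mem_insert _ _)
  rw [commS, mul_assoc, mul_assoc, inv_mul_eq_one, eq_inv_mul_iff_mul_eq] at h
  exact h.symm

theorem commute_Hlam_Hy : Commute Hlam Hy := by
  have h : commS (commS Hx Hy) Hy = 1 :=
    PresentedGroup.one_of_mem (rels := heisRels) (Set.mem_insert_of_mem _ rfl)
  rw [commS, mul_assoc, mul_assoc, inv_mul_eq_one, eq_inv_mul_iff_mul_eq] at h
  exact h.symm

theorem exists_normal_form (g : Heisenberg) :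
    ∃ t : ℤ × ℤ × ℤ, Hlam ^ t.1 * Hx ^ t.2.1 * Hy ^ t.2.2 = g := by
  have hc : Hy * Hx = Hlam⁻¹ * Hx * Hy := by
    have h : Hx * Hy = Hy * Hx * Hlam := by simp [Hlam, commS, mul_assoc]
    rw [mul_assoc, h, (commute_Hlam_Hy.mul_right commute_Hlam_Hx).eq.symm, inv_mul_cancel_left]
  have hconj : Hy * Hx * Hy⁻¹ = Hlam⁻¹ * Hx := by rw [hc, mul_inv_cancel_right]
  have hconj' : Hy⁻¹ * Hx * Hy = Hlam * Hx := by
    rw [mul_assoc, inv_mul_eq_iff_eq_mul, ← mul_assoc, commute_Hlam_Hy.eq.symm, mul_assoc, hc]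
    simp [mul_assoc]
  have hxpow : ∀ b : ℤ, Hy * Hx ^ b = Hlam ^ (-b) * Hx ^ b * Hy := by
    intro b
    rw [← mul_inv_eq_iff_eq_mul, ← conj_zpow, hconj, (commute_Hlam_Hx.inv_left).mul_zpow, inv_zpow']
  have hxpow' : ∀ b : ℤ, Hy⁻¹ * Hx ^ b = Hlam ^ b * Hx ^ b * Hy⁻¹ := by
    intro b
    have h := conj_zpow (i := b) (a := Hy⁻¹) (b := Hx)
    rw [inv_inv, hconj', commute_Hlam_Hx.mul_zpow] at h
    rw [h, mul_inv_cancel_right]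
  let S : Set Heisenberg := {g | ∃ t : ℤ × ℤ × ℤ, Hlam ^ t.1 * Hx ^ t.2.1 * Hy ^ t.2.2 = g}
  have hxS : ∀ ε : ℤ, ∀ g ∈ S, Hx ^ ε * g ∈ S := by
    rintro ε _ ⟨⟨a, b, c⟩, rfl⟩
    refine ⟨(a, ε + b, c), ?_⟩
    have h : Hx ^ ε * Hlam ^ a = Hlam ^ a * Hx ^ ε := (commute_Hlam_Hx.zpow_zpow a ε).eq.symm
    simp only [← mul_assoc, h, zpow_add]
  have hyS : ∀ g ∈ S, Hy * g ∈ S := by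
    rintro _ ⟨⟨a, b, c⟩, rfl⟩
    refine ⟨(a - b, b, 1 + c), ?_⟩
    have h : Hy * Hlam ^ a = Hlam ^ a * Hy := (commute_Hlam_Hy.zpow_left a).eq.symm
    simp only [← mul_assoc, h, zpow_add, zpow_one, sub_eq_add_neg]
    simp only [mul_assoc (Hlam ^ a), hxpow]
  have hyS' : ∀ g ∈ S, Hy⁻¹ * g ∈ S := by
    rintro _ ⟨⟨a, b, c⟩, rfl⟩
    refine ⟨(a + b, b, -1 + c), ?_⟩
    have h : Hy⁻¹ * Hlam ^ a = Hlam ^ a * Hy⁻¹ := (commute_Hlam_Hy.inv_right.zpow_left a).eq.symm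
    simp only [← mul_assoc, h, zpow_add, zpow_neg_one]
    simp only [mul_assoc (Hlam ^ a), hxpow']
  obtain ⟨w, rfl⟩ := PresentedGroup.mk_surjective heisRels g
  suffices h : ∀ g ∈ S, PresentedGroup.mk heisRels w * g ∈ S by
    simpa [S] using h 1 ⟨0, by simp⟩
  induction w using FreeGroup.induction_on with
  | C1 => simp
  | of i =>
    fin_cases i
    · intro g hg
      have h := hxS 1 g hg
      rwa [zpow_one] at h
    · exact hyS
  | inv_of i _ =>
    fin_cases i
    · intro g hg
      have h := hxS (-1) g hg
      rwa [zpow_neg_one] at h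
    · exact hyS'
  | mul w w' h h' =>
    intro g hg
    rw [map_mul, mul_assoc]
    exact h _ (h' g hg)

/-- The Laurent monomials in two elements of an extension field are linearly independent over the
base field. -/
def MonomialsIndependent {k K : Type*} [Field k] [Field K] (η : k →+* K) (s₁ s₂ : K) : Prop :=
  ∀ (T : Finset (ℤ × ℤ)) (c : ℤ × ℤ → k),
    ∑ t ∈ T, η (c t) * (s₁ ^ t.1 * s₂ ^ t.2) = 0 → ∀ t ∈ T, c t = 0

section Representation

variable {K : Type*} [Field K]

/-- The action of `x` on Laurent series in `z` over `K`: substitute `q z` and multiply by `a`. -/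
noncomputable def opX (q a : Kˣ) : (Module.End K (HahnSeries ℤ K))ˣ :=
  twistUnits K fun n => q ^ n * a

/-- The action of `y` on Laurent series in `z` over `K`: multiplication by `z`. -/
noncomputable def opY (K : Type*) [Field K] : (Module.End K (HahnSeries ℤ K))ˣ :=
  mulUnits K (Units.mk0 (single 1 1) (single_ne_zero one_ne_zero))

/-- The action of the central element: multiplication by the scalar `q`. -/
noncomputable def opLam (q : Kˣ) : (Module.End K (HahnSeries ℤ K))ˣ :=
  twistUnits K fun _ => q

theorem coeff_opY (f : HahnSeries ℤ K) (n : ℤ) :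
    ((opY K : Module.End K (HahnSeries ℤ K)) f).coeff n = f.coeff (n - 1) := by
  simp [opY, coeff_single_mul]

theorem coeff_opX (q a : Kˣ) (f : HahnSeries ℤ K) (n : ℤ) :
    ((opX q a : Module.End K (HahnSeries ℤ K)) f).coeff n = (q ^ n * a : Kˣ) * f.coeff n := rfl

theorem coeff_opLam (q : Kˣ) (f : HahnSeries ℤ K) (n : ℤ) :
    ((opLam q : Module.End K (HahnSeries ℤ K)) f).coeff n = q * f.coeff n := rfl

theorem commS_opX_opY (q a : Kˣ) : commS (opX q a) (opY K) = opLam q := by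
  rw [commS, mul_assoc, mul_assoc, inv_mul_eq_iff_eq_mul, inv_mul_eq_iff_eq_mul]
  refine Units.ext (LinearMap.ext fun f => ?_)
  ext n
  simp only [Units.val_mul, Module.End.mul_apply, coeff_opX, coeff_opY, coeff_opLam, zpow_sub_one]
  simp only [Units.val_inv_eq_inv_val]
  field_simp [q.ne_zero]

theorem commS_eq_one_of_commute {G : Type*} [Group G] {g h : G} (hgh : Commute g h) :
    commS g h = 1 := by
  rw [commS, mul_assoc, hgh.eq]
  group

theorem commute_opLam_opX (q a : Kˣ) : Commute (opLam q) (opX q a) := by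
  unfold opLam opX
  exact (Commute.all _ _).map (twistUnits K)

theorem commute_opLam_opY (q : Kˣ) : Commute (opLam q) (opY K) := by
  refine Units.ext (LinearMap.ext fun f => ?_)
  ext n
  simp [coeff_opY, coeff_opLam]

/-- The representation of the Heisenberg group on Laurent series in `z` in which `x` acts by
`f(z) ↦ a f(q z)` and `y` acts by multiplication by `z`. -/
noncomputable def rep (q a : Kˣ) : Heisenberg →* (Module.End K (HahnSeries ℤ K))ˣ :=
  PresentedGroup.toGroup (f := ![opX q a, opY K]) (by
    have hmap : ∀ g h, FreeGroup.lift ![opX q a, opY K] (commS g h) =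
        commS (FreeGroup.lift ![opX q a, opY K] g) (FreeGroup.lift ![opX q a, opY K] h) := by
      intro g h
      simp [commS]
    rintro r (rfl | rfl)
    · rw [hmap, hmap]
      simp only [FreeGroup.lift_apply_of, Matrix.cons_val_zero, Matrix.cons_val_one, commS_opX_opY]
      exact commS_eq_one_of_commute (commute_opLam_opX q a)
    · rw [hmap, hmap]
      simp only [FreeGroup.lift_apply_of, Matrix.cons_val_zero, Matrix.cons_val_one, commS_opX_opY]
      exact commS_eq_one_of_commute (commute_opLam_opY q))

theorem rep_Hx (q a : Kˣ) : rep q a Hx = opX q a := by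
  simp [rep, Hx]

theorem rep_Hy (q a : Kˣ) : rep q a Hy = opY K := by
  simp [rep, Hy]

theorem rep_Hlam (q a : Kˣ) : rep q a Hlam = opLam q := by
  rw [Hlam, ← commS_opX_opY q a, ← rep_Hx q a, ← rep_Hy q a]
  simp [commS]

theorem coeff_rep_normal_form (q a : Kˣ) (i j l : ℤ) (f : HahnSeries ℤ K) (n : ℤ) :
    ((rep q a (Hlam ^ i * Hx ^ j * Hy ^ l) : Module.End K (HahnSeries ℤ K)) f).coeff n =
      (q : K) ^ (i + n * j) * (a : K) ^ j * f.coeff (n - l) := by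
  have hY : opY K ^ l = mulUnits K (Units.mk0 (single l 1) (single_ne_zero one_ne_zero)) := by
    rw [opY, ← map_zpow]
    congr 1
    ext1
    rw [Units.val_zpow_eq_zpow_val]
    exact (RatFunc.single_zpow l).symm
  rw [map_mul, map_mul, map_zpow, map_zpow, map_zpow, rep_Hx, rep_Hy, rep_Hlam, hY, opLam, opX,
    ← map_zpow, ← map_zpow, Units.val_mul, Units.val_mul, Module.End.mul_apply,
    Module.End.mul_apply]
  simp only [coeff_twistUnits, mulUnits_apply, Pi.pow_apply, Units.val_mk0,
    Units.val_zpow_eq_zpow_val, Units.val_mul]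
  simp [coeff_single_mul, mul_zpow, zpow_add₀, zpow_mul, mul_assoc]

/-- The extension of `rep` to the group algebra. -/
noncomputable def repAlg (k : Type*) [Field k] [Algebra k K] (q a : Kˣ) :
    MonoidAlgebra k Heisenberg →ₐ[k] Module.End K (HahnSeries ℤ K) :=
  MonoidAlgebra.lift k _ _ ((Units.coeHom _).comp (rep q a))

theorem repAlg_of (k : Type*) [Field k] [Algebra k K] (q a : Kˣ) (g : Heisenberg) :
    repAlg k q a (MonoidAlgebra.of k _ g) = rep q a g := by
  simp [repAlg]

theorem injective_repAlg_apply {k : Type*} [Field k] [Algebra k K] {q a : Kˣ}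
    (hind : MonomialsIndependent (algebraMap k K) q a)
    {b : MonoidAlgebra k Heisenberg} (hb : b ≠ 0) : Function.Injective (repAlg k q a b) := by
  obtain ⟨t, ht⟩ : ∃ t : Heisenberg → ℤ × ℤ × ℤ,
      ∀ g, Hlam ^ (t g).1 * Hx ^ (t g).2.1 * Hy ^ (t g).2.2 = g :=
    ⟨_, fun g => (exists_normal_form g).choose_spec⟩
  have htinj : Function.Injective t := fun g g' h => by rw [← ht g, ← ht g', h]
  have hcoeff : ∀ (f : HahnSeries ℤ K) (n : ℤ), (repAlg k q a b f).coeff n =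
      ∑ g ∈ b.coeff.support, b.coeff g • (((q : K) ^ ((t g).1 + n * (t g).2.1) *
        (a : K) ^ (t g).2.1) * f.coeff (n - (t g).2.2)) := by
    intro f n
    rw [repAlg, MonoidAlgebra.lift_apply, Finsupp.sum, LinearMap.sum_apply, coeff_sum]
    refine Finset.sum_congr rfl fun g _ => ?_
    rw [← coeff_rep_normal_form, ht g]
    rfl
  have hsupp : b.coeff.support.Nonempty := by
    rw [Finsupp.support_nonempty_iff]
    rintro h
    exact hb (MonoidAlgebra.ext h)
  obtain ⟨g₀, hg₀, hmin⟩ := b.coeff.support.exists_min_image (fun g => (t g).2.2) hsupp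
  set l := (t g₀).2.2
  refine (injective_iff_map_eq_zero _).mpr fun f hf => ?_
  by_contra hf0
  set n := f.order + l with hn
  have hn0 := congrArg (fun f => f.coeff n) hf
  simp only [hcoeff, coeff_zero] at hn0
  set T := b.coeff.support.filter fun g => (t g).2.2 = l with hT
  rw [← Finset.sum_filter_of_ne (p := fun g => (t g).2.2 = l), ← hT] at hn0
  swap
  · intro g hg hne
    by_contra hgl
    refine hne ?_
    have hlt : l < (t g).2.2 := lt_of_le_of_ne (hmin g hg) (Ne.symm hgl)
    rw [coeff_eq_zero_of_lt_order (by omega), mul_zero, smul_zero]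
  have hsum : ∑ g ∈ T, b.coeff g • ((q : K) ^ ((t g).1 + n * (t g).2.1) *
      (a : K) ^ (t g).2.1) = 0 := by
    refine (mul_eq_zero.mp ?_).resolve_right ((coeff_order_eq_zero (x := f)).not.mpr hf0)
    rw [Finset.sum_mul, ← hn0]
    refine Finset.sum_congr rfl fun g hg => ?_
    rw [(Finset.mem_filter.mp hg).2, smul_mul_assoc, hn, add_sub_cancel_right]
  have hTinj : Function.Injective fun g : T => ((t g).1 + n * (t g).2.1, (t g).2.1) := by
    rintro ⟨g, hg⟩ ⟨g', hg'⟩ h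
    simp only [Prod.mk.injEq] at h
    obtain ⟨h1, h2⟩ := h
    rw [h2] at h1
    refine Subtype.ext (htinj (Prod.ext (by simpa using h1) (Prod.ext h2 ?_)))
    rw [(Finset.mem_filter.mp hg).2, (Finset.mem_filter.mp hg').2]
  have hind' : LinearIndependent k fun t : ℤ × ℤ => (q : K) ^ t.1 * (a : K) ^ t.2 := by
    rw [linearIndependent_iff']
    simp only [Algebra.smul_def]
    exact hind
  have hlin := Fintype.linearIndependent_iff.mp (hind'.comp _ hTinj) (fun g => b.coeff g)
    (by rw [← hsum, ← Finset.sum_coe_sort T]; rfl)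
  exact Finsupp.mem_support_iff.mp hg₀ (hlin ⟨g₀, Finset.mem_filter.mpr ⟨hg₀, rfl⟩⟩)

end Representation

section Model

variable {F : Type*} [Field F]

theorem map_units_zpow_eq {R S : Type*} [CommRing R] [CommRing S] {π : R →+* S} {q : Rˣ}
    (hq : π q = -1) (n : ℤ) : π ((q ^ n : Rˣ) : R) = if Even n then 1 else -1 := by
  have hq1 : Units.map π.toMonoidHom q = -1 := Units.ext hq
  have h := congrArg (fun s : Sˣ => ((s ^ n : Sˣ) : S)) hq1
  simp only [← map_zpow] at h
  refine Eq.trans h ?_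
  split_ifs with hn
  · rw [hn.neg_one_zpow, Units.val_one]
  · rw [(Int.not_even_iff_odd.mp hn).neg_one_zpow, Units.val_neg, Units.val_one]

theorem exists_one_add_zpow_mul_eq (h2 : (2 : F) ≠ 0) {q a : (PowerSeries F)ˣ}
    (hq : (PowerSeries.X : PowerSeries F) ^ 2 ∣ q + 1)
    (ha : (a : PowerSeries F) = PowerSeries.X - 1) (n : ℤ) :
    ∃ e : (PowerSeries F)ˣ,
      1 + ((q ^ n : (PowerSeries F)ˣ) : PowerSeries F) * (a : PowerSeries F) =
        (if Even n then PowerSeries.X else 1) * (e : PowerSeries F) := by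
  set π := Ideal.Quotient.mk (Ideal.span {(PowerSeries.X : PowerSeries F) ^ 2})
  have hqn := map_units_zpow_eq (π := π) (q := q) (by
    have h : π (q + 1) = 0 :=
      Ideal.Quotient.eq_zero_iff_mem.mpr (Ideal.mem_span_singleton.mpr hq)
    rw [map_add, map_one] at h
    exact eq_neg_of_add_eq_zero_left h) n
  have hunit : ∀ f g : PowerSeries F, PowerSeries.constantCoeff f ≠ 0 → g = f →
      ∃ e : (PowerSeries F)ˣ, g = e := by
    rintro f _ hf rfl
    obtain ⟨e, rfl⟩ := PowerSeries.isUnit_iff_constantCoeff.mpr hf.isUnit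
    exact ⟨e, rfl⟩
  rcases Int.even_or_odd n with hn | hn
  · rw [if_pos hn, ← map_one π, Ideal.Quotient.mk_eq_mk_iff_sub_mem,
      Ideal.mem_span_singleton] at hqn
    obtain ⟨c, hc⟩ := hqn
    obtain ⟨e, he⟩ := hunit (1 + PowerSeries.X * (c * (PowerSeries.X - 1))) _ (by simp) rfl
    refine ⟨e, ?_⟩
    rw [if_pos hn, ← he, sub_eq_iff_eq_add.mp hc, ha]
    ring
  · rw [if_neg (Int.not_even_iff_odd.mpr hn), ← map_one π, ← map_neg,
      Ideal.Quotient.mk_eq_mk_iff_sub_mem, Ideal.mem_span_singleton] at hqn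
    obtain ⟨c, hc⟩ := hqn
    simp only [if_neg (Int.not_even_iff_odd.mpr hn), one_mul]
    refine hunit (2 + PowerSeries.X * (PowerSeries.X * c * (PowerSeries.X - 1) - 1)) _
      (by simpa [map_ofNat (PowerSeries.constantCoeff (R := F)) 2] using h2) ?_
    rw [sub_eq_iff_eq_add.mp hc, ha]
    ring

theorem exists_unit_one_add_single {R : Type*} [CommRing R] (c : R) :
    ∃ e : (HahnSeries ℤ R)ˣ, (e : HahnSeries ℤ R) = 1 + single 1 c := by
  have h : IsUnit (1 + PowerSeries.C c * PowerSeries.X : PowerSeries R) :=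
    PowerSeries.isUnit_iff_constantCoeff.mpr (by simp)
  obtain ⟨e, he⟩ := h.map (ofPowerSeries ℤ R)
  exact ⟨e, by simp [he]⟩

theorem exists_isFreePair_repAlg (k : Type*) [Field k] [Algebra k F] (h2 : (2 : F) ≠ 0)
    {q a : (PowerSeries F)ˣ} (hq : (PowerSeries.X : PowerSeries F) ^ 2 ∣ q + 1)
    (ha : (a : PowerSeries F) = PowerSeries.X - 1) {m n : ℤ} (hm : Odd m) (hn : Odd n) :
    ∃ U V : (Module.End (LaurentSeries F) (HahnSeries ℤ (LaurentSeries F)))ˣ, IsFreePair U V ∧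
      repAlg k (Units.map (ofPowerSeries ℤ F).toMonoidHom q)
        (Units.map (ofPowerSeries ℤ F).toMonoidHom a)
        (1 + MonoidAlgebra.of k _ (Hlam ^ m * Hx)) * U =
      repAlg k (Units.map (ofPowerSeries ℤ F).toMonoidHom q)
        (Units.map (ofPowerSeries ℤ F).toMonoidHom a) (1 + MonoidAlgebra.of k _ Hx) ∧
      repAlg k (Units.map (ofPowerSeries ℤ F).toMonoidHom q)
        (Units.map (ofPowerSeries ℤ F).toMonoidHom a)
        (1 + MonoidAlgebra.of k _ (Hlam ^ n * Hy)) * V =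
      repAlg k (Units.map (ofPowerSeries ℤ F).toMonoidHom q)
        (Units.map (ofPowerSeries ℤ F).toMonoidHom a) (1 + MonoidAlgebra.of k _ Hy) := by
  set ι := ofPowerSeries ℤ F
  have hι : Function.Injective ι := ofPowerSeries_injective
  set Q := Units.map ι.toMonoidHom q
  set A := Units.map ι.toMonoidHom a
  choose e he using exists_one_add_zpow_mul_eq h2 hq ha
  have hQA : ∀ i : ℤ, 1 + ((Q ^ i : (LaurentSeries F)ˣ) : LaurentSeries F) * A =
      ι (if Even i then PowerSeries.X else 1) * ι (e i) := by
    intro i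
    rw [← map_mul, ← he i, map_add, map_one, map_mul, ← map_zpow]
    rfl
  have hX : ι PowerSeries.X ≠ 0 := (map_ne_zero_iff ι hι).mpr PowerSeries.X_ne_zero
  have hQA0 : ∀ i : ℤ, 1 + ((Q ^ i : (LaurentSeries F)ˣ) : LaurentSeries F) * A ≠ 0 := by
    intro i
    rw [hQA]
    refine mul_ne_zero ?_ ((map_ne_zero_iff ι hι).mpr (e i).ne_zero)
    split_ifs
    · exact hX
    · simp
  let d : ℤ → (LaurentSeries F)ˣ := fun i => Units.mk0 _ (hQA0 i) / Units.mk0 _ (hQA0 (m + i))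
  have hd : ∀ i, (d i : LaurentSeries F) =
      ι PowerSeries.X ^ (if Even i then 1 else -1 : ℤ) * ι ((e i / e (m + i) : (PowerSeries F)ˣ)) := by
    intro i
    have hediv : ι ((e i / e (m + i) : (PowerSeries F)ˣ)) = ι (e i) / ι (e (m + i)) := by
      rw [eq_div_iff ((map_ne_zero_iff ι hι).mpr (e (m + i)).ne_zero), ← map_mul, ← Units.val_mul,
        div_mul_cancel]
    have hdi : (d i : LaurentSeries F) = (1 + ((Q ^ i : (LaurentSeries F)ˣ) : LaurentSeries F) * A) /
        (1 + ((Q ^ (m + i) : (LaurentSeries F)ˣ) : LaurentSeries F) * A) := by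
      simp [d]
    have hpar : Even (m + i) ↔ ¬ Even i := by
      rw [Int.even_add]
      simp [Int.not_even_iff_odd.mpr hm]
    rw [hdi, hQA, hQA, hediv]
    by_cases hi : Even i
    · simp [hpar, hi, mul_div_assoc]
    · simp only [hpar, hi, not_false_eq_true, if_true, if_false, map_one, one_mul, zpow_neg_one]
      rw [div_mul_eq_div_div_swap, div_eq_mul_inv, mul_comm]
  obtain ⟨w₁, hw₁⟩ := exists_unit_one_add_single (1 : PowerSeries F)
  obtain ⟨w₂, hw₂⟩ := exists_unit_one_add_single ((q ^ n : (PowerSeries F)ˣ) : PowerSeries F)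
  have hww : (w₂ : HahnSeries ℤ (PowerSeries F)) * ((w₁ / w₂ : (HahnSeries ℤ (PowerSeries F))ˣ)) =
      w₁ := by
    rw [← Units.val_mul, mul_div_cancel]
  have hρq : PowerSeries.constantCoeff ((q ^ n : (PowerSeries F)ˣ) : PowerSeries F) = -1 := by
    have h : PowerSeries.constantCoeff ((q : PowerSeries F) + 1) = 0 :=
      PowerSeries.X_dvd_iff.mp (dvd_trans (dvd_pow_self _ two_ne_zero) hq)
    rw [map_add, map_one] at h
    rw [map_units_zpow_eq (eq_neg_of_add_eq_zero_left h), if_neg (Int.not_even_iff_odd.mpr hn)]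
  have hw : (1 - single 1 1) * mapRingHom PowerSeries.constantCoeff
      ((w₁ / w₂ : (HahnSeries ℤ (PowerSeries F))ˣ) : HahnSeries ℤ (PowerSeries F)) =
      1 + single 1 (1 : F) := by
    have h := congrArg (mapRingHom PowerSeries.constantCoeff) hww
    simpa [hw₁, hw₂, mapRingHom_single, hρq, sub_eq_add_neg] using h
  refine ⟨_, _, isFreePair_twistUnits_mulUnits h2 hι (PowerSeries.X_ne_zero)
    PowerSeries.constantCoeff_X hd hw, ?_, ?_⟩
  · refine LinearMap.ext fun f => ?_
    refine HahnSeries.ext (funext fun i => ?_)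
    simp only [map_add, map_one, repAlg_of, map_mul, map_zpow, rep_Hlam, rep_Hx]
    have hz : opLam Q ^ m = twistUnits (LaurentSeries F) fun _ => Q ^ m := by
      rw [opLam, ← map_zpow]
      rfl
    rw [hz]
    simp only [Module.End.mul_apply, LinearMap.add_apply, Module.End.one_apply, coeff_add,
      coeff_twistUnits, coeff_opX, Units.val_mul]
    have hdi : (d i : LaurentSeries F) * (1 + ((Q ^ (m + i) : (LaurentSeries F)ˣ) :
        LaurentSeries F) * A) = 1 + ((Q ^ i : (LaurentSeries F)ˣ) : LaurentSeries F) * A := by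
      simp only [d, Units.val_div_eq_div_val, Units.val_mk0]
      exact div_mul_cancel₀ _ (hQA0 _)
    rw [zpow_add, Units.val_mul] at hdi
    linear_combination f.coeff i * hdi
  · refine LinearMap.ext fun f => ?_
    have hV := congrArg (fun g => mapRingHom ι g * f) hww
    have hz : opLam Q ^ n = twistUnits (LaurentSeries F) fun _ => Q ^ n := by
      rw [opLam, ← map_zpow]
      rfl
    simp only [map_add, map_one, repAlg_of, map_mul, map_zpow, rep_Hlam, rep_Hy, hz]
    refine HahnSeries.ext (funext fun i => ?_)
    have hVi := congrArg (fun g => g.coeff i) hV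
    simp only [hw₁, hw₂, map_add, map_one, map_mul, mapRingHom_single, add_mul, one_mul, mul_assoc,
      coeff_add, coeff_single_mul] at hVi
    simp only [Module.End.mul_apply, LinearMap.add_apply, Module.End.one_apply, coeff_add,
      coeff_twistUnits, coeff_opY, mulUnits_apply]
    rw [← map_zpow]
    exact hVi

end Model

section Independence

theorem map_sum_mul_pow_toNat {k S K : Type*} [Field k] [CommRing S] [Field K] (σ : k →+* S)
    (j : S →+* K) {T : Finset (ℤ × ℤ)} {N : ℕ} (hN : ∀ t ∈ T, 0 ≤ t.1 + N ∧ 0 ≤ t.2 + N)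
    (c : ℤ × ℤ → k) {s₁ s₂ : S} (h₁ : j s₁ ≠ 0) (h₂ : j s₂ ≠ 0) :
    j (∑ t ∈ T, σ (c t) * (s₁ ^ (t.1 + N).toNat * s₂ ^ (t.2 + N).toNat)) =
      j s₁ ^ N * j s₂ ^ N * ∑ t ∈ T, j.comp σ (c t) * (j s₁ ^ t.1 * j s₂ ^ t.2) := by
  rw [map_sum, Finset.mul_sum]
  refine Finset.sum_congr rfl fun t ht => ?_
  rw [map_mul, map_mul, map_pow, map_pow, ← zpow_natCast, ← zpow_natCast (j s₂),
    Int.toNat_of_nonneg (hN t ht).1, Int.toNat_of_nonneg (hN t ht).2, zpow_add₀ h₁,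
    zpow_add₀ h₂, zpow_natCast, zpow_natCast, RingHom.comp_apply]
  ring

/-- Independence of Laurent monomials can be transferred between fields through a common
subring. -/
theorem MonomialsIndependent.of_ringHom {k S K₁ K₂ : Type*} [Field k] [CommRing S] [Field K₁]
    [Field K₂] {σ : k →+* S} {j₁ : S →+* K₁} (hj₁ : Function.Injective j₁) {j₂ : S →+* K₂}
    {s₁ s₂ : S} (h₁ : j₂ s₁ ≠ 0) (h₂ : j₂ s₂ ≠ 0)
    (hind : MonomialsIndependent (j₂.comp σ) (j₂ s₁) (j₂ s₂)) :
    MonomialsIndependent (j₁.comp σ) (j₁ s₁) (j₁ s₂) := by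
  have h₁' : j₁ s₁ ≠ 0 := fun h => h₁ (by rw [(map_eq_zero_iff j₁ hj₁).mp h, map_zero])
  have h₂' : j₁ s₂ ≠ 0 := fun h => h₂ (by rw [(map_eq_zero_iff j₁ hj₁).mp h, map_zero])
  intro T c hc
  obtain ⟨N, hN⟩ : ∃ N : ℕ, ∀ t ∈ T, 0 ≤ t.1 + N ∧ 0 ≤ t.2 + N := by
    refine ⟨∑ t ∈ T, (t.1.natAbs + t.2.natAbs), fun t ht => ?_⟩
    have h := Finset.single_le_sum (f := fun t : ℤ × ℤ => t.1.natAbs + t.2.natAbs)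
      (fun _ _ => Nat.zero_le _) ht
    omega
  have h0 := map_sum_mul_pow_toNat σ j₁ hN c h₁' h₂'
  rw [hc, mul_zero, map_eq_zero_iff j₁ hj₁] at h0
  have h0' := map_sum_mul_pow_toNat σ j₂ hN c h₁ h₂
  rw [h0, map_zero, eq_comm,
    mul_eq_zero_iff_left (mul_ne_zero (pow_ne_zero _ h₁) (pow_ne_zero _ h₂))] at h0'
  exact hind T c h0'

variable (k : Type*) [Field k]

theorem monomialsIndependent_single_C_single :
    MonomialsIndependent (C.comp C : k →+* LaurentSeries (LaurentSeries k))
      (single 1 1) (C (single 1 1)) := by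
  have h : ∀ (c : k) (i j : ℤ), (C.comp C : k →+* LaurentSeries (LaurentSeries k)) c *
      (single 1 1 ^ i * C (single 1 1 : LaurentSeries k) ^ j) = single i (single j c) := by
    intro c i j
    rw [← RatFunc.single_zpow, ← map_zpow₀ (C : LaurentSeries k →+* LaurentSeries (LaurentSeries k)),
      ← RatFunc.single_zpow, RingHom.comp_apply, C_apply, C_apply, C_apply, single_mul_single,
      single_mul_single]
    simp
  intro T c hc t ht
  have h0 := congrArg (fun f => (f.coeff t.1).coeff t.2) hc
  simp only [h, coeff_sum, coeff_zero] at h0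
  rw [Finset.sum_eq_single_of_mem t ht] at h0
  · simpa using h0
  · rintro ⟨i, j⟩ _ hne
    simp only [coeff_single]
    split_ifs with hi
    · rw [coeff_single_of_ne]
      rintro rfl
      exact hne (Prod.ext hi.symm rfl)
    · simp

open Polynomial in
theorem exists_units_monomialsIndependent :
    ∃ q a : (PowerSeries (RatFunc k))ˣ, (PowerSeries.X : PowerSeries (RatFunc k)) ^ 2 ∣ q + 1 ∧
      (a : PowerSeries (RatFunc k)) = PowerSeries.X - 1 ∧
      MonomialsIndependent (algebraMap k (LaurentSeries (RatFunc k)))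
        (ofPowerSeries ℤ (RatFunc k) q) (ofPowerSeries ℤ (RatFunc k) a) := by
  have hq : IsUnit (-(1 + PowerSeries.C RatFunc.X * PowerSeries.X ^ 2) : PowerSeries (RatFunc k)) :=
    PowerSeries.isUnit_iff_constantCoeff.mpr (by simp)
  have ha : IsUnit (PowerSeries.X - 1 : PowerSeries (RatFunc k)) :=
    PowerSeries.isUnit_iff_constantCoeff.mpr (by simp)
  obtain ⟨q, hq⟩ := hq
  obtain ⟨a, ha⟩ := ha
  refine ⟨q, a, ⟨-PowerSeries.C RatFunc.X, by rw [hq]; ring⟩, ha, ?_⟩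
  let j₁ : k[X][X] →+* LaurentSeries (RatFunc k) :=
    ((ofPowerSeries ℤ (RatFunc k)).comp Polynomial.coeToPowerSeries.ringHom).comp
      (Polynomial.mapRingHom (algebraMap k[X] (RatFunc k)))
  have hj₁ : Function.Injective j₁ :=
    (ofPowerSeries_injective.comp (Polynomial.coe_injective _)).comp
      (Polynomial.map_injective _ (RatFunc.algebraMap_injective k))
  let x : LaurentSeries (LaurentSeries k) := HahnSeries.C (single 1 1)
  let y : LaurentSeries (LaurentSeries k) := single 1 1
  let j₂ : k[X][X] →+* LaurentSeries (LaurentSeries k) :=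
    Polynomial.eval₂RingHom (Polynomial.eval₂RingHom (HahnSeries.C.comp HahnSeries.C)
      (-(y + 1) / (x + 1) ^ 2)) (x + 1)
  have hy0 : y ≠ 0 := single_ne_zero one_ne_zero
  have hx0 : x ≠ 0 := (map_ne_zero_iff _ HahnSeries.C_injective).mpr (single_ne_zero one_ne_zero)
  have hx : x + 1 ≠ 0 := by
    intro h
    have h0 := congrArg (fun f => (f.coeff 0).coeff 0) h
    simp [x, coeff_single_of_ne] at h0
  have hj₁q : j₁ (-(1 + Polynomial.C X * X ^ 2)) = ofPowerSeries ℤ (RatFunc k) q := by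
    simp [j₁, hq]
  have hj₁a : j₁ (X - 1) = ofPowerSeries ℤ (RatFunc k) a := by
    simp [j₁, ha]
  have hj₁σ : j₁.comp (Polynomial.C.comp Polynomial.C) =
      algebraMap k (LaurentSeries (RatFunc k)) := by
    ext1 c
    change _ = ofPowerSeries ℤ (RatFunc k) (algebraMap k (PowerSeries (RatFunc k)) c)
    rw [PowerSeries.algebraMap_apply, IsScalarTower.algebraMap_apply k k[X] (RatFunc k)]
    simp [j₁]
  have hj₂q : j₂ (-(1 + Polynomial.C X * X ^ 2)) = y := by
    simp only [j₂, map_neg, map_add, map_mul, map_one, map_pow, coe_eval₂RingHom, eval₂_C, eval₂_X]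
    field_simp
    ring
  have hj₂a : j₂ (X - 1) = x := by
    simp [j₂]
  have hj₂σ : j₂.comp (Polynomial.C.comp Polynomial.C) = HahnSeries.C.comp HahnSeries.C := by
    ext1 c
    simp [j₂]
  rw [← hj₁q, ← hj₁a, ← hj₁σ]
  refine MonomialsIndependent.of_ringHom hj₁ (j₂ := j₂) (by rwa [hj₂q]) (by rwa [hj₂a]) ?_
  rw [hj₂q, hj₂a, hj₂σ]
  exact monomialsIndependent_single_C_single k

end Independence

theorem exists_mul_eq_mul_of_involution {k D G : Type*} [Field k] [DivisionRing D] [Algebra k D]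
    [Monoid G] {φ : MonoidAlgebra k G →ₐ[k] D} (hφ : Function.Injective φ)
    (hquot : ∀ d : D, ∃ a b : MonoidAlgebra k G, φ b ≠ 0 ∧ d = φ a * (φ b)⁻¹)
    {gstar : G → G} {invol : D →ₗ[k] D} (hmul : ∀ c d : D, invol (c * d) = invol d * invol c)
    (hinvol : ∀ c : D, invol (invol c) = c)
    (hind : ∀ g : G, invol (φ (MonoidAlgebra.of k G g)) = φ (MonoidAlgebra.of k G (gstar g)))
    {a b : MonoidAlgebra k G} (hb : b ≠ 0) :
    ∃ r r' : MonoidAlgebra k G, r ≠ 0 ∧ r * a = r' * b := by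
  have hrange : ∀ c : MonoidAlgebra k G, ∃ c', φ c' = invol (φ c) := by
    intro c
    induction c using MonoidAlgebra.induction_on with
    | of g => exact ⟨_, (hind g).symm⟩
    | add c d hc hd =>
      obtain ⟨c', hc⟩ := hc
      obtain ⟨d', hd⟩ := hd
      exact ⟨c' + d', by simp [hc, hd]⟩
    | smul s c hc =>
      obtain ⟨c', hc⟩ := hc
      exact ⟨s • c', by simp [hc]⟩
  have hφb : φ b ≠ 0 := (map_ne_zero_iff φ hφ).mpr hb
  obtain ⟨a', b', hb', hd⟩ := hquot (invol (φ a * (φ b)⁻¹))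
  obtain ⟨r, hr⟩ := hrange b'
  obtain ⟨r', hr'⟩ := hrange a'
  refine ⟨r, r', ?_, hφ ?_⟩
  · rintro rfl
    rw [map_zero] at hr
    exact hb' (by rw [← hinvol (φ b'), ← hr, map_zero])
  · have h : φ r * (φ a * (φ b)⁻¹) = φ r' := by
      rw [hr, hr', ← hinvol (φ a * (φ b)⁻¹), ← hmul, hd, inv_mul_cancel_right₀ hb']
    rw [map_mul, map_mul, ← h, mul_assoc, inv_mul_cancel_right₀ hφb]

theorem one_add_of_ne_zero {k G : Type*} [Field k] (h2 : (2 : k) ≠ 0) [Monoid G] (g : G) :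
    1 + MonoidAlgebra.of k G g ≠ 0 := by
  intro h
  have h1 := congrArg (fun f : MonoidAlgebra k G => f.coeff 1) h
  by_cases hg : g = 1
  · simp [hg, one_add_one_eq_two, h2] at h1
  · simp [MonoidAlgebra.one_def, hg] at h1

/-- A quotient `q⁻¹ p` of commuting elements exchanged by an involution is unitary. -/
theorem mul_involution_eq_one {k D : Type*} [Field k] [DivisionRing D] [Algebra k D]
    {invol : D →ₗ[k] D} (hmul : ∀ c d : D, invol (c * d) = invol d * invol c)
    {p q : D} (hp : p ≠ 0) (hq : q ≠ 0) (hpq : Commute p q) (hinvp : invol p = q)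
    (hinvq : invol q = p) : q⁻¹ * p * invol (q⁻¹ * p) = 1 := by
  have h : q⁻¹ * p = p * q⁻¹ := (hpq.inv_right₀).eq.symm
  have hu : invol (q⁻¹ * p) * p = q := by
    nth_rw 2 [← hinvq]
    rw [← hmul, mul_inv_cancel_left₀ hq, hinvp]
  have hu' : invol (q⁻¹ * p) = q * p⁻¹ := (eq_mul_inv_iff_mul_eq₀ hp).mpr hu
  rw [hu', h, mul_assoc, inv_mul_cancel_left₀ hq, mul_inv_cancel₀ hp]

theorem commute_one_add_of_Hlam_zpow_mul (k : Type*) [Field k] {g : Heisenberg}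
    (hg : Commute Hlam g) (m : ℤ) :
    Commute (1 + MonoidAlgebra.of k Heisenberg g) (1 + MonoidAlgebra.of k _ (Hlam ^ m * g)) := by
  have h : Commute g (Hlam ^ m * g) := (hg.zpow_left m).symm.mul_right (Commute.refl g)
  exact ((Commute.one_left _).add_left ((Commute.one_right _).add_right (h.map _)))

theorem isFreePair_of_repAlg {k K D : Type*} [Field k] [Field K] [Algebra k K] [DivisionRing D]
    [Algebra k D] {φ : MonoidAlgebra k Heisenberg →ₐ[k] D} (hφ : Function.Injective φ)
    (hore : ∀ a b : MonoidAlgebra k Heisenberg, b ≠ 0 →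
      ∃ r r' : MonoidAlgebra k Heisenberg, r ≠ 0 ∧ r * a = r' * b)
    {s t : Kˣ} (hind : MonomialsIndependent (algebraMap k K) s t)
    {u v : Dˣ} {U V : (Module.End K (HahnSeries ℤ K))ˣ} (hfree : IsFreePair U V)
    {p q p' q' : MonoidAlgebra k Heisenberg} (hp : p ≠ 0) (hq : q ≠ 0) (hp' : p' ≠ 0)
    (hq' : q' ≠ 0) (hu : φ q * u = φ p) (hv : φ q' * v = φ p')
    (hU : repAlg k s t q * U = repAlg k s t p) (hV : repAlg k s t q' * V = repAlg k s t p') :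
    IsFreePair u v :=
  isFreePair_of_fractions (φ := φ.toRingHom) (ψ := (repAlg k s t).toRingHom) hφ hore
    (fun _ hb _ _ he => LinearMap.ext fun f =>
      injective_repAlg_apply hind hb (LinearMap.congr_fun he f))
    hp hq hp' hq' hu hU hv hV hfree

theorem exists_field_isFreePair_repAlg.{u} {k : Type u} [Field k] (h2 : (2 : k) ≠ 0) {m n : ℤ}
    (hm : Odd m) (hn : Odd n) :
    ∃ (K : Type u) (_ : Field K) (_ : Algebra k K) (s t : Kˣ)
      (U V : (Module.End K (HahnSeries ℤ K))ˣ),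
      MonomialsIndependent (algebraMap k K) s t ∧ IsFreePair U V ∧
      repAlg k s t (1 + MonoidAlgebra.of k _ (Hlam ^ m * Hx)) * U =
        repAlg k s t (1 + MonoidAlgebra.of k _ Hx) ∧
      repAlg k s t (1 + MonoidAlgebra.of k _ (Hlam ^ n * Hy)) * V =
        repAlg k s t (1 + MonoidAlgebra.of k _ Hy) := by
  have h2' : (2 : RatFunc k) ≠ 0 := by
    rw [← map_ofNat (algebraMap k (RatFunc k)) 2]
    exact (map_ne_zero _).mpr h2
  obtain ⟨q, a, hq, ha, hind⟩ := exists_units_monomialsIndependent k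
  obtain ⟨U, V, hfree, hU, hV⟩ := exists_isFreePair_repAlg k h2' hq ha hm hn
  exact ⟨LaurentSeries (RatFunc k), inferInstance, inferInstance,
    Units.map (ofPowerSeries ℤ (RatFunc k)).toMonoidHom q,
    Units.map (ofPowerSeries ℤ (RatFunc k)).toMonoidHom a, U, V, hind, hfree, hU, hV⟩

end HeisenbergFreePair

open HeisenbergFreePair

theorem free_unitary_pair_heisenberg_type_I_both_odd
    (k : Type*) [Field k] (hchar : ringChar k ≠ 2)
    (D : Type*) [DivisionRing D] [Algebra k D]
    (φ : MonoidAlgebra k Heisenberg →ₐ[k] D)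
    (hφinj : Function.Injective φ)
    (hquot : ∀ d : D, ∃ a b : MonoidAlgebra k Heisenberg, φ b ≠ 0 ∧ d = φ a * (φ b)⁻¹)
    (gstar : Heisenberg → Heisenberg)
    (hgstar_mul : ∀ g h : Heisenberg, gstar (g * h) = gstar h * gstar g)
    (hgstar_invol : ∀ g : Heisenberg, gstar (gstar g) = g)
    (invol : D →ₗ[k] D)
    (hinvol_mul : ∀ c d : D, invol (c * d) = invol d * invol c)
    (hinvol_invol : ∀ c : D, invol (invol c) = c)
    (hinduced : ∀ g : Heisenberg,
      invol (φ (MonoidAlgebra.of k Heisenberg g)) = φ (MonoidAlgebra.of k Heisenberg (gstar g)))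
    (m n : ℤ) (hm : Odd m) (hn : Odd n)
    (hxm : gstar Hx = Hlam ^ m * Hx) (hyn : gstar Hy = Hlam ^ n * Hy) :
    ∃ u v : Dˣ, IsFreePair u v ∧ (u : D) * invol (u : D) = 1 ∧ (v : D) * invol (v : D) = 1 := by
  have h2 : (2 : k) ≠ 0 := Ring.two_ne_zero hchar
  obtain ⟨K, _, _, s, t, U, V, hind, hfree, hU, hV⟩ := exists_field_isFreePair_repAlg h2 hm hn
  have hφ0 : ∀ g : Heisenberg, φ (1 + MonoidAlgebra.of k _ g) ≠ 0 := fun g =>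
    (map_ne_zero_iff φ hφinj).mpr (one_add_of_ne_zero h2 g)
  have hinvol_one : invol 1 = 1 := by
    have h := hinvol_mul 1 (invol 1)
    rw [one_mul, hinvol_invol, one_mul] at h
    exact h.symm
  have hinvol : ∀ g : Heisenberg, invol (φ (1 + MonoidAlgebra.of k _ g)) =
      φ (1 + MonoidAlgebra.of k _ (gstar g)) := by
    intro g
    rw [map_add, map_add, map_one, hinvol_one, hinduced, map_add, map_one]
  have hunitary : ∀ (g : Heisenberg) (i : ℤ), Commute Hlam g → gstar g = Hlam ^ i * g →
      (φ (1 + MonoidAlgebra.of k _ (Hlam ^ i * g)))⁻¹ * φ (1 + MonoidAlgebra.of k _ g) *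
        invol ((φ (1 + MonoidAlgebra.of k _ (Hlam ^ i * g)))⁻¹ *
          φ (1 + MonoidAlgebra.of k _ g)) = 1 := by
    intro g i hg hgi
    refine mul_involution_eq_one hinvol_mul (hφ0 _) (hφ0 _)
      ((commute_one_add_of_Hlam_zpow_mul k hg i).map φ) ?_ ?_
    · rw [hinvol, hgi]
    · rw [hinvol, ← hgi, hgstar_invol]
  refine ⟨(Units.mk0 _ (hφ0 (Hlam ^ m * Hx)))⁻¹ * Units.mk0 _ (hφ0 Hx),
    (Units.mk0 _ (hφ0 (Hlam ^ n * Hy)))⁻¹ * Units.mk0 _ (hφ0 Hy), ?_, ?_, ?_⟩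
  · refine isFreePair_of_repAlg hφinj
      (fun c b hb =>
        exists_mul_eq_mul_of_involution hφinj hquot hinvol_mul hinvol_invol hinduced hb)
      hind hfree (one_add_of_ne_zero h2 _) (one_add_of_ne_zero h2 _) (one_add_of_ne_zero h2 _)
      (one_add_of_ne_zero h2 _) ?_ ?_ hU hV
    · exact mul_inv_cancel_left₀ (hφ0 _) _
    · exact mul_inv_cancel_left₀ (hφ0 _) _
  · simpa using hunitary Hx m commute_Hlam_Hx hxm
  · simpa using hunitary Hy n commute_Hlam_Hy hyn
end

section
/- Let D be a division ring of quotients of the first Weyl algebra over ℚ, with generators s, t ∈ D satisfying st − ts = 1, and let * be a ℚ-involution on D with s* = t and t* = s. Then 1 + (ts+1)² ≠ 0 and 1 − sts + tst ≠ 0 in D, and, setting u = (1 + (ts)²)·(1 + (ts+1)²)⁻¹ and v = (1 + sts − tst)·(1 − sts + tst)⁻¹, the elements u and v⁻¹uv are both symmetric (u* = u and (v⁻¹uv)* = v⁻¹uv) and form a free pair in the multiplicative group D^×. -/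
section FreePairProof

open Polynomial

section SkewEval

variable {R E E' : Type*} [CommRing R] [Ring E] [Ring E'] [Algebra R E] [Algebra R E']

/-- The element `∑ cₖ(x) sᵏ` attached to a polynomial `∑ cₖ Yᵏ` with coefficients in `R[X]`;
all coefficients are written to the left of the powers of `s`. -/
noncomputable def skewEval (x s : E) (p : R[X][X]) : E :=
  p.eval₂ (aeval x : R[X] →ₐ[R] E).toRingHom s

theorem skewEval_add (x s : E) (p q : R[X][X]) :
    skewEval x s (p + q) = skewEval x s p + skewEval x s q :=
  eval₂_add _ _

theorem skewEval_zero (x s : E) : skewEval x s (0 : R[X][X]) = 0 :=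
  eval₂_zero _ _

theorem skewEval_one (x s : E) : skewEval x s (1 : R[X][X]) = 1 :=
  eval₂_one _ _

theorem skewEval_C (x s : E) (a : R[X]) : skewEval x s (C a) = aeval x a :=
  eval₂_C _ _

theorem skewEval_X (x s : E) : skewEval x s (X : R[X][X]) = s :=
  eval₂_X _ _

theorem skewEval_monomial (x s : E) (k : ℕ) (a : R[X]) :
    skewEval x s (monomial k a) = aeval x a * s ^ k :=
  eval₂_monomial _ _

theorem skewEval_mul_X (x s : E) (p : R[X][X]) :
    skewEval x s (p * X) = skewEval x s p * s :=
  eval₂_mul_X _ _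

theorem skewEval_mul_X_pow (x s : E) (p : R[X][X]) (k : ℕ) :
    skewEval x s (p * X ^ k) = skewEval x s p * s ^ k := by
  induction k with
  | zero => simp
  | succ k ih => rw [pow_succ, ← mul_assoc, skewEval_mul_X, ih, pow_succ, mul_assoc]

theorem skewEval_C_mul (x s : E) (a : R[X]) (p : R[X][X]) :
    skewEval x s (C a * p) = aeval x a * skewEval x s p := by
  induction p using Polynomial.induction_on' with
  | add p q hp hq => rw [mul_add, skewEval_add, hp, hq, skewEval_add, mul_add]
  | monomial k b => rw [C_mul_monomial, skewEval_monomial, skewEval_monomial, map_mul, mul_assoc]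

/-- Evaluation as an additive map. -/
noncomputable def skewEvalHom (x s : E) : R[X][X] →+ E where
  toFun := skewEval x s
  map_zero' := skewEval_zero x s
  map_add' := skewEval_add x s

theorem map_skewEval (f : E →+* E') (hf : f.comp (algebraMap R E) = algebraMap R E')
    (x s : E) (p : R[X][X]) : f (skewEval x s p) = skewEval (f x) (f s) p := by
  unfold skewEval
  rw [hom_eval₂]
  congr 1
  refine Polynomial.ringHom_ext (fun a => ?_) ?_
  · simpa using DFunLike.congr_fun hf a
  · simp

theorem skewEval_map {R' : Type*} [CommRing R'] [Algebra R' E] (f : R →+* R')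
    (hf : (algebraMap R' E).comp f = algebraMap R E) (x s : E) (p : R[X][X]) :
    skewEval x s (p.map (mapRingHom f)) = skewEval x s p := by
  unfold skewEval
  rw [eval₂_map]
  congr 1
  refine Polynomial.ringHom_ext (fun a => ?_) ?_
  · simpa using DFunLike.congr_fun hf a
  · simp

theorem mul_aeval_of_shift {x s : E} (h : s * x = (x + 1) * s) (a : R[X]) :
    s * aeval x a = aeval x (a.comp (X + 1)) * s := by
  induction a using Polynomial.induction_on with
  | C r => simpa using (Algebra.commutes r s).symm
  | add p q hp hq => simp only [map_add, mul_add, add_comp, add_mul, hp, hq]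
  | monomial n r ih =>
    have hX : aeval x (X + 1 : R[X]) = x + 1 := by simp
    rw [pow_succ, ← mul_assoc, map_mul, ← mul_assoc, ih, mul_comp _ X, map_mul, X_comp, aeval_X, hX,
      mul_assoc, h, mul_assoc]

theorem exists_skewEval_eq_mul {x s : E} (h : s * x = (x + 1) * s) (p q : R[X][X]) :
    ∃ r : R[X][X], skewEval x s r = skewEval x s p * skewEval x s q := by
  have hs : ∀ q : R[X][X], ∃ r : R[X][X], skewEval x s r = s * skewEval x s q := by
    intro q
    induction q using Polynomial.induction_on' with
    | add p q hp hq =>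
      obtain ⟨a, ha⟩ := hp
      obtain ⟨b, hb⟩ := hq
      exact ⟨a + b, by rw [skewEval_add, skewEval_add, ha, hb, mul_add]⟩
    | monomial k b =>
      refine ⟨monomial (k + 1) (b.comp (X + 1)), ?_⟩
      rw [skewEval_monomial, skewEval_monomial, ← mul_assoc, mul_aeval_of_shift h, pow_succ',
        mul_assoc]
  have hs' : ∀ (k : ℕ) (q : R[X][X]), ∃ r : R[X][X], skewEval x s r = s ^ k * skewEval x s q := by
    intro k
    induction k with
    | zero => exact fun q => ⟨q, by simp⟩
    | succ k ih =>
      intro q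
      obtain ⟨a, ha⟩ := hs q
      obtain ⟨b, hb⟩ := ih a
      exact ⟨b, by rw [hb, ha, pow_succ, mul_assoc]⟩
  induction p using Polynomial.induction_on' with
  | add p p' hp hp' =>
    obtain ⟨a, ha⟩ := hp
    obtain ⟨b, hb⟩ := hp'
    exact ⟨a + b, by rw [skewEval_add, skewEval_add, ha, hb, add_mul]⟩
  | monomial k b =>
    obtain ⟨r, hr⟩ := hs' k q
    exact ⟨C b * r, by rw [skewEval_C_mul, hr, skewEval_monomial, mul_assoc]⟩

end SkewEval

section Weyl

variable {D : Type*} [DivisionRing D] [CharZero D]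

theorem eq_zero_of_aeval_eq_zero_of_shift {x s : D} (h : s * x = (x + 1) * s) (hs : s ≠ 0)
    (a : ℤ[X]) (ha : aeval x a = 0) : a = 0 := by
  have key : ∀ (n : ℕ) (a : ℤ[X]), a.natDegree ≤ n → aeval x a = 0 → a = 0 := by
    intro n
    induction n with
    | zero =>
      intro a hn ha
      rw [eq_C_of_natDegree_le_zero hn] at ha ⊢
      simpa using ha
    | succ n ih =>
      intro a hn ha
      have hshift : aeval x (a.comp (X + 1)) = 0 := by
        have := mul_aeval_of_shift h a
        rw [ha, mul_zero] at this
        exact (mul_eq_zero.mp this.symm).resolve_right hs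
      have hconst : a.comp (X + 1) - a = 0 := by
        refine ih _ ?_ (by rw [map_sub, hshift, ha, sub_zero])
        rcases Nat.eq_zero_or_pos a.natDegree with h0 | hpos
        · rw [eq_C_of_natDegree_le_zero h0.le]; simp
        have ha0 : a ≠ 0 := by rintro rfl; simp at hpos
        have hdeg : (a.comp (X + C 1)).degree = a.degree := by
          rw [← taylor_apply, degree_taylor]
        have hlt : (a.comp (X + C 1) - a).degree < (a.comp (X + C 1)).degree :=
          degree_sub_lt_left hdeg
            (by intro h0; rw [h0, degree_zero] at hdeg; exact ha0 (degree_eq_bot.mp hdeg.symm))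
            (by rw [← taylor_apply, leadingCoeff_taylor])
        rw [hdeg] at hlt
        rw [C_1] at hlt
        by_cases h0 : a.comp (X + 1) - a = 0
        · simp [h0]
        · have := natDegree_lt_natDegree h0 hlt
          omega
      have hval : ∀ k : ℕ, a.eval (k : ℤ) = a.eval 0 := by
        intro k
        induction k with
        | zero => simp
        | succ k ihk =>
          have := congrArg (eval (k : ℤ)) (sub_eq_zero.mp hconst)
          simpa [eval_comp, ihk] using this
      have hC : a = C (a.eval 0) := by
        refine Polynomial.eq_of_infinite_eval_eq _ _ ?_
        refine (Set.infinite_range_of_injective (Nat.cast_injective (R := ℤ))).mono ?_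
        rintro _ ⟨k, rfl⟩
        simpa using hval k
      rw [hC] at ha ⊢
      simpa using ha
  exact key _ a le_rfl ha

theorem aeval_mul_pow_commutator {x s : D} (h : s * x = (x + 1) * s) (k : ℕ) (a : ℤ[X]) :
    aeval x a * s ^ k * x = (x + k) * (aeval x a * s ^ k) := by
  have hk : s ^ k * x = (x + k) * s ^ k := by
    induction k with
    | zero => simp
    | succ k ih =>
      rw [pow_succ', mul_assoc, ih, ← mul_assoc, mul_add, h, (Nat.cast_commute k s).symm.eq,
        ← add_mul, mul_assoc]
      push_cast
      congr 1
      abel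
  have hc : Commute (aeval x a) (x + k : D) := by
    have := Commute.all a (X + (k : ℤ[X]))
    simpa using this.map (aeval x)
  rw [mul_assoc, hk, ← mul_assoc, hc.eq, mul_assoc]

theorem skewEval_injective {x s : D} (h : s * x = (x + 1) * s) (hs : s ≠ 0)
    (p : ℤ[X][X]) (hp : skewEval x s p = 0) : p = 0 := by
  have comm : ∀ p : ℤ[X][X], skewEval x s p * x - x * skewEval x s p
      = skewEval x s (derivative p * X) := by
    intro p
    induction p using Polynomial.induction_on' with
    | add p q hp hq =>
      rw [derivative_add, add_mul, skewEval_add, skewEval_add, ← hp, ← hq]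
      noncomm_ring
    | monomial k b =>
      rw [skewEval_monomial, aeval_mul_pow_commutator h, derivative_monomial, monomial_mul_X,
        add_mul, add_sub_cancel_left, skewEval_monomial]
      rcases k with _ | k
      · simp
      · simp only [add_tsub_cancel_right, map_mul, map_natCast]
        rw [← mul_assoc, (Nat.cast_commute (k + 1) (aeval x b)).eq]
  have key : ∀ (n : ℕ) (p : ℤ[X][X]), p.natDegree ≤ n → skewEval x s p = 0 → p = 0 := by
    intro n
    induction n with
    | zero =>
      intro p hn hp
      rw [eq_C_of_natDegree_le_zero hn] at hp ⊢
      rw [skewEval_C] at hp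
      rw [eq_zero_of_aeval_eq_zero_of_shift h hs _ hp, C_0]
    | succ n ih =>
      intro p hn hp
      have h1 : skewEval x s (derivative p) = 0 := by
        have := comm p
        rw [hp, skewEval_mul_X] at this
        simpa [hs] using this.symm
      have h2 : derivative p = 0 := ih _ ((natDegree_derivative_le p).trans (by omega)) h1
      rw [eq_C_of_derivative_eq_zero h2] at hp ⊢
      rw [skewEval_C] at hp
      rw [eq_zero_of_aeval_eq_zero_of_shift h hs _ hp, C_0]
  exact key _ p le_rfl hp

end Weyl

section Pairs

variable {E E' : Type*} [Ring E] [Ring E'] [Algebra ℤ E] [Algebra ℤ E']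

theorem exists_skewEval_eq_mul_of_shift {x s : E} {x' s' : E'} (h : s * x = (x + 1) * s)
    (h' : s' * x' = (x' + 1) * s') (p q : ℤ[X][X]) :
    ∃ r : ℤ[X][X], skewEval x s r = skewEval x s p * skewEval x s q ∧
      skewEval x' s' r = skewEval x' s' p * skewEval x' s' q := by
  obtain ⟨r, hr⟩ := exists_skewEval_eq_mul (x := (x, x')) (s := (s, s')) (Prod.ext h h') p q
  have hfst := fun p : ℤ[X][X] =>
    map_skewEval (RingHom.fst E E') (Subsingleton.elim _ _) (x, x') (s, s') p
  have hsnd := fun p : ℤ[X][X] =>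
    map_skewEval (RingHom.snd E E') (Subsingleton.elim _ _) (x, x') (s, s') p
  refine ⟨r, ?_, ?_⟩
  · have := congrArg (RingHom.fst E E') hr
    rwa [map_mul, hfst, hfst, hfst] at this
  · have := congrArg (RingHom.snd E E') hr
    rwa [map_mul, hsnd, hsnd, hsnd] at this

end Pairs

section Fractions

variable {D : Type*} [DivisionRing D] [Algebra ℚ D]

theorem mul_mul_eq_shift {E : Type*} [Ring E] {s t : E} (hst : s * t - t * s = 1) :
    s * (t * s) = (t * s + 1) * s := by
  rw [← mul_assoc, sub_eq_iff_eq_add.mp hst, add_comm]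

theorem ne_zero_of_commutator_eq_one {E : Type*} [Ring E] [Nontrivial E] {s t : E}
    (hst : s * t - t * s = 1) : s ≠ 0 := by
  rintro rfl
  simp at hst

theorem exists_skewEval_eq_mul_pow_mul {E : Type*} [Ring E] {x s a : E} {n m : ℕ} {p : ℤ[X][X]}
    (hp : a * s ^ m * n = skewEval x s p) (n' m' : ℕ) :
    ∃ p' : ℤ[X][X], a * s ^ (m + m') * ((n * n' : ℕ) : E) = skewEval x s p' := by
  refine ⟨C (n' : ℤ[X]) * (p * X ^ m'), ?_⟩
  rw [skewEval_C_mul, skewEval_mul_X_pow, ← hp, map_natCast, (Nat.cast_commute n' _).eq,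
    mul_assoc (a * s ^ m), (Nat.cast_commute n (s ^ m')).eq, pow_add, Nat.cast_mul]
  simp only [mul_assoc]

theorem exists_skewEval_eq_of_mem_adjoin {s t : D} (hst : s * t - t * s = 1) (hs : s ≠ 0)
    {a : D} (ha : a ∈ Algebra.adjoin ℚ ({s, t} : Set D)) :
    ∃ (n m : ℕ) (p : ℤ[X][X]), n ≠ 0 ∧ a * s ^ m * n = skewEval (t * s) s p := by
  have h := mul_mul_eq_shift hst
  have hpow : ∀ (p : ℤ[X][X]) (m : ℕ), ∃ q : ℤ[X][X],
      skewEval (t * s) s p * s ^ m = s ^ m * skewEval (t * s) s q := by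
    have hone : ∀ p : ℤ[X][X], ∃ q : ℤ[X][X],
        skewEval (t * s) s p * s = s * skewEval (t * s) s q := by
      intro p
      induction p using Polynomial.induction_on' with
      | add p q hp hq =>
        obtain ⟨a, ha⟩ := hp
        obtain ⟨b, hb⟩ := hq
        exact ⟨a + b, by rw [skewEval_add, skewEval_add, add_mul, ha, hb, mul_add]⟩
      | monomial k b =>
        refine ⟨monomial k (b.comp (X - 1)), ?_⟩
        rw [skewEval_monomial, skewEval_monomial, ← mul_assoc, mul_aeval_of_shift h, comp_assoc,
          mul_assoc, mul_assoc, ← pow_succ, ← pow_succ']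
        simp
    intro p m
    induction m with
    | zero => exact ⟨p, by simp⟩
    | succ m ih =>
      obtain ⟨q, hq⟩ := ih
      obtain ⟨r, hr⟩ := hone q
      exact ⟨r, by rw [pow_succ, ← mul_assoc, hq, mul_assoc, hr, mul_assoc]⟩
  induction ha using Algebra.adjoin_induction with
  | mem y hy =>
    rcases hy with rfl | rfl
    · exact ⟨1, 0, X, one_ne_zero, by simp [skewEval_X]⟩
    · exact ⟨1, 1, C X, one_ne_zero, by simp [skewEval_C]⟩
  | algebraMap r =>
    refine ⟨r.den, 0, C (C r.num), r.den_ne_zero, ?_⟩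
    rw [skewEval_C, aeval_C, pow_zero, mul_one, ← map_natCast (algebraMap ℚ D), ← map_mul,
      Rat.mul_den_eq_num]
    simp
  | add a b _ _ hab hbb =>
    obtain ⟨n, m, p, hn, hp⟩ := hab
    obtain ⟨n', m', p', hn', hp'⟩ := hbb
    obtain ⟨r, hr⟩ := exists_skewEval_eq_mul_pow_mul hp n' m'
    obtain ⟨r', hr'⟩ := exists_skewEval_eq_mul_pow_mul hp' n m
    rw [add_comm, mul_comm n'] at hr'
    exact ⟨n * n', m + m', r + r', mul_ne_zero hn hn', by
      rw [skewEval_add, ← hr, ← hr', add_mul, add_mul]⟩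
  | mul a b _ _ hab hbb =>
    obtain ⟨n, m, p, hn, hp⟩ := hab
    obtain ⟨n', m', p', hn', hp'⟩ := hbb
    obtain ⟨q, hq⟩ := hpow p' m
    obtain ⟨r, hr⟩ := exists_skewEval_eq_mul h p q
    refine ⟨n' * n, m' + m, r, mul_ne_zero hn' hn, ?_⟩
    rw [hr, ← hp, mul_assoc (a * s ^ m), (Nat.cast_commute n _).eq, ← mul_assoc, mul_assoc a (s ^ m),
      ← hq, ← hp', Nat.cast_mul, pow_add, mul_assoc (b * s ^ m'), (Nat.cast_commute n' (s ^ m)).eq]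
    simp only [mul_assoc]

theorem exists_mul_skewEval_eq {s t : D} (hst : s * t - t * s = 1) (hs : s ≠ 0)
    (hquot : ∀ d : D, ∃ a b : D, a ∈ Algebra.adjoin ℚ ({s, t} : Set D) ∧
      b ∈ Algebra.adjoin ℚ ({s, t} : Set D) ∧ b ≠ 0 ∧ d = a * b⁻¹) (d : D) :
    ∃ p q : ℤ[X][X], skewEval (t * s) s q ≠ 0 ∧
      d * skewEval (t * s) s q = skewEval (t * s) s p := by
  have : CharZero D := algebraRat.charZero D
  obtain ⟨a, b, ha, hb, hb0, rfl⟩ := hquot d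
  obtain ⟨n, m, p, hn, hp⟩ := exists_skewEval_eq_of_mem_adjoin hst hs ha
  obtain ⟨n', m', q, hn', hq⟩ := exists_skewEval_eq_of_mem_adjoin hst hs hb
  obtain ⟨r, hr⟩ := exists_skewEval_eq_mul_pow_mul hp n' m'
  obtain ⟨r', hr'⟩ := exists_skewEval_eq_mul_pow_mul hq n m
  rw [add_comm, mul_comm n'] at hr'
  refine ⟨r, r', ?_, ?_⟩
  · rw [← hr']
    simp [hn, hn', hb0, hs]
  · rw [← hr, ← hr']
    simp only [mul_assoc, inv_mul_cancel_left₀ hb0]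

end Fractions

section Reduction

variable {D M : Type*} [DivisionRing D] [Ring M]

/-- `d` and `m` are the values in `D` and in `M` of the same right fraction, whose denominator
is invertible in `M`. -/
def IsCommonFraction (f : ℤ[X][X] →+ D) (g : ℤ[X][X] →+ M) (d : D) (m : M) : Prop :=
  ∃ p q : ℤ[X][X], IsUnit (g q) ∧ d * f q = f p ∧ m * g q = g p

variable {f : ℤ[X][X] →+ D} {g : ℤ[X][X] →+ M}

theorem IsCommonFraction.eq_one (hf : ∀ p, f p = 0 → p = 0) {m : M}
    (h : IsCommonFraction f g 1 m) : m = 1 := by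
  obtain ⟨p, q, hq, h1, h2⟩ := h
  have : q = p := by
    rw [one_mul] at h1
    exact sub_eq_zero.mp (hf _ (by rw [map_sub, h1, sub_self]))
  subst this
  exact hq.mul_right_cancel (by rw [h2, one_mul])

theorem IsCommonFraction.one (hone : g 1 = 1) : IsCommonFraction f g 1 1 :=
  ⟨1, 1, by simp [hone], one_mul _, one_mul _⟩

theorem exists_ore_of_reduction [CharZero D] (hf : ∀ p, f p = 0 → p = 0)
    (hmul : ∀ p q, ∃ r, f r = f p * f q ∧ g r = g p * g q)
    (hthree : ∀ p, g (3 * p) = 0) (hunit : ∀ p, ¬ 3 ∣ p → IsUnit (g p))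
    [Nontrivial M]
    (hfrac : ∀ d : D, ∃ p q, f q ≠ 0 ∧ d * f q = f p) {b : ℤ[X][X]} (hb : IsUnit (g b))
    (a : ℤ[X][X]) : ∃ p q, IsUnit (g q) ∧ f a * f q = f b * f p ∧ g a * g q = g b * g p := by
  have hlift : ∀ p q, f a * f q = f b * f p → g a * g q = g b * g p := by
    intro p q h
    obtain ⟨r, hr1, hr2⟩ := hmul a q
    obtain ⟨r', hr1', hr2'⟩ := hmul b p
    have : r = r' := sub_eq_zero.mp (hf _ (by rw [map_sub, hr1, hr1', h, sub_self]))
    rw [← hr2, ← hr2', this]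
  have hf3 : ∀ p, f (3 * p) = 3 * f p := by
    intro p
    have : (3 * p : ℤ[X][X]) = 3 • p := by rw [nsmul_eq_mul]; norm_num
    rw [this, map_nsmul, nsmul_eq_mul]; norm_num
  have hfb : f b ≠ 0 := by
    intro h0
    rw [hf b h0, map_zero] at hb
    exact not_isUnit_zero hb
  have key : ∀ (n : ℕ) (p q : ℤ[X][X]), ¬ 3 ∣ q → f a * f (3 ^ n * q) = f b * f p →
      ∃ p, f a * f q = f b * f p := by
    intro n
    induction n with
    | zero => exact fun p q _ h => ⟨p, by simpa using h⟩
    | succ n ih =>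
      intro p q hq h
      have h0 := hlift _ _ h
      rw [pow_succ', mul_assoc, hthree, mul_zero] at h0
      have hp0 : g p = 0 := hb.mul_right_eq_zero.mp h0.symm
      have hp : 3 ∣ p := by
        by_contra hcon
        have := hunit p hcon
        rw [hp0] at this
        exact not_isUnit_zero this
      obtain ⟨p, rfl⟩ := hp
      refine ih p q hq ?_
      have hc : ∀ d : D, Commute (3 : D) d := fun d => Nat.cast_commute 3 d
      rw [pow_succ', mul_assoc, hf3, hf3, ← mul_assoc, ← mul_assoc, ← (hc _).eq, ← (hc _).eq,
        mul_assoc, mul_assoc] at h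
      exact mul_left_cancel₀ three_ne_zero h
  obtain ⟨p, q, hq0, hpq⟩ := hfrac ((f b)⁻¹ * f a)
  have hq : q ≠ 0 := by rintro rfl; exact hq0 (map_zero f)
  have h3 : ¬ IsUnit (3 : ℤ[X][X]) := by
    intro h
    have := hthree 1
    have h' := h.map (constantCoeff.comp constantCoeff : ℤ[X][X] →+* ℤ)
    simp at h'
    have := Int.isUnit_iff.mp h'
    omega
  obtain ⟨n, q, hq3, rfl⟩ := WfDvdMonoid.max_power_factor' hq h3
  obtain ⟨p, hp⟩ := key n p q hq3 (by rw [← hpq, mul_assoc, mul_inv_cancel_left₀ hfb])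
  exact ⟨p, q, hunit q hq3, hp, hlift _ _ hp⟩

theorem IsCommonFraction.mul [CharZero D] (hf : ∀ p, f p = 0 → p = 0)
    (hmul : ∀ p q, ∃ r, f r = f p * f q ∧ g r = g p * g q)
    (hthree : ∀ p, g (3 * p) = 0) (hunit : ∀ p, ¬ 3 ∣ p → IsUnit (g p))
    [Nontrivial M]
    (hfrac : ∀ d : D, ∃ p q, f q ≠ 0 ∧ d * f q = f p) {d d' : D} {m m' : M}
    (h : IsCommonFraction f g d m) (h' : IsCommonFraction f g d' m') :
    IsCommonFraction f g (d * d') (m * m') := by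
  obtain ⟨a, b, hb, h1, h2⟩ := h
  obtain ⟨a', b', hb', h1', h2'⟩ := h'
  obtain ⟨p, q, hq, h3, h4⟩ := exists_ore_of_reduction hf hmul hthree hunit hfrac hb a'
  obtain ⟨r, hr1, hr2⟩ := hmul b' q
  obtain ⟨r', hr1', hr2'⟩ := hmul a p
  refine ⟨r', r, by rw [hr2]; exact hb'.mul hq, ?_, ?_⟩
  · rw [hr1, hr1', mul_assoc, ← mul_assoc d', h1', h3, ← mul_assoc, h1]
  · rw [hr2, hr2', mul_assoc, ← mul_assoc m', h2', h4, ← mul_assoc, h2]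

end Reduction

section PingPong

open Matrix

/-- The image of a letter of a free group word. -/
def letterValue {α G : Type*} [Group G] (x : α → G) (l : α × Bool) : G :=
  bif l.2 then x l.1 else (x l.1)⁻¹

/-- A ping-pong criterion: if, up to scalars killed by a specialization `χ`, all letters
specialize to rank one matrices `C l ⬝ R lᵀ` such that `R l ⬝ C m ≠ 0` unless the letters `l` and
`m` cancel, then the matrices generate a free group. -/
theorem injective_lift_of_rank_one_specialization {α n P K F : Type*} [Fintype n] [DecidableEq n]
    [CommRing P] [CommRing K] [CommRing F] [IsDomain F]
    (φ : P →+* K) (hφ : Function.Injective φ) (χ : P →+* F)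
    (x : α → (Matrix n n K)ˣ) (N : α × Bool → Matrix n n P) (q : α × Bool → P)
    (hN : ∀ l, φ.mapMatrix (N l) = φ (q l) • (letterValue x l).val)
    (hq : ∀ l, χ (q l) = 0) (c r : α × Bool → n → F)
    (hrank : ∀ l, χ.mapMatrix (N l) = vecMulVec (c l) (r l))
    (hdot : ∀ l m : α × Bool, (l.1 = m.1 → l.2 = m.2) → r l ⬝ᵥ c m ≠ 0) :
    Function.Injective (FreeGroup.lift x) := by
  have hc : ∀ l, c l ≠ 0 := fun l h => hdot l l (fun _ => rfl) (by rw [h, dotProduct_zero])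
  have key : ∀ (L : List (α × Bool)) (l : α × Bool), FreeGroup.IsReduced (l :: L) →
      ∃ (A : Matrix n n P) (k : P) (y : n → F), χ k = 0 ∧ y ≠ 0 ∧
        φ.mapMatrix A = φ k • (((l :: L).map (letterValue x)).prod : (Matrix n n K)ˣ).val ∧
        χ.mapMatrix A = vecMulVec (c l) y := by
    intro L
    induction L with
    | nil =>
      intro l _
      refine ⟨N l, q l, r l, hq l, ?_, ?_, hrank l⟩
      · intro h
        exact hdot l l (fun _ => rfl) (by rw [h, zero_dotProduct])
      · simpa using hN l
    | cons m L ih =>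
      intro l hl
      obtain ⟨hlm, hm⟩ := List.isChain_cons_cons.mp hl
      obtain ⟨A, k, y, hk, hy, hA, hχA⟩ := ih m hm
      refine ⟨N l * A, q l * k, (r l ⬝ᵥ c m) • y, by rw [map_mul, hk, mul_zero],
        smul_ne_zero (hdot l m hlm) hy, ?_, ?_⟩
      · rw [map_mul, hN, hA, map_mul, List.map_cons (l := m :: L), List.prod_cons, Units.val_mul,
          smul_mul_assoc, mul_smul_comm, smul_smul]
      · rw [map_mul, hrank, hχA, vecMulVec_mul_vecMulVec]
  rw [injective_iff_map_eq_one]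
  intro w hw
  classical
  rw [← FreeGroup.toWord_eq_nil_iff]
  by_contra hne
  obtain ⟨l, L, hL⟩ := List.exists_cons_of_ne_nil hne
  obtain ⟨A, k, y, hk, hy, hA, hχA⟩ := key L l (hL ▸ FreeGroup.isReduced_toWord)
  have hprod : ((l :: L).map (letterValue x)).prod = 1 := by
    rw [← hw, ← FreeGroup.mk_toWord (x := w), FreeGroup.lift_mk, hL]
    rfl
  have hA' : A = k • 1 := by
    ext i j
    apply hφ
    have := congrFun (congrFun hA i) j
    rw [hprod] at this
    simp only [RingHom.mapMatrix_apply, map_apply, Units.val_one, Matrix.smul_apply, smul_eq_mul] at this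
    rw [this, Matrix.smul_apply, smul_eq_mul, map_mul, one_apply, one_apply]
    split_ifs <;> simp
  obtain ⟨i, hi⟩ := Function.ne_iff.mp (hc l)
  obtain ⟨j, hj⟩ := Function.ne_iff.mp hy
  refine mul_ne_zero hi hj ?_
  have := congrFun (congrFun hχA i) j
  rw [vecMulVec_apply] at this
  rw [← this, hA', RingHom.mapMatrix_apply, map_apply, Matrix.smul_apply, smul_eq_mul, map_mul, hk,
    zero_mul]

end PingPong

section CyclicModel

open Matrix

theorem isUpperTriangular_skewEval {R : Type*} [CommRing R] {A : Type*} [CommRing A] [Algebra R A]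
    {d : Fin 3 → A} {s : Matrix (Fin 3) (Fin 3) A} (hs : s.IsUpperTriangular) (p : R[X][X]) :
    (skewEval (diagonal d) s p).IsUpperTriangular := by
  have hd : ∀ a : R[X], (aeval (diagonal d) a).IsUpperTriangular := by
    intro a
    have : aeval (diagonal d) a = diagonalAlgHom R (aeval d a) := by
      rw [← aeval_algHom_apply]; rfl
    rw [this]
    exact blockTriangular_diagonal _
  have hp : ∀ k, (s ^ k).IsUpperTriangular := by
    intro k
    induction k with
    | zero => rw [pow_zero]; exact blockTriangular_one
    | succ k ih => rw [pow_succ]; exact ih.mul hs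
  induction p using Polynomial.induction_on' with
  | add p q hp hq => rw [skewEval_add]; exact hp.add hq
  | monomial k b => rw [skewEval_monomial]; exact (hd b).mul (hp k)

theorem det_skewEval_of_strictly_upper {R : Type*} [CommRing R] {A : Type*} [CommRing A]
    [Algebra R A] {d : Fin 3 → A} {s : Matrix (Fin 3) (Fin 3) A} (hs : s.IsUpperTriangular)
    (hs0 : ∀ i, s i i = 0) (p : R[X][X]) :
    (skewEval (diagonal d) s p).det = ∏ i, aeval (d i) (p.coeff 0) := by
  rw [det_of_isUpperTriangular (isUpperTriangular_skewEval hs p)]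
  refine Finset.prod_congr rfl fun i _ => ?_
  have hd : aeval (diagonal d) (p.coeff 0) = diagonalAlgHom R (aeval d (p.coeff 0)) := by
    rw [← aeval_algHom_apply]; rfl
  have hmul : (skewEval (diagonal d) s p.divX * s) i i = 0 := by
    rw [mul_apply]
    refine Finset.sum_eq_zero fun j _ => ?_
    rcases lt_trichotomy j i with h | h | h
    · rw [isUpperTriangular_skewEval hs _ h, zero_mul]
    · rw [h, hs0, mul_zero]
    · rw [hs h, mul_zero]
  conv_lhs => rw [← divX_mul_X_add p]
  rw [skewEval_add, skewEval_mul_X, skewEval_C, Matrix.add_apply, hmul, zero_add, hd]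
  simp only [diagonalAlgHom_apply, diagonal_apply_eq]
  exact (aeval_algHom_apply (Pi.evalAlgHom R (fun _ : Fin 3 => A) i) d _).symm

/-- The diagonal matrix representing `x` modulo `3`. -/
noncomputable def cyclicX : Matrix (Fin 3) (Fin 3) (ZMod 3)[X][X] :=
  diagonal ![C X, C X + 1, C X + 2]

/-- The twisted cyclic shift representing `s` modulo `3`. -/
noncomputable def cyclicS : Matrix (Fin 3) (Fin 3) (ZMod 3)[X][X] :=
  !![0, 1, 0; 0, 0, 1; X, 0, 0]

theorem three_eq_zero_of_algebra (A : Type*) [Ring A] [Algebra (ZMod 3) A] : (3 : A) = 0 := by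
  rw [← map_ofNat (algebraMap (ZMod 3) A) 3, show (OfNat.ofNat 3 : ZMod 3) = 0 from rfl, map_zero]

theorem cyclicS_mul_cyclicX : cyclicS * cyclicX = (cyclicX + 1) * cyclicS := by
  have h3 := three_eq_zero_of_algebra (ZMod 3)[X][X]
  ext i j : 1
  fin_cases i <;> fin_cases j <;>
    simp [cyclicS, cyclicX, Matrix.mul_apply, Fin.sum_univ_three, Matrix.add_apply]
  · ring
  · linear_combination -h3

theorem det_skewEval_cyclic_ne_zero {p : (ZMod 3)[X][X]} (hp : p ≠ 0) :
    (skewEval cyclicX cyclicS p).det ≠ 0 := by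
  obtain ⟨k, q, hq, rfl⟩ := WfDvdMonoid.max_power_factor hp (irreducible_X (R := (ZMod 3)[X]))
  rw [X_dvd_iff] at hq
  rw [mul_comm, skewEval_mul_X_pow, det_mul, det_pow]
  refine mul_ne_zero (fun h => ?_) (pow_ne_zero _ ?_)
  · have h0 := congrArg (evalRingHom (0 : (ZMod 3)[X])) h
    rw [map_zero, RingHom.map_det, map_skewEval _ (Subsingleton.elim _ _)] at h0
    have hX : (evalRingHom (0 : (ZMod 3)[X])).mapMatrix cyclicX = diagonal ![X, X + 1, X + 2] := by
      ext i j : 1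
      fin_cases i <;> fin_cases j <;> simp [cyclicX]
    have hS : (evalRingHom (0 : (ZMod 3)[X])).mapMatrix cyclicS = !![0, 1, 0; 0, 0, 1; 0, 0, 0] := by
      ext i j : 1
      fin_cases i <;> fin_cases j <;> simp [cyclicS]
    rw [hX, hS, det_skewEval_of_strictly_upper] at h0
    · obtain ⟨i, -, hi⟩ := Finset.prod_eq_zero_iff.mp h0
      have hd : (![X, X + 1, X + 2] : Fin 3 → (ZMod 3)[X]) i = X + C (i.val : ZMod 3) := by
        fin_cases i <;> simp; rfl
      rw [hd] at hi
      refine hq ((taylor_injective (i.val : ZMod 3)) ?_)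
      rw [taylor_apply, map_zero, ← hi]
      rfl
    · intro i j hij
      fin_cases i <;> fin_cases j <;> simp_all
    · intro i
      fin_cases i <;> rfl
  · simp [cyclicS, det_fin_three]

/-- The evaluation of `ℤ[X][X]` in `3 × 3` matrices over the fraction field. -/
noncomputable def cyclicEval : ℤ[X][X] →+ Matrix (Fin 3) (Fin 3) (FractionRing (ZMod 3)[X][X]) :=
  skewEvalHom ((algebraMap _ (FractionRing (ZMod 3)[X][X])).mapMatrix cyclicX)
    ((algebraMap _ (FractionRing (ZMod 3)[X][X])).mapMatrix cyclicS)

theorem cyclicEval_eq (p : ℤ[X][X]) :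
    cyclicEval p = (algebraMap _ (FractionRing (ZMod 3)[X][X])).mapMatrix
      (skewEval cyclicX cyclicS p) :=
  (map_skewEval _ (Subsingleton.elim _ _) _ _ _).symm

theorem three_dvd_of_map_eq_zero {p : ℤ[X][X]}
    (h : p.map (mapRingHom (Int.castRingHom (ZMod 3))) = 0) : 3 ∣ p := by
  rw [show (3 : ℤ[X][X]) = C (C 3) from rfl, C_dvd_iff_dvd_coeff]
  intro i
  rw [C_dvd_iff_dvd_coeff]
  intro j
  have := congrArg (fun p : (ZMod 3)[X][X] => (p.coeff i).coeff j) h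
  simp only [coeff_map, coe_mapRingHom, coeff_zero, eq_intCast] at this
  exact (ZMod.intCast_zmod_eq_zero_iff_dvd _ 3).mp (by simpa using this)

theorem isUnit_cyclicEval {p : ℤ[X][X]} (hp : ¬ 3 ∣ p) : IsUnit (cyclicEval p) := by
  rw [cyclicEval_eq, isUnit_iff_isUnit_det, ← RingHom.map_det, isUnit_iff_ne_zero,
    ← skewEval_map (Int.castRingHom (ZMod 3)) (Subsingleton.elim _ _)]
  rw [Ne, map_eq_zero_iff _ (IsFractionRing.injective (ZMod 3)[X][X] _)]
  exact det_skewEval_cyclic_ne_zero fun h => hp (three_dvd_of_map_eq_zero h)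

theorem cyclicEval_three_mul (p : ℤ[X][X]) : cyclicEval (3 * p) = 0 := by
  have : (3 * p : ℤ[X][X]) = 3 • p := by rw [nsmul_eq_mul]; norm_num
  rw [this, map_nsmul, nsmul_eq_mul, Nat.cast_ofNat, three_eq_zero_of_algebra, zero_mul]

end CyclicModel

section Specialization

open Matrix

/-- The scaled matrices representing the letters of a word in `u = A B⁻¹` and `v⁻¹ u v`,
where `v = Q Q'⁻¹`. -/
def letterMatrix {R : Type*} [CommRing R] (A B Q Q' : Matrix (Fin 3) (Fin 3) R) :
    Bool × Bool → Matrix (Fin 3) (Fin 3) R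
  | (true, true) => A * adjugate B
  | (true, false) => B * adjugate A
  | (false, true) => Q' * adjugate Q * (A * adjugate B) * (Q * adjugate Q')
  | (false, false) => Q' * adjugate Q * (B * adjugate A) * (Q * adjugate Q')

/-- The scalars by which `letterMatrix` differs from the letters. -/
def letterScalar {R : Type*} [CommRing R] (A B Q Q' : Matrix (Fin 3) (Fin 3) R) :
    Bool × Bool → R
  | (true, true) => B.det
  | (true, false) => A.det
  | (false, true) => Q.det * B.det * Q'.det
  | (false, false) => Q.det * A.det * Q'.det

theorem map_letterMatrix {R R' : Type*} [CommRing R] [CommRing R'] (f : R →+* R')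
    (A B Q Q' : Matrix (Fin 3) (Fin 3) R) (l : Bool × Bool) :
    f.mapMatrix (letterMatrix A B Q Q' l) =
      letterMatrix (f.mapMatrix A) (f.mapMatrix B) (f.mapMatrix Q) (f.mapMatrix Q') l := by
  rcases l with ⟨_ | _, _ | _⟩ <;> simp only [letterMatrix, map_mul, RingHom.map_adjugate]

theorem map_letterScalar {R R' : Type*} [CommRing R] [CommRing R'] (f : R →+* R')
    (A B Q Q' : Matrix (Fin 3) (Fin 3) R) (l : Bool × Bool) :
    f (letterScalar A B Q Q' l) =
      letterScalar (f.mapMatrix A) (f.mapMatrix B) (f.mapMatrix Q) (f.mapMatrix Q') l := by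
  rcases l with ⟨_ | _, _ | _⟩ <;> simp only [letterScalar, map_mul, RingHom.map_det]

theorem adjugate_eq_det_smul_inv {R n : Type*} [CommRing R] [Fintype n] [DecidableEq n]
    (a : (Matrix n n R)ˣ) : adjugate a.val = a.val.det • (a⁻¹).val := by
  have := congrArg (· * (a⁻¹).val) (adjugate_mul a.val)
  simpa [mul_assoc] using this

theorem letterMatrix_eq_smul {R : Type*} [CommRing R] (a b q q' : (Matrix (Fin 3) (Fin 3) R)ˣ)
    (l : Bool × Bool) :
    letterMatrix a.val b.val q.val q'.val l = letterScalar a.val b.val q.val q'.val l •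
      (letterValue (fun c : Bool => if c then a * b⁻¹ else
        (q * q'⁻¹)⁻¹ * (a * b⁻¹) * (q * q'⁻¹)) l).val := by
  rcases l with ⟨_ | _, _ | _⟩ <;>
    simp [letterMatrix, letterScalar, letterValue, adjugate_eq_det_smul_inv, smul_smul, mul_assoc]
  all_goals congr 1; ring

instance fact_neg_one_not_square_mod_three : Fact (∀ r : ZMod 3, r ^ 2 ≠ -1 + 0 * r) :=
  ⟨by decide⟩

/-- The field with nine elements, with `i = ⟨0, 1⟩` a square root of `-1`. -/
abbrev FieldNine : Type := QuadraticAlgebra (ZMod 3) (-1) 0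

/-- The specialization `x ↦ i`, `z ↦ 1 - i`. -/
noncomputable def specialize : (ZMod 3)[X][X] →+* FieldNine :=
  eval₂RingHom (aeval (⟨0, 1⟩ : FieldNine) : (ZMod 3)[X] →ₐ[ZMod 3] FieldNine).toRingHom ⟨1, -1⟩

theorem specialize_cyclicX :
    specialize.mapMatrix cyclicX = !![⟨0, 1⟩, 0, 0; 0, ⟨1, 1⟩, 0; 0, 0, ⟨2, 1⟩] := by
  ext i j : 1
  fin_cases i <;> fin_cases j <;> simp [cyclicX, specialize] <;> decide

theorem specialize_cyclicS :
    specialize.mapMatrix cyclicS = !![0, 1, 0; 0, 0, 1; ⟨1, -1⟩, 0, 0] := by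
  ext i j : 1
  fin_cases i <;> fin_cases j <;> simp [cyclicS, specialize]

/-- The numerator `1 + x²` of `u`. -/
noncomputable def numU : ℤ[X][X] := C (1 + X ^ 2)

/-- The denominator `1 + (x + 1)²` of `u`. -/
noncomputable def denU : ℤ[X][X] := C (1 + (X + 1) ^ 2)

/-- The numerator `(1 + w) s` of `v`, where `w s = (x + 1) s² - x²`. -/
noncomputable def numV : ℤ[X][X] := X + (C (X + 1) * X ^ 2 - C (X ^ 2))

/-- The denominator `(1 - w) s` of `v`, where `w s = (x + 1) s² - x²`. -/
noncomputable def denV : ℤ[X][X] := X - (C (X + 1) * X ^ 2 - C (X ^ 2))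

section Values

variable {E : Type*} [Ring E] [Algebra ℤ E] (x s : E)

theorem skewEval_sub (p q : ℤ[X][X]) : skewEval x s (p - q) = skewEval x s p - skewEval x s q :=
  eval₂_sub _

theorem skewEval_numU : skewEval x s numU = 1 + x ^ 2 := by
  rw [numU, skewEval_C]
  simp

theorem skewEval_denU : skewEval x s denU = 1 + (x + 1) ^ 2 := by
  rw [denU, skewEval_C]
  simp

theorem skewEval_numV : skewEval x s numV = s + ((x + 1) * s ^ 2 - x ^ 2) := by
  rw [numV, skewEval_add, skewEval_sub, skewEval_X, skewEval_mul_X_pow, skewEval_C, skewEval_C]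
  simp

theorem skewEval_denV : skewEval x s denV = s - ((x + 1) * s ^ 2 - x ^ 2) := by
  rw [denV, skewEval_sub, skewEval_sub, skewEval_X, skewEval_mul_X_pow, skewEval_C, skewEval_C]
  simp

end Values

theorem specialize_skewEval (p : ℤ[X][X]) :
    specialize.mapMatrix (skewEval cyclicX cyclicS p) =
      skewEval !![⟨0, 1⟩, 0, 0; 0, ⟨1, 1⟩, 0; 0, 0, ⟨2, 1⟩]
        !![0, 1, 0; 0, 0, 1; ⟨1, -1⟩, 0, 0] p := by
  rw [map_skewEval _ (Subsingleton.elim _ _), specialize_cyclicX, specialize_cyclicS]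

theorem specialize_numU : specialize.mapMatrix (skewEval cyclicX cyclicS numU) =
    !![0, 0, 0; 0, ⟨1, 2⟩, 0; 0, 0, ⟨1, 1⟩] := by
  rw [specialize_skewEval, skewEval_numU]
  decide +kernel

theorem specialize_denU : specialize.mapMatrix (skewEval cyclicX cyclicS denU) =
    !![⟨1, 2⟩, 0, 0; 0, ⟨1, 1⟩, 0; 0, 0, 0] := by
  rw [specialize_skewEval, skewEval_denU]
  decide +kernel

theorem specialize_numV : specialize.mapMatrix (skewEval cyclicX cyclicS numV) =
    !![1, 1, ⟨1, 1⟩; ⟨0, 2⟩, ⟨0, 1⟩, 1; ⟨1, 2⟩, ⟨1, 1⟩, ⟨0, 2⟩] := by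
  rw [specialize_skewEval, skewEval_numV]
  decide +kernel

theorem specialize_denV : specialize.mapMatrix (skewEval cyclicX cyclicS denV) =
    !![2, 1, ⟨2, 2⟩; ⟨0, 1⟩, ⟨0, 2⟩, 1; ⟨1, 2⟩, ⟨2, 2⟩, ⟨0, 1⟩] := by
  rw [specialize_skewEval, skewEval_denV]
  decide +kernel

/-- The columns of the specialized letters. -/
def letterColumn : Bool × Bool → Fin 3 → FieldNine
  | (true, true) => ![0, 0, ⟨2, 2⟩]
  | (true, false) => ![⟨2, 1⟩, 0, 0]
  | (false, true) => ![⟨0, 1⟩ * ⟨2, 2⟩, ⟨0, 1⟩ * ⟨2, 2⟩, ⟨1, 1⟩ * ⟨2, 2⟩]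
  | (false, false) => ![⟨0, 2⟩ * ⟨2, 1⟩, ⟨0, 2⟩ * ⟨2, 1⟩, ⟨1, 1⟩ * ⟨2, 1⟩]

/-- The rows of the specialized letters. -/
def letterRow : Bool × Bool → Fin 3 → FieldNine
  | (true, true) => ![0, 0, 1]
  | (true, false) => ![1, 0, 0]
  | (false, true) => ![⟨0, 1⟩, ⟨2, 2⟩, ⟨1, 1⟩]
  | (false, false) => ![⟨0, 2⟩, ⟨1, 1⟩, ⟨1, 1⟩]

theorem letterRow_dotProduct_letterColumn :
    ∀ l m : Bool × Bool, (l.1 = m.1 → l.2 = m.2) → letterRow l ⬝ᵥ letterColumn m ≠ 0 := by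
  decide +kernel

theorem specialize_letterMatrix (l : Bool × Bool) :
    specialize.mapMatrix (letterMatrix (skewEval cyclicX cyclicS numU)
      (skewEval cyclicX cyclicS denU) (skewEval cyclicX cyclicS numV)
      (skewEval cyclicX cyclicS denV) l) = vecMulVec (letterColumn l) (letterRow l) := by
  rw [map_letterMatrix, specialize_numU, specialize_denU, specialize_numV, specialize_denV]
  rcases l with ⟨_ | _, _ | _⟩ <;> simp only [letterMatrix, adjugate_fin_three_of] <;>
    decide +kernel

theorem specialize_letterScalar (l : Bool × Bool) :
    specialize (letterScalar (skewEval cyclicX cyclicS numU)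
      (skewEval cyclicX cyclicS denU) (skewEval cyclicX cyclicS numV)
      (skewEval cyclicX cyclicS denV) l) = 0 := by
  rw [map_letterScalar, specialize_numU, specialize_denU]
  rcases l with ⟨_ | _, _ | _⟩ <;> simp [letterScalar, det_fin_three]

theorem injective_lift_cyclicEval
    {a b q q' : (Matrix (Fin 3) (Fin 3) (FractionRing (ZMod 3)[X][X]))ˣ}
    (ha : a.val = cyclicEval numU) (hb : b.val = cyclicEval denU)
    (hq : q.val = cyclicEval numV) (hq' : q'.val = cyclicEval denV) :
    Function.Injective (FreeGroup.lift (fun c : Bool => if c then a * b⁻¹ else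
      (q * q'⁻¹)⁻¹ * (a * b⁻¹) * (q * q'⁻¹))) := by
  refine injective_lift_of_rank_one_specialization
    (algebraMap (ZMod 3)[X][X] (FractionRing (ZMod 3)[X][X])) (IsFractionRing.injective _ _)
    specialize _ _ _ (fun l => ?_) specialize_letterScalar _ _ specialize_letterMatrix
    letterRow_dotProduct_letterColumn
  rw [map_letterMatrix, map_letterScalar, ← cyclicEval_eq, ← cyclicEval_eq, ← cyclicEval_eq,
    ← cyclicEval_eq, ← ha, ← hb, ← hq, ← hq', letterMatrix_eq_smul]

end Specialization

section WeylDivisionRing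

theorem IsCommonFraction.of_units {D M : Type*} [DivisionRing D] [Ring M] {f : ℤ[X][X] →+ D}
    {g : ℤ[X][X] →+ M} {p q : ℤ[X][X]} {a b : Dˣ} {a' b' : Mˣ} (ha : a.val = f p)
    (hb : b.val = f q) (ha' : a'.val = g p) (hb' : b'.val = g q) :
    IsCommonFraction f g (a * b⁻¹).val (a' * b'⁻¹).val :=
  ⟨p, q, hb' ▸ b'.isUnit, by simp [← ha, ← hb], by simp [← ha', ← hb']⟩

theorem IsCommonFraction.lift {α D M : Type*} [DivisionRing D] [Ring M] {f : ℤ[X][X] →+ D}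
    {g : ℤ[X][X] →+ M} (hone : IsCommonFraction f g 1 1)
    (hmul : ∀ {d d' : D} {m m' : M}, IsCommonFraction f g d m → IsCommonFraction f g d' m' →
      IsCommonFraction f g (d * d') (m * m')) {a : α → Dˣ} {b : α → Mˣ}
    (h : ∀ c, IsCommonFraction f g (a c).val (b c).val)
    (hinv : ∀ c, IsCommonFraction f g ((a c)⁻¹).val ((b c)⁻¹).val) (w : FreeGroup α) :
    IsCommonFraction f g (FreeGroup.lift a w).val (FreeGroup.lift b w).val := by
  induction w using FreeGroup.induction_on with
  | C1 => simpa using hone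
  | of c => simpa using h c
  | inv_of c _ => simpa using hinv c
  | mul v w hv hw => simpa using hmul hv hw

theorem not_three_dvd {p : ℤ[X][X]} (f : ℤ[X][X] →+* ℤ) (h : ¬ 3 ∣ f p) : ¬ 3 ∣ p :=
  fun hp => h (map_ofNat f 3 ▸ map_dvd f hp)

theorem not_three_dvd_numU : ¬ 3 ∣ numU :=
  not_three_dvd ((evalRingHom 0).comp (evalRingHom 0)) (by simp [numU])

theorem not_three_dvd_denU : ¬ 3 ∣ denU :=
  not_three_dvd ((evalRingHom 0).comp (evalRingHom 0)) (by norm_num [denU])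

theorem not_three_dvd_numV : ¬ 3 ∣ numV :=
  not_three_dvd ((evalRingHom 0).comp (evalRingHom 1)) (by norm_num [numV])

theorem not_three_dvd_denV : ¬ 3 ∣ denV :=
  not_three_dvd ((evalRingHom 0).comp (evalRingHom (-1))) (by norm_num [denV])

theorem exists_skewEval_cyclicEval_eq_mul {D : Type*} [DivisionRing D] {s t : D}
    (hst : s * t - t * s = 1) (p q : ℤ[X][X]) :
    ∃ r, skewEvalHom (t * s) s r = skewEvalHom (t * s) s p * skewEvalHom (t * s) s q ∧
      cyclicEval r = cyclicEval p * cyclicEval q := by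
  refine exists_skewEval_eq_mul_of_shift (mul_mul_eq_shift hst) ?_ p q
  simpa only [map_mul, map_add, map_one] using
    congrArg (algebraMap _ (FractionRing (ZMod 3)[X][X])).mapMatrix cyclicS_mul_cyclicX

variable {D : Type*} [DivisionRing D] [Algebra ℚ D] {s t : D}

theorem skewEval_ne_zero_of_not_three_dvd (hst : s * t - t * s = 1) {p : ℤ[X][X]} (hp : ¬ 3 ∣ p) :
    skewEval (t * s) s p ≠ 0 := by
  have : CharZero D := algebraRat.charZero D
  intro h
  rw [skewEval_injective (mul_mul_eq_shift hst) (ne_zero_of_commutator_eq_one hst) p h] at hp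
  exact hp (dvd_zero _)

theorem isFreePair_of_skewEval (hst : s * t - t * s = 1)
    (hquot : ∀ d : D, ∃ a b : D, a ∈ Algebra.adjoin ℚ ({s, t} : Set D) ∧
      b ∈ Algebra.adjoin ℚ ({s, t} : Set D) ∧ b ≠ 0 ∧ d = a * b⁻¹) {a b q q' : Dˣ}
    (ha : a.val = skewEval (t * s) s numU) (hb : b.val = skewEval (t * s) s denU)
    (hq : q.val = skewEval (t * s) s numV) (hq' : q'.val = skewEval (t * s) s denV) :
    IsFreePair (a * b⁻¹) ((q * q'⁻¹)⁻¹ * (a * b⁻¹) * (q * q'⁻¹)) := by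
  have : CharZero D := algebraRat.charZero D
  have hs := ne_zero_of_commutator_eq_one hst
  obtain ⟨a₃, ha₃⟩ := isUnit_cyclicEval not_three_dvd_numU
  obtain ⟨b₃, hb₃⟩ := isUnit_cyclicEval not_three_dvd_denU
  obtain ⟨q₃, hq₃⟩ := isUnit_cyclicEval not_three_dvd_numV
  obtain ⟨q₃', hq₃'⟩ := isUnit_cyclicEval not_three_dvd_denV
  have hf : ∀ p, skewEvalHom (t * s) s p = 0 → p = 0 :=
    skewEval_injective (mul_mul_eq_shift hst) hs
  have hmul : ∀ {d d' m m'}, IsCommonFraction (skewEvalHom (t * s) s) cyclicEval d m →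
      IsCommonFraction (skewEvalHom (t * s) s) cyclicEval d' m' →
      IsCommonFraction (skewEvalHom (t * s) s) cyclicEval (d * d') (m * m') :=
    IsCommonFraction.mul hf (exists_skewEval_cyclicEval_eq_mul hst) cyclicEval_three_mul
      (fun _ => isUnit_cyclicEval) (exists_mul_skewEval_eq hst hs hquot)
  have hone : IsCommonFraction (skewEvalHom (t * s) s) cyclicEval 1 1 :=
    IsCommonFraction.one (skewEval_one _ _)
  have hu := IsCommonFraction.of_units (f := skewEvalHom (t * s) s) ha hb ha₃ hb₃
  have hu' := IsCommonFraction.of_units (f := skewEvalHom (t * s) s) hb ha hb₃ ha₃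
  have hv := IsCommonFraction.of_units (f := skewEvalHom (t * s) s) hq hq' hq₃ hq₃'
  have hv' := IsCommonFraction.of_units (f := skewEvalHom (t * s) s) hq' hq hq₃' hq₃
  refine (injective_iff_map_eq_one _).mpr fun w hw => ?_
  refine (injective_iff_map_eq_one _).mp (injective_lift_cyclicEval ha₃ hb₃ hq₃ hq₃') w ?_
  have h := IsCommonFraction.lift hone hmul (a := fun c : Bool => if c then a * b⁻¹ else
    (q * q'⁻¹)⁻¹ * (a * b⁻¹) * (q * q'⁻¹)) (b := fun c : Bool => if c then a₃ * b₃⁻¹ else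
    (q₃ * q₃'⁻¹)⁻¹ * (a₃ * b₃⁻¹) * (q₃ * q₃'⁻¹)) (fun c => ?_) (fun c => ?_) w
  · rw [hw] at h
    exact Units.ext (h.eq_one hf)
  · rcases c with _ | _
    · simpa [mul_assoc] using hmul (hmul hv' hu) hv
    · simpa using hu
  · rcases c with _ | _
    · simpa [mul_assoc] using hmul (hmul hv' hu') hv
    · simpa using hu'

end WeylDivisionRing

section Involution

variable {D F : Type*} [DivisionRing D] [FunLike F D D] [AddMonoidHomClass F D D] {σ : F}

theorem antiInvolution_one (hmul : ∀ c d : D, σ (c * d) = σ d * σ c) (hσ : ∀ c, σ (σ c) = c) :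
    σ 1 = 1 := by
  have h0 : σ 1 ≠ 0 := by
    intro h
    have := hσ 1
    rw [h, map_zero] at this
    exact zero_ne_one this
  exact mul_left_cancel₀ h0 (by rw [← hmul, mul_one, mul_one])

theorem antiInvolution_inv (hmul : ∀ c d : D, σ (c * d) = σ d * σ c) (hσ : ∀ c, σ (σ c) = c)
    (c : D) : σ c⁻¹ = (σ c)⁻¹ := by
  rcases eq_or_ne c 0 with rfl | hc
  · simp
  · refine eq_inv_of_mul_eq_one_left ?_
    rw [← hmul, mul_inv_cancel₀ hc, antiInvolution_one hmul hσ]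

end Involution

end FreePairProof

theorem free_symmetric_pair_weyl_swap_involution
    (D : Type*) [DivisionRing D] [Algebra ℚ D]
    (s t : D) (hst : s * t - t * s = 1)
    (hquot : ∀ d : D, ∃ a b : D, a ∈ Algebra.adjoin ℚ ({s, t} : Set D) ∧
      b ∈ Algebra.adjoin ℚ ({s, t} : Set D) ∧ b ≠ 0 ∧ d = a * b⁻¹)
    (invol : D →ₗ[ℚ] D)
    (hinvol_mul : ∀ c d : D, invol (c * d) = invol d * invol c)
    (hinvol_invol : ∀ c : D, invol (invol c) = c)
    (hs : invol s = t) (ht : invol t = s) :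
    (1 + (t * s + 1) ^ 2 ≠ 0) ∧ (1 - s * t * s + t * s * t ≠ 0) ∧
    ∀ u v : D,
      u = (1 + (t * s) ^ 2) * (1 + (t * s + 1) ^ 2)⁻¹ →
      v = (1 + s * t * s - t * s * t) * (1 - s * t * s + t * s * t)⁻¹ →
      invol u = u ∧ invol (v⁻¹ * u * v) = v⁻¹ * u * v ∧
      ∃ U W : Dˣ, (U : D) = u ∧ (W : D) = v⁻¹ * u * v ∧ IsFreePair U W := by
  have hs0 := ne_zero_of_commutator_eq_one hst
  have hshift := mul_mul_eq_shift hst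
  have hN : 1 + (t * s) ^ 2 ≠ 0 := by
    simpa [skewEval_numU] using skewEval_ne_zero_of_not_three_dvd hst not_three_dvd_numU
  have hE : 1 + (t * s + 1) ^ 2 ≠ 0 := by
    simpa [skewEval_denU] using skewEval_ne_zero_of_not_three_dvd hst not_three_dvd_denU
  have hw : (s * t * s - t * s * t) * s = (t * s + 1) * s ^ 2 - (t * s) ^ 2 := by
    rw [pow_two, ← mul_assoc (t * s + 1), ← hshift]
    noncomm_ring
  have hP : (1 + s * t * s - t * s * t) * s = skewEval (t * s) s numV := by
    rw [skewEval_numV, ← hw]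
    noncomm_ring
  have hQ : (1 - s * t * s + t * s * t) * s = skewEval (t * s) s denV := by
    rw [skewEval_denV, ← hw]
    noncomm_ring
  have hP0 : 1 + s * t * s - t * s * t ≠ 0 := left_ne_zero_of_mul <|
    hP.trans_ne (skewEval_ne_zero_of_not_three_dvd hst not_three_dvd_numV)
  have hQ0 : 1 - s * t * s + t * s * t ≠ 0 := left_ne_zero_of_mul <|
    hQ.trans_ne (skewEval_ne_zero_of_not_three_dvd hst not_three_dvd_denV)
  refine ⟨hE, hQ0, fun u v hu hv => ?_⟩
  have hone := antiInvolution_one hinvol_mul hinvol_invol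
  have hinv := antiInvolution_inv hinvol_mul hinvol_invol
  have hu_symm : invol u = u := by
    have hcomm : Commute (1 + (t * s + 1) ^ 2) (1 + (t * s) ^ 2) := by
      refine .add_left (.one_left _) (.add_right (.one_right _) (.pow_pow ?_ _ _))
      exact .add_left (.refl _) (.one_left _)
    rw [hu, hinvol_mul, hinv]
    simp only [map_add, pow_two, hinvol_mul, hone, hs, ht]
    simpa only [pow_two] using hcomm.inv_left₀.eq
  have hv_inv : invol v = v⁻¹ := by
    have hcomm : Commute (1 + s * t * s - t * s * t) (1 - s * t * s + t * s * t) := by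
      unfold Commute SemiconjBy
      noncomm_ring
    have hP' : invol (1 + s * t * s - t * s * t) = 1 - s * t * s + t * s * t := by
      simp only [map_add, map_sub, hinvol_mul, hone, hs, ht, mul_assoc]
      abel
    have hQ' : invol (1 - s * t * s + t * s * t) = 1 + s * t * s - t * s * t := by
      rw [← hP', hinvol_invol]
    rw [hv, hinvol_mul, hinv, hP', hQ', mul_inv_rev, inv_inv]
    exact hcomm.inv_left₀.eq
  refine ⟨hu_symm, ?_, ?_⟩
  · rw [hinvol_mul, hinvol_mul, hinv, hv_inv, hu_symm, inv_inv, mul_assoc]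
  · have hfree := isFreePair_of_skewEval hst hquot
      (a := .mk0 _ hN) (b := .mk0 _ hE) (q := .mk0 _ (mul_ne_zero hP0 hs0))
      (q' := .mk0 _ (mul_ne_zero hQ0 hs0)) (by simp [skewEval_numU]) (by simp [skewEval_denU])
      (by simpa using hP) (by simpa using hQ)
    refine ⟨_, _, ?_, ?_, hfree⟩
    · simp [hu]
    · simp [hu, hv, mul_assoc]
end

section
/- Let D be a division ring of quotients of the first Weyl algebra over ℚ, with generators s, t ∈ D satisfying st − ts = 1, and let * be a ℚ-involution on D with s* = s and t* = −t. Then 1 − ts − st ≠ 0 and 1 + t²s − st² ≠ 0 in D, and, setting u = (1 + ts + st)·(1 − ts − st)⁻¹ and v = (1 − t²s + st²)·(1 + t²s − st²)⁻¹, the elements u and v⁻¹uv are both unitary (u·u* = 1 and (v⁻¹uv)·(v⁻¹uv)* = 1) and form a free pair in the multiplicative group D^×. -/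
section WeylEval

open Polynomial

variable {k R : Type*} [CommRing k] [Ring R] [Algebra k R]

/-- The normally ordered evaluation `∑ qᵢ(s) tⁱ` of a polynomial `∑ qᵢ Xⁱ`. -/
noncomputable def weylEval (k : Type*) {R : Type*} [CommRing k] [Ring R] [Algebra k R] (s t : R) :
    k[X][X] →+ R :=
  eval₂AddMonoidHom (aeval s : k[X] →ₐ[k] R).toRingHom t

theorem weylEval_apply (s t : R) (n : k[X][X]) :
    weylEval k s t n = eval₂ (aeval s : k[X] →ₐ[k] R).toRingHom t n := rfl

theorem weylEval_monomial (s t : R) (i : ℕ) (q : k[X]) :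
    weylEval k s t (monomial i q) = aeval s q * t ^ i := by
  simp [weylEval_apply]

theorem weylEval_C (s t : R) (q : k[X]) : weylEval k s t (C q) = aeval s q := by
  simp [weylEval_apply]

theorem weylEval_one (s t : R) : weylEval k s t 1 = 1 := by
  simp [weylEval_apply]

theorem weylEval_mul_X (s t : R) (n : k[X][X]) :
    weylEval k s t (n * X) = weylEval k s t n * t := by
  simp [weylEval_apply, eval₂_mul_X]

theorem weylEval_C_mul (s t : R) (q : k[X]) (n : k[X][X]) :
    weylEval k s t (C q * n) = aeval s q * weylEval k s t n := by
  induction n using Polynomial.induction_on' with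
  | add p q hp hq => simp only [mul_add, map_add, hp, hq]
  | monomial i r => simp only [C_mul_monomial, weylEval_monomial, map_mul, mul_assoc]

theorem pow_mul_eq_of_weyl {s t : R} (h : s * t - t * s = 1) (i : ℕ) :
    t ^ i * s = s * t ^ i - i * t ^ (i - 1) := by
  induction i with
  | zero => simp
  | succ i ih =>
    have h' : t * s = s * t - 1 := by rw [← h]; abel
    rw [pow_succ, mul_assoc, h', mul_sub, ← mul_assoc, ih]
    rcases i with _ | i
    · simp
    · simp only [Nat.add_sub_cancel, pow_succ]
      push_cast
      noncomm_ring

theorem weylEval_mul_eq {s t : R} (h : s * t - t * s = 1) (n : k[X][X]) :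
    weylEval k s t n * s = weylEval k s t (C X * n - derivative n) := by
  induction n using Polynomial.induction_on' with
  | add p q hp hq =>
    rw [map_add, add_mul, hp, hq, ← map_add]
    congr 1
    simp only [derivative_add]
    ring
  | monomial i r =>
    have e : aeval s r * s = s * aeval s r := by
      have e' : aeval s (r * X) = aeval s (X * r) := by rw [mul_comm]
      simpa only [map_mul, aeval_X] using e'
    rw [map_sub, weylEval_C_mul, weylEval_monomial, derivative_monomial, weylEval_monomial,
      mul_assoc, pow_mul_eq_of_weyl h]
    simp only [aeval_X, map_mul, map_natCast, mul_sub]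
    simp only [← mul_assoc, e]

/-- The subring generated by a Weyl pair consists of the normally ordered expressions. -/
theorem mem_closure_weyl_iff {s t : R} (h : s * t - t * s = 1) (x : R) :
    x ∈ Subring.closure {s, t} ↔ ∃ n, weylEval ℤ s t n = x := by
  constructor
  · intro hx
    suffices H : ∀ n, ∃ m, weylEval ℤ s t m = weylEval ℤ s t n * x by
      obtain ⟨m, hm⟩ := H 1
      exact ⟨m, by rw [hm, weylEval_one, one_mul]⟩
    induction hx using Subring.closure_induction with
    | mem x hx =>
      intro n
      rcases hx with rfl | rfl
      · exact ⟨_, (weylEval_mul_eq h n).symm⟩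
      · exact ⟨_, weylEval_mul_X _ _ n⟩
    | zero => exact fun n => ⟨0, by simp⟩
    | one => exact fun n => ⟨n, by simp⟩
    | add x y _ _ hx hy =>
      intro n
      obtain ⟨a, ha⟩ := hx n
      obtain ⟨b, hb⟩ := hy n
      exact ⟨a + b, by rw [map_add, ha, hb, mul_add]⟩
    | neg x _ hx =>
      intro n
      obtain ⟨a, ha⟩ := hx n
      exact ⟨-a, by rw [map_neg, ha, mul_neg]⟩
    | mul x y _ _ hx hy =>
      intro n
      obtain ⟨a, ha⟩ := hx n
      obtain ⟨b, hb⟩ := hy a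
      exact ⟨b, by rw [hb, ha, mul_assoc]⟩
  · rintro ⟨n, rfl⟩
    have hs : s ∈ Subring.closure {s, t} := Subring.subset_closure (by simp)
    have ht : t ∈ Subring.closure {s, t} := Subring.subset_closure (by simp)
    induction n using Polynomial.induction_on' with
    | add p q hp hq => rw [map_add]; exact add_mem hp hq
    | monomial i q =>
      rw [weylEval_monomial]
      refine mul_mem ?_ (pow_mem ht i)
      induction q using Polynomial.induction_on' with
      | add p q hp hq => rw [map_add]; exact add_mem hp hq
      | monomial j a =>
        rw [aeval_monomial]
        refine mul_mem ?_ (pow_mem hs j)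
        simp

theorem aeval_eq_zero_of_weyl [CharZero R] [NoZeroDivisors R] {s t : R} (h : s * t - t * s = 1)
    (q : ℤ[X]) (hq : aeval s q = 0) : q = 0 := by
  have comm : ∀ p : ℤ[X], aeval s (derivative p) = aeval s p * t - t * aeval s p := by
    intro p
    induction p using Polynomial.induction_on with
    | C a => simp [(Int.cast_commute a t).eq]
    | add p q hp hq => simp only [map_add, hp, hq]; noncomm_ring
    | monomial i a ih =>
      have e : (C a * X ^ (i + 1) : ℤ[X]) = (C a * X ^ i) * X := by ring
      have h' : s * t = t * s + 1 := by rw [← h]; abel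
      rw [e, derivative_mul, map_add, map_mul, ih]
      simp only [derivative_X, mul_one, map_mul (aeval s) _ X, aeval_X]
      rw [mul_assoc _ s t, h']
      noncomm_ring
  induction hd : q.natDegree using Nat.strong_induction_on generalizing q with
  | _ d ih =>
    by_cases h0 : d = 0
    · subst h0
      obtain ⟨a, rfl⟩ := natDegree_eq_zero.1 hd
      simpa using hq
    · have hlt := natDegree_derivative_lt (p := q) (by omega)
      have := ih _ (hd ▸ hlt) (derivative q) (by rw [comm, hq]; simp) rfl
      have := derivative_eq_zero.1 this
      omega

theorem weylEval_injective [CharZero R] [NoZeroDivisors R] {s t : R} (h : s * t - t * s = 1)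
    (n : ℤ[X][X]) (hn : weylEval ℤ s t n = 0) : n = 0 := by
  induction hd : n.natDegree using Nat.strong_induction_on generalizing n with
  | _ d ih =>
    by_cases h0 : d = 0
    · subst h0
      obtain ⟨q, rfl⟩ := natDegree_eq_zero.1 hd
      rw [weylEval_C] at hn
      rw [aeval_eq_zero_of_weyl h q hn, C_0]
    · have hlt := natDegree_derivative_lt (p := n) (by omega)
      have e := weylEval_mul_eq h n
      rw [map_sub, weylEval_C_mul, hn, zero_mul, mul_zero, zero_sub, eq_comm, neg_eq_zero] at e
      have := derivative_eq_zero.1 (ih _ (hd ▸ hlt) (derivative n) e rfl)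
      omega

theorem map_weylEval {S : Type*} [Ring S] (f : R →+* S) (s t : R) (n : ℤ[X][X]) :
    f (weylEval ℤ s t n) = weylEval ℤ (f s) (f t) n := by
  rw [weylEval_apply, hom_eval₂, weylEval_apply]
  congr 1
  ext
  · simp
  · change f (aeval s X) = aeval (f s) X
    simp only [aeval_X]

theorem weylEval_map (s t : R) (n : ℤ[X][X]) :
    weylEval k s t (n.map (mapRingHom (Int.castRingHom k))) = weylEval ℤ s t n := by
  rw [weylEval_apply, eval₂_map, weylEval_apply]
  congr 1
  ext
  · simp
  · change aeval s (map (Int.castRingHom k) X) = aeval s X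
    simp only [map_X, aeval_X]

end WeylEval

section Representation

open Polynomial

/-- The operator `f ↦ X f - df` (with inner variable `X`,
and `d` the derivative in the outer one) by which `s` acts from the right on
`(ZMod 3)[X][X]`. -/
noncomputable def weylOpS : Module.End (ZMod 3) (ZMod 3)[X][X] :=
  LinearMap.mulLeft (ZMod 3) (C X) - derivative.restrictScalars (ZMod 3)

/-- Multiplication by the outer variable, by which `t` acts from the right on
`(ZMod 3)[X][X]`. -/
noncomputable def weylOpT : Module.End (ZMod 3) (ZMod 3)[X][X] :=
  LinearMap.mulLeft (ZMod 3) X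

/-- The ring of operators on `(ZMod 3)[X][X]`, acting from the right. -/
def WeylOp : Type := (Module.End (ZMod 3) (ZMod 3)[X][X])ᵐᵒᵖ

noncomputable instance : Ring WeylOp :=
  inferInstanceAs (Ring (Module.End (ZMod 3) (ZMod 3)[X][X])ᵐᵒᵖ)

noncomputable instance : Algebra (ZMod 3) WeylOp :=
  inferInstanceAs (Algebra (ZMod 3) (Module.End (ZMod 3) (ZMod 3)[X][X])ᵐᵒᵖ)

/-- The action of a right operator. -/
noncomputable def weylAct : WeylOp →+ Module.End (ZMod 3) (ZMod 3)[X][X] :=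
  MulOpposite.opAddEquiv.symm.toAddMonoidHom

theorem weylAct_mul (φ ψ : WeylOp) (f : (ZMod 3)[X][X]) :
    weylAct (φ * ψ) f = weylAct ψ (weylAct φ f) := rfl

theorem weylAct_one (f : (ZMod 3)[X][X]) : weylAct 1 f = f := rfl

theorem weylOp_ext {φ ψ : WeylOp} (h : ∀ f, weylAct φ f = weylAct ψ f) : φ = ψ :=
  MulOpposite.unop_injective (LinearMap.ext h)

/-- The operator `weylOpS` as a right operator. -/
noncomputable def weylS : WeylOp := MulOpposite.op weylOpS

/-- The operator `weylOpT` as a right operator. -/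
noncomputable def weylT : WeylOp := MulOpposite.op weylOpT

theorem weylOpS_apply (f : (ZMod 3)[X][X]) : weylOpS f = C X * f - derivative f := rfl

theorem weylOpT_apply (f : (ZMod 3)[X][X]) : weylOpT f = X * f := rfl

theorem weylS_weylT_commutator :
    weylS * weylT - weylT * weylS = 1 := by
  refine weylOp_ext fun f => ?_
  change weylOpT (weylOpS f) - weylOpS (weylOpT f) = f
  simp only [weylOpS_apply, weylOpT_apply, derivative_mul, derivative_X]
  ring

theorem aeval_weylOpS_apply (q : (ZMod 3)[X]) (f : (ZMod 3)[X][X]) (K : ℕ)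
    (hf : f.natDegree ≤ K) :
    (weylAct (aeval weylS q) f).natDegree ≤ K ∧
      (weylAct (aeval weylS q) f).coeff K = q * f.coeff K := by
  induction q using Polynomial.induction_on with
  | C a =>
    have e : weylAct (aeval weylS (C a)) f = a • f := by
      rw [aeval_C]; rfl
    rw [e]
    refine ⟨(natDegree_smul_le _ _).trans hf, ?_⟩
    rw [coeff_smul, smul_eq_C_mul]
  | add p q hp hq =>
    rw [map_add, map_add, LinearMap.add_apply, coeff_add, hp.2, hq.2, add_mul]
    exact ⟨natDegree_add_le_of_degree_le hp.1 hq.1, rfl⟩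
  | monomial i a ih =>
    rw [pow_succ, ← mul_assoc]
    generalize (C a * X ^ i : (ZMod 3)[X]) = r at ih
    have e : weylAct (aeval weylS (r * X)) f =
        C X * weylAct (aeval weylS r) f -
          derivative (weylAct (aeval weylS r) f) := by
      rw [map_mul, aeval_X]; rfl
    rw [e]
    generalize weylAct (aeval weylS r) f = g at ih
    have hd : (derivative g).natDegree ≤ K :=
      (natDegree_derivative_le g).trans (by omega)
    refine ⟨(natDegree_sub_le_of_le ((natDegree_C_mul_le _ _).trans ih.1) hd).trans (by simp), ?_⟩
    rw [coeff_sub, coeff_C_mul, ih.2, coeff_derivative,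
      coeff_eq_zero_of_natDegree_lt (show g.natDegree < K + 1 by omega)]
    ring

theorem weylAct_weylEval_ne_zero {n f : (ZMod 3)[X][X]} (hn : n ≠ 0) (hf : f ≠ 0) :
    weylAct (weylEval (ZMod 3) weylS weylT n) f ≠ 0 := by
  have hpow : ∀ (i : ℕ) g, weylAct (weylT ^ i) g = X ^ i * g := by
    intro i g
    induction i with
    | zero => rw [pow_zero, weylAct_one, pow_zero, one_mul]
    | succ i ih =>
      rw [pow_succ, weylAct_mul, ih, pow_succ', mul_assoc]
      rfl
  have hmon : ∀ i q, weylAct (weylEval (ZMod 3) weylS weylT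
      (monomial i q)) f = X ^ i * weylAct (aeval weylS q) f := by
    intro i q
    rw [weylEval_monomial, weylAct_mul, hpow]
  let ψ : (ZMod 3)[X][X] →+ (ZMod 3)[X][X] :=
    { toFun := fun n => weylAct (weylEval (ZMod 3) weylS weylT n) f
      map_zero' := by simp
      map_add' := by simp }
  have hsum : ψ n = ∑ i ∈ Finset.range (n.natDegree + 1),
      X ^ i * weylAct (aeval weylS (n.coeff i)) f := by
    conv_lhs => rw [n.as_sum_range, map_sum]
    exact Finset.sum_congr rfl fun i _ => hmon i _
  intro h0
  have h1 := congrArg (fun g => coeff g (n.natDegree + f.natDegree)) (hsum.symm.trans h0)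
  simp only [finsetSum_coeff, coeff_zero] at h1
  rw [Finset.sum_eq_single n.natDegree] at h1
  · rw [add_comm, coeff_X_pow_mul, (aeval_weylOpS_apply _ f _ le_rfl).2] at h1
    rcases mul_eq_zero.1 h1 with h | h
    · exact hn (leadingCoeff_eq_zero.1 h)
    · exact hf (leadingCoeff_eq_zero.1 h)
  · intro i hi hne
    have hi' := Finset.mem_range.1 hi
    rw [show n.natDegree + f.natDegree = (n.natDegree - i + f.natDegree) + i by omega,
      coeff_X_pow_mul]
    exact coeff_eq_zero_of_natDegree_lt
      ((aeval_weylOpS_apply _ f _ le_rfl).1.trans_lt (by omega))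
  · intro h
    exact absurd (Finset.self_mem_range_succ _) h

theorem exists_eq_three_mul_of_map_eq_zero {n : ℤ[X][X]}
    (hn : n.map (mapRingHom (Int.castRingHom (ZMod 3))) = 0) : ∃ m, n = C (C 3) * m := by
  change C (C 3) ∣ n
  rw [C_dvd_iff_dvd_coeff]
  intro i
  rw [C_dvd_iff_dvd_coeff]
  intro j
  have h := congrArg (fun p => (p.coeff i).coeff j) hn
  simp only [coeff_map, coe_mapRingHom, coeff_zero, eq_intCast] at h
  exact (ZMod.intCast_zmod_eq_zero_iff_dvd _ 3).1 h

end Representation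

section Fractions

open Polynomial

variable {D E : Type*} [DivisionRing D] [Ring E]

/-- `φ` is a numerator over the central element `c` of a specialization of `d`: the pair
`(d, c⁻¹ φ)` is formally a right fraction `a b⁻¹` of elements of `P` whose denominator has nonzero
second component. -/
def SpecializesTo (P : Subring (D × E)) (d : D) (φ c : E) : Prop :=
  (∃ p ∈ P, p.2 = φ) ∧ (∀ p ∈ P, c * p.2 = p.2 * c) ∧
    ∃ a ∈ P, ∃ b ∈ P, b.2 ≠ 0 ∧ d * b.1 = a.1 ∧ φ * b.2 = c * a.2

theorem SpecializesTo.one [Nontrivial E] (P : Subring (D × E)) : SpecializesTo P 1 1 1 :=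
  ⟨⟨1, one_mem _, rfl⟩, fun p _ => by simp, 1, one_mem _, 1, one_mem _, by simp, by simp, by simp⟩

theorem SpecializesTo.mul {P : Subring (D × E)}
    (hreg : ∀ p ∈ P, p.2 ≠ 0 → ∀ φ, φ * p.2 = 0 → φ = 0)
    (hore : ∀ a ∈ P, ∀ b ∈ P, b.2 ≠ 0 → ∃ c ∈ P, ∃ e ∈ P, e.2 ≠ 0 ∧ a * e = b * c)
    {d₁ d₂ : D} {φ₁ φ₂ c₁ c₂ : E} (h₁ : SpecializesTo P d₁ φ₁ c₁)
    (h₂ : SpecializesTo P d₂ φ₂ c₂) : SpecializesTo P (d₁ * d₂) (φ₁ * φ₂) (c₂ * c₁) := by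
  obtain ⟨⟨p₁, hp₁, rfl⟩, hc₁, a₁, ha₁, b₁, hb₁, hb₁0, hd₁, he₁⟩ := h₁
  obtain ⟨⟨p₂, hp₂, rfl⟩, hc₂, a₂, ha₂, b₂, hb₂, hb₂0, hd₂, he₂⟩ := h₂
  obtain ⟨c, hc, e, he, he0, hace⟩ := hore a₂ ha₂ b₁ hb₁ hb₁0
  have hD : a₂.1 * e.1 = b₁.1 * c.1 := congrArg Prod.fst hace
  have hE : a₂.2 * e.2 = b₁.2 * c.2 := congrArg Prod.snd hace
  refine ⟨⟨p₁ * p₂, mul_mem hp₁ hp₂, rfl⟩, fun p hp => ?_, a₁ * c, mul_mem ha₁ hc, b₂ * e,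
    mul_mem hb₂ he, fun h => hb₂0 (hreg e he he0 _ h), ?_, ?_⟩
  · rw [mul_assoc, hc₁ p hp, ← mul_assoc, hc₂ p hp, mul_assoc]
  · calc d₁ * d₂ * (b₂.1 * e.1) = d₁ * (d₂ * b₂.1) * e.1 := by simp only [mul_assoc]
      _ = (d₁ * b₁.1) * c.1 := by rw [hd₂, mul_assoc, hD, mul_assoc]
      _ = a₁.1 * c.1 := by rw [hd₁]
  · calc p₁.2 * p₂.2 * (b₂.2 * e.2) = p₁.2 * (p₂.2 * b₂.2) * e.2 := by simp only [mul_assoc]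
      _ = (p₁.2 * c₂) * (a₂.2 * e.2) := by rw [he₂]; simp only [mul_assoc]
      _ = c₂ * ((p₁.2 * b₁.2) * c.2) := by rw [← hc₂ p₁ hp₁, hE]; simp only [mul_assoc]
      _ = c₂ * c₁ * (a₁.2 * c.2) := by rw [he₁]; simp only [mul_assoc]

theorem SpecializesTo.eq_of_one {P : Subring (D × E)}
    (hker : ∀ p ∈ P, p.1 = 0 → p.2 = 0)
    (hreg : ∀ p ∈ P, p.2 ≠ 0 → ∀ φ, φ * p.2 = 0 → φ = 0)
    {φ c : E} (h : SpecializesTo P 1 φ c) : φ = c := by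
  obtain ⟨-, -, a, ha, b, hb, hb0, hd, he⟩ := h
  have hab : b.2 = a.2 := by
    rw [← sub_eq_zero]
    exact hker (b - a) (sub_mem hb ha) (by simpa [sub_eq_zero] using hd)
  rw [← sub_eq_zero]
  refine hreg b hb hb0 _ ?_
  rw [sub_mul, he, hab, sub_self]

/-- The two-component order generated by `s` and `t`: the first component is the integral Weyl
algebra in `D`, the second one its reduction modulo `3`. -/
noncomputable def weylOrder {D : Type*} [DivisionRing D] (s t : D) :
    Subring (D × WeylOp) :=
  Subring.closure {(s, weylS), (t, weylT)}

theorem mem_weylOrder_iff {s t : D} (h : s * t - t * s = 1)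
    (p : D × WeylOp) :
    p ∈ weylOrder s t ↔ ∃ n, weylEval ℤ s t n = p.1 ∧
      weylEval (ZMod 3) weylS weylT
        (n.map (mapRingHom (Int.castRingHom (ZMod 3)))) = p.2 := by
  refine (mem_closure_weyl_iff (s := (s, weylS))
    (t := (t, weylT)) (Prod.ext h weylS_weylT_commutator) p).trans ?_
  refine exists_congr fun n => ?_
  rw [weylEval_map, Prod.ext_iff]
  refine and_congr (Eq.congr_left ?_) (Eq.congr_left ?_)
  · exact map_weylEval (R := D × WeylOp) (S := D) (RingHom.fst D WeylOp) _ _ n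
  · exact map_weylEval (R := D × WeylOp) (S := WeylOp) (RingHom.snd D WeylOp) _ _ n

theorem weylOrder_snd_eq_zero [CharZero D] {s t : D} (h : s * t - t * s = 1)
    (p : D × WeylOp) (hp : p ∈ weylOrder s t)
    (hp1 : p.1 = 0) : p.2 = 0 := by
  obtain ⟨n, hn1, hn2⟩ := (mem_weylOrder_iff h p).1 hp
  have := weylEval_injective h n (hn1.trans hp1)
  rw [← hn2, this, Polynomial.map_zero, map_zero]

theorem weylOrder_snd_injective {s t : D} (h : s * t - t * s = 1)
    (p : D × WeylOp) (hp : p ∈ weylOrder s t)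
    (hp2 : p.2 ≠ 0) (f : (ZMod 3)[X][X]) (hf : weylAct p.2 f = 0) : f = 0 := by
  obtain ⟨n, -, hn⟩ := (mem_weylOrder_iff h p).1 hp
  by_contra hf0
  rw [← hn] at hf
  refine weylAct_weylEval_ne_zero (fun h0 => hp2 ?_) hf0 hf
  rw [← hn, h0, map_zero]

theorem weylOrder_snd_regular {s t : D} (h : s * t - t * s = 1)
    (p : D × WeylOp) (hp : p ∈ weylOrder s t)
    (hp2 : p.2 ≠ 0) (φ : WeylOp) (hφ : φ * p.2 = 0) :
    φ = 0 := by
  refine weylOp_ext fun f => weylOrder_snd_injective h p hp hp2 _ ?_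
  exact congrArg (fun ψ => weylAct ψ f) hφ

theorem weylEval_int_mul (s t : D) (k : ℤ) (n : ℤ[X][X]) :
    weylEval ℤ s t (C (C k) * n) = k * weylEval ℤ s t n := by
  rw [weylEval_C_mul, aeval_C, algebraMap_int_eq, eq_intCast]

theorem weylOrder_ore_of_eval [CharZero D] {s t : D} (h : s * t - t * s = 1)
    {a b : D × WeylOp} (ha : a ∈ weylOrder s t)
    (hb : b ∈ weylOrder s t) (hb2 : b.2 ≠ 0) (c e : ℤ[X][X]) (he : e ≠ 0)
    (hace : a.1 * weylEval ℤ s t e = b.1 * weylEval ℤ s t c) :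
    ∃ c ∈ weylOrder s t, ∃ e ∈ weylOrder s t, e.2 ≠ 0 ∧ a * e = b * c := by
  induction hk : (e.leadingCoeff.leadingCoeff).natAbs using Nat.strong_induction_on
    generalizing c e with
  | _ k ih =>
    have mk : ∀ n, ∃ p ∈ weylOrder s t, p.1 = weylEval ℤ s t n ∧
        p.2 = weylEval (ZMod 3) weylS weylT
          (n.map (mapRingHom (Int.castRingHom (ZMod 3)))) := fun n =>
      ⟨_, (mem_weylOrder_iff h (_, _)).2 ⟨n, rfl, rfl⟩, rfl, rfl⟩
    obtain ⟨p, hp, hp1, hp2⟩ := mk e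
    obtain ⟨q, hq, hq1, hq2⟩ := mk c
    rw [← hp1, ← hq1] at hace
    have hE : a.2 * p.2 = b.2 * q.2 := by
      rw [← sub_eq_zero]
      exact weylOrder_snd_eq_zero h (a * p - b * q)
        (sub_mem (mul_mem ha hp) (mul_mem hb hq)) (sub_eq_zero.2 hace)
    have zero_of : ∀ n : ℤ[X][X],
        weylEval (ZMod 3) weylS weylT
          (n.map (mapRingHom (Int.castRingHom (ZMod 3)))) = 0 → ∃ m, n = C (C 3) * m := by
      intro n hn
      apply exists_eq_three_mul_of_map_eq_zero
      by_contra h0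
      exact weylAct_weylEval_ne_zero h0 (one_ne_zero) (by rw [hn]; rfl)
    by_cases hp0 : p.2 = 0
    · have hq0 : q.2 = 0 := by
        by_contra hq0
        refine hb2 (weylOrder_snd_regular h q hq hq0 _ ?_)
        rw [← hE, hp0, mul_zero]
      obtain ⟨e', rfl⟩ := zero_of e (hp2 ▸ hp0)
      obtain ⟨c', rfl⟩ := zero_of c (hq2 ▸ hq0)
      have he' : e' ≠ 0 := right_ne_zero_of_mul he
      refine ih _ ?_ c' e' he' ?_ rfl
      · have hpos : e'.leadingCoeff.leadingCoeff ≠ 0 := by simpa using he'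
        rw [leadingCoeff_mul, leadingCoeff_C, leadingCoeff_mul, leadingCoeff_C] at hk
        omega
      · rw [hp1, hq1, weylEval_int_mul, weylEval_int_mul, Int.cast_ofNat] at hace
        have h3 : (3 : D) ≠ 0 := by norm_num
        apply mul_left_cancel₀ h3
        have c3 : ∀ x : D, x * 3 = 3 * x := fun x => (Nat.cast_commute 3 x).eq.symm
        rw [← mul_assoc, ← mul_assoc, c3, c3] at hace
        simpa only [mul_assoc] using hace
    · exact ⟨q, hq, p, hp, hp0, Prod.ext hace hE⟩

theorem exists_int_mul_eq_weylEval [Algebra ℚ D] {s t : D} (h : s * t - t * s = 1) {x : D}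
    (hx : x ∈ Algebra.adjoin ℚ ({s, t} : Set D)) :
    ∃ m : ℤ, m ≠ 0 ∧ ∃ n, weylEval ℤ s t n = m * x := by
  suffices H : ∃ m : ℤ, m ≠ 0 ∧ (m : D) * x ∈ Subring.closure {s, t} by
    obtain ⟨m, hm, hn⟩ := H
    exact ⟨m, hm, (mem_closure_weyl_iff h _).1 hn⟩
  induction hx using Algebra.adjoin_induction with
  | mem x hx => exact ⟨1, one_ne_zero, by simpa using Subring.subset_closure hx⟩
  | algebraMap r =>
    refine ⟨r.den, by simp, ?_⟩
    have e : ((r.den : ℤ) : D) * algebraMap ℚ D r = (r.num : ℤ) := by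
      rw [← map_intCast (algebraMap ℚ D), ← map_mul, ← map_intCast (algebraMap ℚ D)]
      congr 1
      rw [Int.cast_natCast, mul_comm, Rat.mul_den_eq_num]
    rw [e]
    exact intCast_mem _ _
  | add x y _ _ hx hy =>
    obtain ⟨m, hm, hx⟩ := hx
    obtain ⟨k, hk, hy⟩ := hy
    refine ⟨m * k, mul_ne_zero hm hk, ?_⟩
    have e : ((m * k : ℤ) : D) * (x + y) = k * (m * x) + m * (k * y) := by
      rw [← mul_assoc, ← mul_assoc, ← Int.cast_mul, ← Int.cast_mul, mul_comm k m, mul_add]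
    rw [e]
    exact add_mem (mul_mem (intCast_mem _ _) hx) (mul_mem (intCast_mem _ _) hy)
  | mul x y _ _ hx hy =>
    obtain ⟨m, hm, hx⟩ := hx
    obtain ⟨k, hk, hy⟩ := hy
    refine ⟨m * k, mul_ne_zero hm hk, ?_⟩
    have e : ((m * k : ℤ) : D) * (x * y) = (m * x) * (k * y) := by
      rw [mul_assoc (m : D) x, ← mul_assoc x, ← (Int.cast_commute k x).eq]
      push_cast
      simp only [mul_assoc]
    rw [e]
    exact mul_mem hx hy

theorem weylOrder_ore [Algebra ℚ D] [CharZero D] {s t : D} (h : s * t - t * s = 1)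
    (hquot : ∀ d : D, ∃ a b : D, a ∈ Algebra.adjoin ℚ ({s, t} : Set D) ∧
      b ∈ Algebra.adjoin ℚ ({s, t} : Set D) ∧ b ≠ 0 ∧ d = a * b⁻¹)
    (a : D × WeylOp) (ha : a ∈ weylOrder s t)
    (b : D × WeylOp)
    (hb : b ∈ weylOrder s t) (hb2 : b.2 ≠ 0) :
    ∃ c ∈ weylOrder s t, ∃ e ∈ weylOrder s t, e.2 ≠ 0 ∧ a * e = b * c := by
  have hb1 : b.1 ≠ 0 := fun h0 => hb2 (weylOrder_snd_eq_zero h b hb h0)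
  obtain ⟨x, y, hx, hy, hy0, hxy⟩ := hquot (b.1⁻¹ * a.1)
  obtain ⟨m, hm, c, hc⟩ := exists_int_mul_eq_weylEval h hx
  obtain ⟨k, hk, e, he⟩ := exists_int_mul_eq_weylEval h hy
  have hx' : b.1 * x = a.1 * y := by
    rw [eq_mul_inv_iff_mul_eq₀ hy0] at hxy
    rw [← hxy, ← mul_assoc, ← mul_assoc, mul_inv_cancel₀ hb1, one_mul]
  refine weylOrder_ore_of_eval h ha hb hb2 (C (C k) * c) (C (C m) * e) ?_ ?_
  · refine mul_ne_zero (by simpa using hm) ?_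
    rintro rfl
    rw [map_zero] at he
    exact mul_ne_zero (Int.cast_ne_zero.2 hk) hy0 he.symm
  · rw [weylEval_int_mul, weylEval_int_mul, hc, he]
    have e1 : ∀ (i j : ℤ) (z w : D), z * (i * (j * w)) = ((i * j : ℤ) : D) * (z * w) := by
      intro i j z w
      rw [← mul_assoc (i : D), ← mul_assoc, ← Int.cast_mul, ← (Int.cast_commute (i * j) z).eq,
        mul_assoc]
    rw [e1, e1, hx', mul_comm m k]

end Fractions

section Letters

open Polynomial

/-- Evaluation of the inner variable at `0`. -/
noncomputable def evalInner : (ZMod 3)[X][X] →+* (ZMod 3)[X] :=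
  mapRingHom (evalRingHom 0)

theorem evalInner_weylS (f : (ZMod 3)[X][X]) :
    evalInner (weylAct weylS f) = -derivative (evalInner f) := by
  change map _ (C X * f - derivative f) = -derivative (map _ f)
  rw [derivative_map]
  simp

theorem evalInner_weylT (f : (ZMod 3)[X][X]) :
    evalInner (weylAct weylT f) = X * evalInner f := by
  change map _ (X * f) = X * map _ f
  simp

theorem evalInner_map_C (g : (ZMod 3)[X]) : evalInner (g.map C) = g := by
  change map _ (map C g) = g
  rw [map_map]
  convert Polynomial.map_id
  ext
  simp

theorem weylOp_three : (3 : WeylOp) = 0 := by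
  have h : (3 : ZMod 3) = 0 := rfl
  rw [← map_ofNat (algebraMap (ZMod 3) WeylOp) 3, h, map_zero]

theorem weylS_mul_weylT : weylS * weylT = weylT * weylS + 1 := by
  rw [← weylS_weylT_commutator]
  abel

variable {D : Type*} [DivisionRing D] {s t : D}

theorem mk_weylS_mem : ((s, weylS) : D × WeylOp) ∈ weylOrder s t :=
  Subring.subset_closure (by simp)

theorem mk_weylT_mem : ((t, weylT) : D × WeylOp) ∈ weylOrder s t :=
  Subring.subset_closure (by simp)

theorem weylOrder_central {c : WeylOp} (hS : c * weylS = weylS * c) (hT : c * weylT = weylT * c)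
    (p : D × WeylOp) (hp : p ∈ weylOrder s t) : c * p.2 = p.2 * c := by
  induction hp using Subring.closure_induction with
  | mem x hx => rcases hx with rfl | rfl <;> assumption
  | zero => simp
  | one => simp
  | add x y _ _ hx hy => rw [Prod.snd_add, mul_add, add_mul, hx, hy]
  | neg x _ hx => rw [Prod.snd_neg, mul_neg, neg_mul, hx]
  | mul x y _ _ hx hy => rw [Prod.snd_mul, ← mul_assoc, hx, mul_assoc, hy, mul_assoc]

theorem weylT_cube_central (p : D × WeylOp) (hp : p ∈ weylOrder s t) :
    weylT ^ 3 * p.2 = p.2 * weylT ^ 3 := by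
  refine weylOrder_central ?_ (Commute.pow_self _ _).eq p hp
  have h := pow_mul_eq_of_weyl weylS_weylT_commutator 3
  rw [h, Nat.cast_ofNat, weylOp_three, zero_mul, sub_zero]

/-- The Euler operator `ts` as a right operator. -/
noncomputable def weylEuler : WeylOp := weylT * weylS

theorem evalInner_weylEuler (f : (ZMod 3)[X][X]) :
    evalInner (weylAct weylEuler f) = -derivative (X * evalInner f) := by
  change evalInner (weylAct weylS (weylAct weylT f)) = _
  rw [evalInner_weylS, evalInner_weylT]

theorem weylEuler_cube_sub_central (p : D × WeylOp) (hp : p ∈ weylOrder s t) :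
    (weylEuler ^ 3 - weylEuler) * p.2 = p.2 * (weylEuler ^ 3 - weylEuler) := by
  have h3 : ∀ x : WeylOp, x + x + x = 0 := fun x => by
    have e : x + x + x = 3 * x := by noncomm_ring
    rw [e, weylOp_three, zero_mul]
  have aux : ∀ x y : WeylOp, y * x = x * y + y →
      (x ^ 3 - x) * y = y * (x ^ 3 - x) := by
    intro x y h
    have h2 : y * x ^ 2 = x ^ 2 * y + x * y + x * y + y := by
      rw [pow_two, ← mul_assoc, h, add_mul, mul_assoc x y, h]
      noncomm_ring
    have h4 : y * x ^ 3 =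
        x ^ 3 * y + x ^ 2 * y + x ^ 2 * y + x ^ 2 * y + x * y + x * y + x * y + y := by
      rw [pow_succ, ← mul_assoc, h2]
      simp only [add_mul, mul_assoc, h]
      noncomm_ring
    rw [mul_sub, h4, h, sub_mul]
    have e1 := h3 (x ^ 2 * y)
    have e2 := h3 (x * y)
    rw [← sub_eq_zero]
    have e : x ^ 3 * y - x * y - (x ^ 3 * y + x ^ 2 * y + x ^ 2 * y + x ^ 2 * y +
          x * y + x * y + x * y + y - (x * y + y)) =
        -(x ^ 2 * y + x ^ 2 * y + x ^ 2 * y) - (x * y + x * y + x * y) := by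
      abel
    rw [e, e1, e2, neg_zero, sub_zero]
  have hS : weylS * weylEuler = weylEuler * weylS + weylS := by
    rw [weylEuler, ← mul_assoc, weylS_mul_weylT]
    noncomm_ring
  have hT : weylEuler * weylT = weylT * weylEuler + weylT := by
    rw [weylEuler, mul_assoc, weylS_mul_weylT]
    noncomm_ring
  refine weylOrder_central (aux _ _ hS) ?_ p hp
  have e := aux (-weylEuler) weylT (by rw [mul_neg, neg_mul, hT]; abel)
  have e' : (-weylEuler) ^ 3 - -weylEuler = -(weylEuler ^ 3 - weylEuler) := by noncomm_ring
  rw [e', neg_mul, mul_neg] at e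
  exact neg_injective e

theorem evalInner_weylEuler_cube_sub (f : (ZMod 3)[X][X]) :
    evalInner (weylAct (weylEuler ^ 3 - weylEuler) f) = 0 := by
  have e : evalInner (weylAct (weylEuler ^ 3 - weylEuler) f) =
      evalInner (weylAct weylEuler (weylAct weylEuler (weylAct weylEuler f))) -
        evalInner (weylAct weylEuler f) := by
    rw [← map_sub]; rfl
  rw [e]
  simp only [evalInner_weylEuler]
  generalize evalInner f = g
  induction g using Polynomial.induction_on' with
  | add p q hp hq =>
    simp only [mul_add, derivative_add, mul_neg, derivative_neg, neg_add] at hp hq ⊢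
    linear_combination hp + hq
  | monomial n a =>
    simp only [X_mul_monomial, derivative_monomial, Nat.add_sub_cancel,
      ← map_neg, ← map_sub]
    rw [monomial_eq_zero_iff]
    have : ∀ a m : ZMod 3, -(-(-(a * m) * m) * m) - -(a * m) = 0 := by decide
    simpa using this a ((n + 1 : ℕ) : ZMod 3)

/-- The Euler operator acts by `-1`, `1`, `0` on the exponents congruent to `0`, `1`, `2`
modulo `3`. -/
theorem evalInner_weylEuler_of_eq {f : (ZMod 3)[X][X]} {a₀ a₁ a₂ : (ZMod 3)[X]}
    (h : evalInner f = expand _ 3 a₀ + X * expand _ 3 a₁ + X ^ 2 * expand _ 3 a₂) :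
    evalInner (weylAct weylEuler f) =
      expand _ 3 (-a₀) + X * expand _ 3 a₁ + X ^ 2 * expand _ 3 0 := by
  have h3 : (3 : (ZMod 3)[X]) = 0 := by exact_mod_cast CharP.cast_eq_zero (ZMod 3)[X] 3
  rw [evalInner_weylEuler, h]
  simp only [derivative_mul, derivative_add, derivative_expand, derivative_X, derivative_X_pow,
    Nat.cast_ofNat, h3, map_neg, map_zero, zero_mul, mul_zero, C_ofNat]
  linear_combination (-X * expand _ 3 a₁ - X ^ 2 * expand _ 3 a₂) * h3

theorem specializesTo_euler [CharZero D] (hst : s * t - t * s = 1) {u : D}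
    (hu : u = (1 + t * s + s * t) * (1 - t * s - s * t)⁻¹) :
    1 - t * s - s * t ≠ 0 ∧ 1 + t * s + s * t ≠ 0 ∧ ∃ c : WeylOp,
      (∀ f, evalInner (weylAct c f) = 0) ∧
      (∃ φ, SpecializesTo (weylOrder s t) u φ c ∧ ∀ f a₀ a₁ a₂,
        evalInner f = expand _ 3 a₀ + X * expand _ 3 a₁ + X ^ 2 * expand _ 3 a₂ →
        evalInner (weylAct φ f) = X ^ 2 * expand _ 3 a₂) ∧
      (∃ φ, SpecializesTo (weylOrder s t) u⁻¹ φ c ∧ ∀ f a₀ a₁ a₂,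
        evalInner f = expand _ 3 a₀ + X * expand _ 3 a₁ + X ^ 2 * expand _ 3 a₂ →
        evalInner (weylAct φ f) = -expand _ 3 a₀) := by
  have hs : ((s, weylS) : D × WeylOp) ∈ weylOrder s t := mk_weylS_mem
  have ht : ((t, weylT) : D × WeylOp) ∈ weylOrder s t := mk_weylT_mem
  have hθ := mul_mem ht hs
  have h3 : ∀ x : WeylOp, x + x + x = 0 := fun x => by
    have e : x + x + x = 3 * x := by noncomm_ring
    rw [e, weylOp_three, zero_mul]
  have hb : (1 - (t, weylT) * (s, weylS) - (s, weylS) * (t, weylT) : D × WeylOp) ∈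
    weylOrder s t := sub_mem (sub_mem (one_mem _) hθ) (mul_mem hs ht)
  have ha : (1 + (t, weylT) * (s, weylS) + (s, weylS) * (t, weylT) : D × WeylOp) ∈
    weylOrder s t := add_mem (add_mem (one_mem _) hθ) (mul_mem hs ht)
  have hb2 : 1 - weylT * weylS - weylS * weylT = weylEuler := by
    rw [weylS_mul_weylT, ← weylEuler, ← sub_eq_zero]
    have e : 1 - weylEuler - (weylEuler + 1) - weylEuler = -(weylEuler + weylEuler + weylEuler) := by
      abel
    rw [e, h3, neg_zero]
  have ha2 : 1 + weylT * weylS + weylS * weylT = -(1 + weylEuler) := by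
    rw [weylS_mul_weylT, ← weylEuler, ← sub_eq_zero]
    have e : 1 + weylEuler + (weylEuler + 1) - -(1 + weylEuler) =
      ((1 + weylEuler) + (1 + weylEuler) + (1 + weylEuler)) := by abel
    rw [e, h3]
  have hb0 : 1 - weylT * weylS - weylS * weylT ≠ 0 := by
    rw [hb2]
    intro h0
    have := evalInner_weylEuler 1
    rw [h0] at this
    simp at this
  have ha0 : 1 + weylT * weylS + weylS * weylT ≠ 0 := by
    rw [ha2]
    intro h0
    have h1 : weylEuler = -1 := by
      rw [neg_eq_zero, add_comm] at h0
      exact eq_neg_of_add_eq_zero_left h0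
    have := evalInner_weylEuler X
    rw [h1] at this
    change evalInner (-X) = _ at this
    have hX : evalInner X = X := by simp [evalInner]
    rw [map_neg, hX, ← pow_two, derivative_X_pow] at this
    have := congrArg (fun p => p.coeff 1) this
    revert this
    simp
    decide
  have hb1 : 1 - t * s - s * t ≠ 0 := fun h => hb0 (weylOrder_snd_eq_zero hst _ hb h)
  have ha1 : 1 + t * s + s * t ≠ 0 := fun h => ha0 (weylOrder_snd_eq_zero hst _ ha h)
  refine ⟨hb1, ha1, weylEuler ^ 3 - weylEuler, evalInner_weylEuler_cube_sub,
    ⟨1 + weylEuler - weylEuler ^ 2 - weylEuler ^ 3, ⟨⟨_, sub_mem (sub_mem (add_mem (one_mem _) hθ)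
      (pow_mem hθ 2)) (pow_mem hθ 3), rfl⟩, weylEuler_cube_sub_central, _, ha, _, hb, hb0, ?_, ?_⟩,
      ?_⟩,
    ⟨weylEuler ^ 2 - weylEuler ^ 3, ⟨⟨_, sub_mem (pow_mem hθ 2) (pow_mem hθ 3), rfl⟩,
      weylEuler_cube_sub_central, _, hb, _, ha, ha0, ?_, ?_⟩, ?_⟩⟩
  · change u * (1 - t * s - s * t) = 1 + t * s + s * t
    rw [hu, inv_mul_cancel_right₀ hb1]
  · change _ * (1 - weylT * weylS - weylS * weylT) = _ * (1 + weylT * weylS + weylS * weylT)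
    rw [hb2, ha2]
    noncomm_ring
  · intro f a₀ a₁ a₂ h
    have h1 := evalInner_weylEuler_of_eq h
    have h2 := evalInner_weylEuler_of_eq h1
    have h4 := evalInner_weylEuler_of_eq h2
    have e : evalInner (weylAct (1 + weylEuler - weylEuler ^ 2 - weylEuler ^ 3) f) =
        evalInner f + evalInner (weylAct weylEuler f) -
          evalInner (weylAct weylEuler (weylAct weylEuler f))
        - evalInner (weylAct weylEuler (weylAct weylEuler (weylAct weylEuler f))) := by
      rw [← map_add, ← map_sub, ← map_sub]; rfl
    rw [e, h, h1, h2, h4]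
    simp only [map_neg, map_zero]
    ring
  · change u⁻¹ * (1 + t * s + s * t) = 1 - t * s - s * t
    rw [hu, mul_inv_rev, inv_inv, inv_mul_cancel_right₀ ha1]
  · change _ * (1 + weylT * weylS + weylS * weylT) = _ * (1 - weylT * weylS - weylS * weylT)
    rw [hb2, ha2]
    noncomm_ring
  · intro f a₀ a₁ a₂ h
    have h1 := evalInner_weylEuler_of_eq h
    have h2 := evalInner_weylEuler_of_eq h1
    have h4 := evalInner_weylEuler_of_eq h2
    have e : evalInner (weylAct (weylEuler ^ 2 - weylEuler ^ 3) f) =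
        evalInner (weylAct weylEuler (weylAct weylEuler f))
        - evalInner (weylAct weylEuler (weylAct weylEuler (weylAct weylEuler f))) := by
      rw [← map_sub, map_sub weylAct, LinearMap.sub_apply]; rfl
    rw [e, h2, h4]
    have h3' : (3 : (ZMod 3)[X]) = 0 := by exact_mod_cast CharP.cast_eq_zero (ZMod 3)[X] 3
    simp only [map_neg, map_zero]
    linear_combination expand _ 3 a₀ * h3'

end Letters

section Words

open Polynomial

variable {D : Type*} [DivisionRing D] {s t : D}

theorem specializesTo_cayley {d : D} {y : WeylOp} {a b p : D × WeylOp}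
    (hp : p ∈ weylOrder s t) (hpy : p.2 = y) (ha : a ∈ weylOrder s t) (ha2 : a.2 = 1 - y)
    (hb : b ∈ weylOrder s t) (hb2 : b.2 = 1 + y) (hy : 1 + y ≠ 0)
    (hc : ∀ p ∈ weylOrder s t, y ^ 3 * p.2 = p.2 * y ^ 3) (hd : d * b.1 = a.1) :
    SpecializesTo (weylOrder s t) d (1 + y - y ^ 2 - y ^ 3) (1 + y ^ 3) := by
  refine ⟨⟨1 + p - p ^ 2 - p ^ 3, sub_mem (sub_mem (add_mem (one_mem _) hp) (pow_mem hp 2))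
    (pow_mem hp 3), by rw [← hpy]; rfl⟩, fun q hq => ?_, a, ha, b, hb, hb2 ▸ hy, hd, ?_⟩
  · rw [add_mul, mul_add, hc q hq, one_mul, mul_one]
  · rw [ha2, hb2, ← sub_eq_zero]
    have e : (1 + y - y ^ 2 - y ^ 3) * (1 + y) - (1 + y ^ 3) * (1 - y) = 3 * (y - y ^ 3) := by
      noncomm_ring
    rw [e, weylOp_three, zero_mul]

theorem evalInner_weylAct_cayley {y : WeylOp} {r : (ZMod 3)[X]}
    (hy : ∀ f, evalInner (weylAct y f) = r * evalInner f) (f : (ZMod 3)[X][X]) :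
    evalInner (weylAct (1 + y - y ^ 2 - y ^ 3) f) = (1 + r - r ^ 2 - r ^ 3) * evalInner f ∧
      evalInner (weylAct (1 + y ^ 3) f) = (1 + r ^ 3) * evalInner f := by
  have e2 : evalInner (weylAct (y ^ 2) f) = r ^ 2 * evalInner f := by
    rw [pow_two, weylAct_mul, hy, hy]; ring
  have e3 : evalInner (weylAct (y ^ 3) f) = r ^ 3 * evalInner f := by
    rw [pow_succ, weylAct_mul, hy, e2]; ring
  constructor
  · simp only [map_sub, map_add, LinearMap.sub_apply, LinearMap.add_apply, weylAct_one, hy, e2, e3]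
    ring
  · simp only [map_add, LinearMap.add_apply, weylAct_one, e3]
    ring

theorem specializesTo_conjugator [CharZero D] (hst : s * t - t * s = 1) {v : D}
    (hv : v = (1 - t ^ 2 * s + s * t ^ 2) * (1 + t ^ 2 * s - s * t ^ 2)⁻¹) :
    1 + t ^ 2 * s - s * t ^ 2 ≠ 0 ∧ 1 - t ^ 2 * s + s * t ^ 2 ≠ 0 ∧
      (∃ φ c, SpecializesTo (weylOrder s t) v φ c ∧ ∀ f,
        evalInner (weylAct φ f) = (1 + X - X ^ 2 - X ^ 3) * evalInner f) ∧
      (∃ φ c, SpecializesTo (weylOrder s t) v⁻¹ φ c ∧ ∀ f,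
        evalInner (weylAct φ f) = (1 - X - X ^ 2 + X ^ 3) * evalInner f ∧
        evalInner (weylAct c f) = (1 - X ^ 3) * evalInner f) := by
  have hs : ((s, weylS) : D × WeylOp) ∈ weylOrder s t := mk_weylS_mem
  have ht : ((t, weylT) : D × WeylOp) ∈ weylOrder s t := mk_weylT_mem
  have hts := mul_mem (pow_mem ht 2) hs
  have hst' := mul_mem hs (pow_mem ht 2)
  have ha := add_mem (sub_mem (one_mem _) hts) hst'
  have hb := sub_mem (add_mem (one_mem _) hts) hst'
  have hT : weylS * weylT ^ 2 = weylT ^ 2 * weylS - weylT := by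
    have e : weylS * weylT ^ 2 - (weylT ^ 2 * weylS - weylT) = 3 * weylT := by
      rw [pow_two, ← mul_assoc, weylS_mul_weylT, add_mul, mul_assoc, weylS_mul_weylT]
      noncomm_ring
    rw [← sub_eq_zero, e, weylOp_three, zero_mul]
  have ha2 : 1 - weylT ^ 2 * weylS + weylS * weylT ^ 2 = 1 - weylT := by rw [hT]; abel
  have hb2 : 1 + weylT ^ 2 * weylS - weylS * weylT ^ 2 = 1 + weylT := by rw [hT]; abel
  have hact : ∀ f, evalInner (weylAct (-weylT) f) = -X * evalInner f := fun f => by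
    rw [map_neg, LinearMap.neg_apply, map_neg, evalInner_weylT, neg_mul]
  have hb0 : 1 + weylT ≠ 0 := fun h => by
    have := evalInner_weylT 1
    rw [eq_neg_of_add_eq_zero_right h, map_neg, LinearMap.neg_apply, weylAct_one, map_neg, map_one,
      mul_one] at this
    simpa using congrArg (eval 0) this
  have ha0 : 1 - weylT ≠ 0 := fun h => by
    have := evalInner_weylT 1
    rw [← sub_eq_zero.1 h, weylAct_one, map_one, mul_one] at this
    simpa using congrArg (eval 0) this
  have hb1 : 1 + t ^ 2 * s - s * t ^ 2 ≠ 0 := fun h =>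
    hb0 (hb2 ▸ weylOrder_snd_eq_zero hst _ hb h)
  have ha1 : 1 - t ^ 2 * s + s * t ^ 2 ≠ 0 := fun h =>
    ha0 (ha2 ▸ weylOrder_snd_eq_zero hst _ ha h)
  refine ⟨hb1, ha1, ⟨_, _, specializesTo_cayley ht rfl ha ha2 hb hb2 hb0 weylT_cube_central ?_,
    fun f => (evalInner_weylAct_cayley evalInner_weylT f).1⟩, ⟨_, _, specializesTo_cayley
    (y := -weylT) (neg_mem ht) rfl hb (hb2.trans (sub_neg_eq_add _ _).symm) ha
    (ha2.trans (sub_eq_add_neg _ _)) (by rwa [← sub_eq_add_neg]) (fun p hp => ?_) ?_,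
    fun f => ?_⟩⟩
  · change v * (1 + t ^ 2 * s - s * t ^ 2) = 1 - t ^ 2 * s + s * t ^ 2
    rw [hv, inv_mul_cancel_right₀ hb1]
  · rw [Odd.neg_pow (by decide), neg_mul, mul_neg, weylT_cube_central p hp]
  · change v⁻¹ * (1 - t ^ 2 * s + s * t ^ 2) = 1 + t ^ 2 * s - s * t ^ 2
    rw [hv, mul_inv_rev, inv_inv, inv_mul_cancel_right₀ ha1]
  · refine ⟨(evalInner_weylAct_cayley hact f).1.trans ?_,
      (evalInner_weylAct_cayley hact f).2.trans ?_⟩ <;> ring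

/-- The polynomial by which `v⁻¹` (on the left of the letter `v⁻¹ u v`) acts; the letter `u`,
encoded by `true`, has no such factor. -/
noncomputable def leftFactor (g : Bool) : (ZMod 3)[X] := if g then 1 else 1 - X - X ^ 2 + X ^ 3

/-- The polynomial by which `v` (on the right of the letter `v⁻¹ u v`) acts; the letter `u`,
encoded by `true`, has no such factor. -/
noncomputable def rightFactor (g : Bool) : (ZMod 3)[X] := if g then 1 else 1 + X - X ^ 2 - X ^ 3

/-- The shape of a nonzero image of the reduction of a letter; the letter `(g, e)` is the `±1`-st
power (`+1` if `e` is true) of `u` or `v⁻¹ u v`. -/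
def IsLetterImage (l : Bool × Bool) (p : (ZMod 3)[X]) : Prop :=
  ∃ h ≠ 0, p = X ^ (if l.2 then 2 else 0) * expand _ 3 h * rightFactor l.1

theorem exists_trisection {l₀ l : Bool × Bool} (hl : l₀.1 = l.1 → l₀.2 = l.2) {p : (ZMod 3)[X]}
    (hp : IsLetterImage l₀ p) : ∃ a₀ a₁ a₂ : (ZMod 3)[X],
      p * leftFactor l.1 = expand _ 3 a₀ + X * expand _ 3 a₁ + X ^ 2 * expand _ 3 a₂ ∧
      (if l.2 then a₂ else a₀) ≠ 0 := by
  obtain ⟨h, h0, rfl⟩ := hp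
  have h3 : (3 : (ZMod 3)[X]) = 0 := by exact_mod_cast CharP.cast_eq_zero (ZMod 3)[X] 3
  have hadd : (1 + X : (ZMod 3)[X]) * h ≠ 0 := mul_ne_zero (by
    rw [add_comm, ← C_1]; exact X_add_C_ne_zero 1) h0
  have hsub : (1 - X : (ZMod 3)[X]) * h ≠ 0 := mul_ne_zero (by
    rw [← neg_ne_zero, neg_sub, ← C_1]; exact X_sub_C_ne_zero 1) h0
  have hmul : (1 - X : (ZMod 3)[X]) * ((1 + X) * h) ≠ 0 := mul_ne_zero (left_ne_zero_of_mul hsub)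
    hadd
  have hX : X * h ≠ 0 := mul_ne_zero X_ne_zero h0
  obtain ⟨g₀, e₀⟩ := l₀
  obtain ⟨g, e⟩ := l
  cases g₀ <;> cases g
  · obtain rfl : e₀ = e := hl rfl
    cases e₀
    · refine ⟨(1 - X) * ((1 + X) * h), 0, 0, ?_, by simpa using hmul⟩
      simp only [leftFactor, rightFactor, map_mul, map_sub, map_add, map_one, map_zero, expand_X,
        Bool.false_eq_true, if_false]
      linear_combination (-X ^ 2 + X ^ 4) * expand _ 3 h * h3
    · refine ⟨0, 0, (1 - X) * ((1 + X) * h), ?_, by simpa using hmul⟩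
      simp only [leftFactor, rightFactor, map_mul, map_sub, map_add, map_one, map_zero, expand_X,
        Bool.false_eq_true, if_false, if_true]
      linear_combination X ^ 2 * (-X ^ 2 + X ^ 4) * expand _ 3 h * h3
  · cases e₀
    · refine ⟨(1 - X) * h, h, -h, ?_, by cases e; exacts [hsub, neg_ne_zero.2 h0]⟩
      simp [leftFactor, rightFactor]
      ring
    · refine ⟨X * h, -(X * h), (1 - X) * h, ?_, by cases e; exacts [hX, hsub]⟩
      simp [leftFactor, rightFactor]
      ring
  · cases e₀
    · refine ⟨(1 + X) * h, -h, -h, ?_, by cases e; exacts [hadd, neg_ne_zero.2 h0]⟩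
      simp [leftFactor, rightFactor]
      ring
    · refine ⟨-(X * h), -(X * h), (1 + X) * h, ?_, by
        cases e; exacts [neg_ne_zero.2 hX, hadd]⟩
      simp [leftFactor, rightFactor]
      ring
  · obtain rfl : e₀ = e := hl rfl
    cases e₀
    · exact ⟨h, 0, 0, by simp [leftFactor, rightFactor], by simpa⟩
    · exact ⟨0, 0, h, by simp [leftFactor, rightFactor], by simpa⟩

theorem IsLetterImage.ne_zero {l : Bool × Bool} {p : (ZMod 3)[X]} (hp : IsLetterImage l p) :
    p ≠ 0 := by
  obtain ⟨h, h0, rfl⟩ := hp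
  refine mul_ne_zero (mul_ne_zero (pow_ne_zero _ X_ne_zero) ?_) fun h1 => ?_
  · rwa [Ne, expand_eq_zero (by norm_num)]
  · have := congrArg (eval 0) h1
    rw [rightFactor] at this
    split_ifs at this <;> simp at this

theorem specializesTo_letter [Algebra ℚ D] [CharZero D] (hst : s * t - t * s = 1)
    (hquot : ∀ d : D, ∃ a b : D, a ∈ Algebra.adjoin ℚ ({s, t} : Set D) ∧
      b ∈ Algebra.adjoin ℚ ({s, t} : Set D) ∧ b ≠ 0 ∧ d = a * b⁻¹) {u v : D}
    (hu : u = (1 + t * s + s * t) * (1 - t * s - s * t)⁻¹)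
    (hv : v = (1 - t ^ 2 * s + s * t ^ 2) * (1 + t ^ 2 * s - s * t ^ 2)⁻¹) (l : Bool × Bool) :
    ∃ φ c, SpecializesTo (weylOrder s t) (cond l.2 (if l.1 then u else v⁻¹ * u * v)
        (if l.1 then u else v⁻¹ * u * v)⁻¹) φ c ∧
      (∀ f, evalInner (weylAct c f) = 0) ∧ ∀ f a₀ a₁ a₂,
        evalInner f * leftFactor l.1 =
          expand _ 3 a₀ + X * expand _ 3 a₁ + X ^ 2 * expand _ 3 a₂ →
        evalInner (weylAct φ f) = X ^ (if l.2 then 2 else 0) *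
          expand _ 3 (if l.2 then a₂ else -a₀) * rightFactor l.1 := by
  have key : ∃ c, (∀ f, evalInner (weylAct c f) = 0) ∧ ∃ φ,
      SpecializesTo (weylOrder s t) (cond l.2 u u⁻¹) φ c ∧ ∀ f a₀ a₁ a₂,
        evalInner f = expand _ 3 a₀ + X * expand _ 3 a₁ + X ^ 2 * expand _ 3 a₂ →
        evalInner (weylAct φ f) = X ^ (if l.2 then 2 else 0) *
          expand _ 3 (if l.2 then a₂ else -a₀) := by
    obtain ⟨-, -, c, hc, ⟨φ, hφ, hφf⟩, ψ, hψ, hψf⟩ := specializesTo_euler hst hu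
    refine ⟨c, hc, ?_⟩
    cases l.2
    · exact ⟨ψ, hψ, fun f a₀ a₁ a₂ h => by simpa using hψf f a₀ a₁ a₂ h⟩
    · exact ⟨φ, hφ, fun f a₀ a₁ a₂ h => by simpa using hφf f a₀ a₁ a₂ h⟩
  obtain ⟨c, hc, φ, hφ, hφf⟩ := key
  cases l.1
  · obtain ⟨-, -, ⟨ψ, e, hψ, hψf⟩, χ, k, hχ, hχf⟩ := specializesTo_conjugator hst hv
    have hmul := SpecializesTo.mul (weylOrder_snd_regular hst) (weylOrder_ore hst hquot)
      (hχ.mul (weylOrder_snd_regular hst) (weylOrder_ore hst hquot) hφ) hψ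
    refine ⟨χ * φ * ψ, e * (c * k), ?_, fun f => ?_, fun f a₀ a₁ a₂ h => ?_⟩
    · convert hmul using 1
      cases l.2
      · simp [mul_assoc]
      · simp
    · rw [weylAct_mul, weylAct_mul, (hχf _).2, hc, mul_zero]
    · rw [weylAct_mul, weylAct_mul, hψf, hφf _ a₀ a₁ a₂ (by
        rw [← h, (hχf _).1, mul_comm]; rfl), mul_comm]
      rfl
  · refine ⟨φ, c, hφ, hc, fun f a₀ a₁ a₂ h => ?_⟩
    rw [hφf f a₀ a₁ a₂ ((mul_one _).symm.trans h)]
    exact (mul_one _).symm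

theorem specializesTo_word [Algebra ℚ D] [CharZero D] (hst : s * t - t * s = 1)
    (hquot : ∀ d : D, ∃ a b : D, a ∈ Algebra.adjoin ℚ ({s, t} : Set D) ∧
      b ∈ Algebra.adjoin ℚ ({s, t} : Set D) ∧ b ≠ 0 ∧ d = a * b⁻¹) {u v : D}
    (hu : u = (1 + t * s + s * t) * (1 - t * s - s * t)⁻¹)
    (hv : v = (1 - t ^ 2 * s + s * t ^ 2) * (1 + t ^ 2 * s - s * t ^ 2)⁻¹)
    (l₀ : Bool × Bool) (L : List (Bool × Bool)) (hL : FreeGroup.IsReduced (l₀ :: L)) :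
    ∃ φ c, SpecializesTo (weylOrder s t)
        (L.map fun l => cond l.2 (if l.1 then u else v⁻¹ * u * v)
          (if l.1 then u else v⁻¹ * u * v)⁻¹).prod φ c ∧
      (L ≠ [] → ∀ f, evalInner (weylAct c f) = 0) ∧
      ∀ f, IsLetterImage l₀ (evalInner f) → evalInner (weylAct φ f) ≠ 0 := by
  induction L generalizing l₀ with
  | nil =>
    have : Nontrivial WeylOp := ⟨1, 0, fun h => one_ne_zero (α := (ZMod 3)[X][X])
      (congrArg (fun φ => weylAct φ 1) h)⟩
    exact ⟨1, 1, .one _, fun h => absurd rfl h, fun f hf => hf.ne_zero⟩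
  | cons l L ih =>
    rw [FreeGroup.IsReduced, List.isChain_cons_cons] at hL
    obtain ⟨φ, c, hφ, hc, hφf⟩ := specializesTo_letter hst hquot hu hv l
    obtain ⟨ψ, e, hψ, -, hψf⟩ := ih l hL.2
    refine ⟨φ * ψ, e * c, ?_, fun _ f => ?_, fun f hf => ?_⟩
    · rw [List.map_cons, List.prod_cons]
      exact hφ.mul (weylOrder_snd_regular hst) (weylOrder_ore hst hquot) hψ
    · rw [weylAct_mul, hc]
    · obtain ⟨a₀, a₁, a₂, h, h0⟩ := exists_trisection hL.1 hf
      rw [weylAct_mul]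
      refine hψf _ ⟨if l.2 then a₂ else -a₀, ?_, hφf f a₀ a₁ a₂ h⟩
      split_ifs at h0 ⊢
      · exact h0
      · exact neg_ne_zero.2 h0

theorem prod_word_ne_one [Algebra ℚ D] [CharZero D] (hst : s * t - t * s = 1)
    (hquot : ∀ d : D, ∃ a b : D, a ∈ Algebra.adjoin ℚ ({s, t} : Set D) ∧
      b ∈ Algebra.adjoin ℚ ({s, t} : Set D) ∧ b ≠ 0 ∧ d = a * b⁻¹) {u v : D}
    (hu : u = (1 + t * s + s * t) * (1 - t * s - s * t)⁻¹)
    (hv : v = (1 - t ^ 2 * s + s * t ^ 2) * (1 + t ^ 2 * s - s * t ^ 2)⁻¹)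
    {L : List (Bool × Bool)} (hL : FreeGroup.IsReduced L) (hne : L ≠ []) :
    (L.map fun l => cond l.2 (if l.1 then u else v⁻¹ * u * v)
      (if l.1 then u else v⁻¹ * u * v)⁻¹).prod ≠ 1 := by
  intro h1
  obtain ⟨l, L, rfl⟩ := List.exists_cons_of_ne_nil hne
  obtain ⟨φ, c, hφ, hc, hφf⟩ := specializesTo_word hst hquot hu hv l (l :: L)
    (List.isChain_cons_cons.2 ⟨fun _ => rfl, hL⟩)
  rw [h1] at hφ
  have hφc := hφ.eq_of_one (weylOrder_snd_eq_zero hst) (weylOrder_snd_regular hst)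
  subst hφc
  let p : (ZMod 3)[X] := X ^ (if l.2 then 2 else 0) * expand _ 3 1 * rightFactor l.1
  exact hφf (p.map C) ((evalInner_map_C p).symm ▸ ⟨1, one_ne_zero, rfl⟩) (hc hne _)

theorem isFreePair_of_prod_ne_one {U W : Dˣ}
    (h : ∀ L : List (Bool × Bool), FreeGroup.IsReduced L → L ≠ [] →
      (L.map fun l => cond l.2 (if l.1 then (U : D) else W)
        (if l.1 then (U : D) else W)⁻¹).prod ≠ 1) : IsFreePair U W := by
  refine (injective_iff_map_eq_one _).2 fun x hx => ?_
  by_contra hne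
  refine h x.toWord FreeGroup.isReduced_toWord (fun h0 => hne (FreeGroup.toWord_eq_nil_iff.1 h0)) ?_
  rw [← FreeGroup.mk_toWord (x := x), FreeGroup.lift_mk] at hx
  have hx' := congrArg (Units.coeHom D) hx
  rw [map_list_prod, map_one, List.map_map] at hx'
  refine (congrArg (fun g => (x.toWord.map g).prod) (funext fun ⟨g, e⟩ => ?_)).trans hx'
  cases g <;> cases e <;> simp

end Words

section Unitary

variable {D : Type*} [DivisionRing D] {σ : D → D}

theorem antihom_one (hmul : ∀ c d, σ (c * d) = σ d * σ c) (hinv : ∀ c, σ (σ c) = c) : σ 1 = 1 := by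
  have := hmul (σ 1) 1
  rw [mul_one, hinv, mul_one] at this
  exact this.symm

theorem antihom_inv (hmul : ∀ c d, σ (c * d) = σ d * σ c) (hinv : ∀ c, σ (σ c) = c) {c : D}
    (hc : c ≠ 0) : σ c⁻¹ = (σ c)⁻¹ := by
  refine eq_inv_of_mul_eq_one_left ?_
  rw [← hmul, mul_inv_cancel₀ hc, antihom_one hmul hinv]

theorem div_mul_antihom_eq_one (hmul : ∀ c d, σ (c * d) = σ d * σ c) (hinv : ∀ c, σ (σ c) = c)
    {a b : D} (ha : a ≠ 0) (hb : b ≠ 0) (hab : a * b = b * a) (h : σ a = b) :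
    (a * b⁻¹) * σ (a * b⁻¹) = 1 := by
  have h' : σ b = a := h ▸ hinv a
  have e : a * b⁻¹ = b⁻¹ * a := by
    rw [eq_inv_mul_iff_mul_eq₀ hb, ← mul_assoc, ← hab, mul_inv_cancel_right₀ hb]
  rw [hmul, antihom_inv hmul hinv hb, h, h', e, mul_assoc, mul_inv_cancel_left₀ ha,
    inv_mul_cancel₀ hb]

theorem conj_mul_antihom_eq_one (hmul : ∀ c d, σ (c * d) = σ d * σ c) (hinv : ∀ c, σ (σ c) = c)
    {u v : D} (hv0 : v ≠ 0) (hu : u * σ u = 1) (hv : v * σ v = 1) :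
    (v⁻¹ * u * v) * σ (v⁻¹ * u * v) = 1 := by
  have h : σ v = v⁻¹ := eq_inv_of_mul_eq_one_right hv
  rw [hmul, hmul, antihom_inv hmul hinv hv0, h, inv_inv, mul_assoc, mul_inv_cancel_left₀ hv0,
    ← mul_assoc, mul_assoc _ u, hu, mul_one, inv_mul_cancel₀ hv0]

end Unitary

theorem free_unitary_pair_weyl_sign_involution
    (D : Type*) [DivisionRing D] [Algebra ℚ D]
    (s t : D) (hst : s * t - t * s = 1)
    (hquot : ∀ d : D, ∃ a b : D, a ∈ Algebra.adjoin ℚ ({s, t} : Set D) ∧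
      b ∈ Algebra.adjoin ℚ ({s, t} : Set D) ∧ b ≠ 0 ∧ d = a * b⁻¹)
    (invol : D →ₗ[ℚ] D)
    (hinvol_mul : ∀ c d : D, invol (c * d) = invol d * invol c)
    (hinvol_invol : ∀ c : D, invol (invol c) = c)
    (hs : invol s = s) (ht : invol t = -t) :
    (1 - t * s - s * t ≠ 0) ∧ (1 + t ^ 2 * s - s * t ^ 2 ≠ 0) ∧
    ∀ u v : D,
      u = (1 + t * s + s * t) * (1 - t * s - s * t)⁻¹ →
      v = (1 - t ^ 2 * s + s * t ^ 2) * (1 + t ^ 2 * s - s * t ^ 2)⁻¹ →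
      u * invol u = 1 ∧ (v⁻¹ * u * v) * invol (v⁻¹ * u * v) = 1 ∧
      ∃ U W : Dˣ, (U : D) = u ∧ (W : D) = v⁻¹ * u * v ∧ IsFreePair U W := by
  have : CharZero D := algebraRat.charZero D
  obtain ⟨hb, ha, -⟩ := specializesTo_euler hst rfl
  obtain ⟨hb', ha', -⟩ := specializesTo_conjugator hst rfl
  have h1 := antihom_one hinvol_mul hinvol_invol
  refine ⟨hb, hb', fun u v hu hv => ?_⟩
  have hu0 : u ≠ 0 := hu ▸ mul_ne_zero ha (inv_ne_zero hb)
  have hv0 : v ≠ 0 := hv ▸ mul_ne_zero ha' (inv_ne_zero hb')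
  have hu1 : u * invol u = 1 := by
    rw [hu]
    refine div_mul_antihom_eq_one hinvol_mul hinvol_invol ha hb (by noncomm_ring) ?_
    rw [map_add, map_add, hinvol_mul, hinvol_mul, h1, hs, ht]
    noncomm_ring
  have hv1 : v * invol v = 1 := by
    rw [hv]
    refine div_mul_antihom_eq_one hinvol_mul hinvol_invol ha' hb' (by noncomm_ring) ?_
    rw [map_add, map_sub, hinvol_mul, hinvol_mul, pow_two, hinvol_mul, h1, hs, ht]
    noncomm_ring
  refine ⟨hu1, conj_mul_antihom_eq_one hinvol_mul hinvol_invol hv0 hu1 hv1, Units.mk0 u hu0,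
    Units.mk0 (v⁻¹ * u * v) (mul_ne_zero (mul_ne_zero (inv_ne_zero hv0) hu0) hv0), rfl, rfl,
    isFreePair_of_prod_ne_one fun _ hL hne => prod_word_ne_one hst hquot hu hv hL hne⟩
end
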